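/- arXiv:1109.3646 — 2 statements merged into one kernel-verified Lean document; each statement's English description precedes it below -/
import Mathlib

section
/- Suppose Y_pr is Zariski dense in Y, Y is G-saturated, and the vanishing ideal of π(Y) in ℂ[V//G] is generated by f_1, …, f_k where k is the codimension of Y in V. Then Y is G-reduced. -/
/-!
Common framework: a "compact Lie group / complex reductive group acting on a
finite-dimensional module" is modelled as a subgroup of invertible `n × n`
matrices over `𝕜 = ℝ` or `ℂ` acting on `Fin n → 𝕜` by `Matrix.mulVec`.
Polynomial functions on the module are `MvPolynomial (Fin n) 𝕜`.
-/

set_option synthInstance.maxHeartbeats 1000000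
set_option maxHeartbeats 1000000

noncomputable section

open MvPolynomial

namespace ZPaper

variable (𝕜 : Type) [RCLike 𝕜] (n : ℕ)

/-- The zero set of a family of polynomials. -/
def zeroSet (S : Set (MvPolynomial (Fin n) 𝕜)) : Set (Fin n → 𝕜) :=
  {v | ∀ p ∈ S, eval v p = 0}

/-- A subset of `𝕜ⁿ` is algebraic if it is the zero set of a family of polynomials. -/
def IsAlgebraicSet (X : Set (Fin n → 𝕜)) : Prop :=
  ∃ S : Set (MvPolynomial (Fin n) 𝕜), X = zeroSet 𝕜 n S

/-- The vanishing ideal `I(X)` of a subset `X ⊆ 𝕜ⁿ`. -/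
def vanishingIdeal (X : Set (Fin n → 𝕜)) : Ideal (MvPolynomial (Fin n) 𝕜) where
  carrier := {p | ∀ x ∈ X, eval x p = 0}
  zero_mem' := by intro x _; simp
  add_mem' := by intro a b ha hb x hx; simp [ha x hx, hb x hx]
  smul_mem' := by intro c p hp x hx; simp [smul_eq_mul, hp x hx]

/-- The Zariski closure of a subset of `𝕜ⁿ`. -/
def zclosure (A : Set (Fin n → 𝕜)) : Set (Fin n → 𝕜) :=
  zeroSet 𝕜 n (vanishingIdeal 𝕜 n A : Set (MvPolynomial (Fin n) 𝕜))

/-- `A` is Zariski dense in `X`: every polynomial vanishing on `A` vanishes on `X`. -/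
def ZDenseIn (A X : Set (Fin n → 𝕜)) : Prop :=
  ∀ p : MvPolynomial (Fin n) 𝕜, (∀ a ∈ A, eval a p = 0) → ∀ x ∈ X, eval x p = 0

/-- A set of matrices is a subgroup of `GL_n(𝕜)`. -/
def IsMatSubgroup (G : Set (Matrix (Fin n) (Fin n) 𝕜)) : Prop :=
  (1 : Matrix (Fin n) (Fin n) 𝕜) ∈ G ∧ (∀ a ∈ G, ∀ b ∈ G, a * b ∈ G) ∧
    ∀ a ∈ G, IsUnit a ∧ a⁻¹ ∈ G

/-- `X` is a `G`-stable subset of `𝕜ⁿ`. -/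
def Stabilizes (G : Set (Matrix (Fin n) (Fin n) 𝕜)) (X : Set (Fin n → 𝕜)) : Prop :=
  ∀ g ∈ G, ∀ x ∈ X, Matrix.mulVec g x ∈ X

/-- A polynomial is `G`-invariant. -/
def Invariant (G : Set (Matrix (Fin n) (Fin n) 𝕜)) (p : MvPolynomial (Fin n) 𝕜) : Prop :=
  ∀ g ∈ G, ∀ v : Fin n → 𝕜, eval (Matrix.mulVec g v) p = eval v p

/-- `I_G(X)`: the ideal generated by the `G`-invariant polynomials vanishing on `X`,
i.e. by `I(X)^G = I(X) ∩ 𝕜[V]^G`. -/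
def invariantIdeal (G : Set (Matrix (Fin n) (Fin n) 𝕜)) (X : Set (Fin n → 𝕜)) :
    Ideal (MvPolynomial (Fin n) 𝕜) :=
  Ideal.span {p | Invariant 𝕜 n G p ∧ ∀ x ∈ X, eval x p = 0}

/-- `X` is `G`-reduced: `I_G(X) = I(X)`. -/
def IsGReduced (G : Set (Matrix (Fin n) (Fin n) 𝕜)) (X : Set (Fin n → 𝕜)) : Prop :=
  invariantIdeal 𝕜 n G X = vanishingIdeal 𝕜 n X

/-- `X` is almost `G`-reduced: `√I_G(X) = I(X)`. -/
def IsAlmostGReduced (G : Set (Matrix (Fin n) (Fin n) 𝕜)) (X : Set (Fin n → 𝕜)) : Prop :=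
  (invariantIdeal 𝕜 n G X).radical = vanishingIdeal 𝕜 n X

/-- The orbit `G·v`. -/
def orbit (G : Set (Matrix (Fin n) (Fin n) 𝕜)) (v : Fin n → 𝕜) : Set (Fin n → 𝕜) :=
  (fun g => Matrix.mulVec g v) '' G

/-- The isotropy group `G_v`. -/
def isotropy (G : Set (Matrix (Fin n) (Fin n) 𝕜)) (v : Fin n → 𝕜) :
    Set (Matrix (Fin n) (Fin n) 𝕜) :=
  {g ∈ G | Matrix.mulVec g v = v}

/-- Matrix exponential. -/
def mexp (A : Matrix (Fin n) (Fin n) 𝕜) : Matrix (Fin n) (Fin n) 𝕜 :=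
  ∑' k : ℕ, ((k.factorial : 𝕜)⁻¹) • A ^ k

/-- The Lie algebra of a matrix group: matrices whose one-parameter subgroup lies in `G`. -/
def lieAlgebra (G : Set (Matrix (Fin n) (Fin n) 𝕜)) : Set (Matrix (Fin n) (Fin n) 𝕜) :=
  {A | ∀ t : 𝕜, mexp 𝕜 n (t • A) ∈ G}

/-- The tangent space `T_v(G·v)` to the orbit, i.e. `𝔤·v`. -/
def orbitTangent (G : Set (Matrix (Fin n) (Fin n) 𝕜)) (v : Fin n → 𝕜) :
    Submodule 𝕜 (Fin n → 𝕜) :=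
  Submodule.span 𝕜 ((fun A => Matrix.mulVec A v) '' lieAlgebra 𝕜 n G)

/-- `N` is a `G_v`-stable complement to `T_v(G·v)` in `𝕜ⁿ` (a slice at `v`). -/
def IsSliceComplement (G : Set (Matrix (Fin n) (Fin n) 𝕜)) (v : Fin n → 𝕜)
    (N : Submodule 𝕜 (Fin n → 𝕜)) : Prop :=
  IsCompl (orbitTangent 𝕜 n G v) N ∧
    ∀ g ∈ isotropy 𝕜 n G v, ∀ x ∈ N, Matrix.mulVec g x ∈ N

/-- The image of `H` in `GL(N)` is trivial. -/
def ActsTriviallyOn (H : Set (Matrix (Fin n) (Fin n) 𝕜))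
    (N : Submodule 𝕜 (Fin n → 𝕜)) : Prop :=
  ∀ g ∈ H, ∀ x ∈ N, Matrix.mulVec g x = x

/-- The image of `H` in `GL(N)` is finite. -/
def HasFiniteImageOn (H : Set (Matrix (Fin n) (Fin n) 𝕜))
    (N : Submodule 𝕜 (Fin n → 𝕜)) : Prop :=
  Set.Finite ((fun g => fun x : N => Matrix.mulVec g (x : Fin n → 𝕜)) '' H)

/-- The orbit `G·v` is (Zariski) closed. -/
def HasClosedOrbit (G : Set (Matrix (Fin n) (Fin n) 𝕜)) (v : Fin n → 𝕜) : Prop :=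
  zclosure 𝕜 n (orbit 𝕜 n G v) ⊆ orbit 𝕜 n G v

/-- `v` lies on a principal orbit: `G·v` is closed and the isotropy group acts trivially on
some (hence any) slice at `v`. -/
def IsPrincipalPt (G : Set (Matrix (Fin n) (Fin n) 𝕜)) (v : Fin n → 𝕜) : Prop :=
  HasClosedOrbit 𝕜 n G v ∧
    ∃ N, IsSliceComplement 𝕜 n G v N ∧ ActsTriviallyOn 𝕜 n (isotropy 𝕜 n G v) N

/-- `v` lies on an almost principal orbit. -/
def IsAlmostPrincipalPt (G : Set (Matrix (Fin n) (Fin n) 𝕜)) (v : Fin n → 𝕜) : Prop :=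
  HasClosedOrbit 𝕜 n G v ∧
    ∃ N, IsSliceComplement 𝕜 n G v N ∧ HasFiniteImageOn 𝕜 n (isotropy 𝕜 n G v) N

/-- The set of principal points `V_pr`. -/
def prPoints (G : Set (Matrix (Fin n) (Fin n) 𝕜)) : Set (Fin n → 𝕜) :=
  {v | IsPrincipalPt 𝕜 n G v}

/-- The set of almost principal points `V_apr`. -/
def aprPoints (G : Set (Matrix (Fin n) (Fin n) 𝕜)) : Set (Fin n → 𝕜) :=
  {v | IsAlmostPrincipalPt 𝕜 n G v}

/-- `π⁻¹(π(Y))`: all points that the invariants cannot separate from `Y`. -/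
def saturation (G : Set (Matrix (Fin n) (Fin n) 𝕜)) (Y : Set (Fin n → 𝕜)) :
    Set (Fin n → 𝕜) :=
  {v | ∃ y ∈ Y, ∀ p, Invariant 𝕜 n G p → eval v p = eval y p}

/-- `Y` is `G`-saturated: `Y = π⁻¹(π(Y))`. -/
def IsSaturated (G : Set (Matrix (Fin n) (Fin n) 𝕜)) (Y : Set (Fin n → 𝕜)) : Prop :=
  Y = saturation 𝕜 n G Y

/-- The fiber `π⁻¹(π(v))` of the quotient morphism. -/
def piFiber (G : Set (Matrix (Fin n) (Fin n) 𝕜)) (v : Fin n → 𝕜) : Set (Fin n → 𝕜) :=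
  {u | ∀ p, Invariant 𝕜 n G p → eval u p = eval v p}

/-- The invariant ring `𝕜[V]^G` as a subalgebra of `𝕜[V]`. -/
def invariantSubalgebra (G : Set (Matrix (Fin n) (Fin n) 𝕜)) :
    Subalgebra 𝕜 (MvPolynomial (Fin n) 𝕜) where
  carrier := {p | Invariant 𝕜 n G p}
  mul_mem' := by intro a b ha hb g hg v; simp [ha g hg v, hb g hg v]
  one_mem' := by intro g hg v; simp
  add_mem' := by intro a b ha hb g hg v; simp [ha g hg v, hb g hg v]
  zero_mem' := by intro g hg v; simp
  algebraMap_mem' := by intro r g hg v; simp [MvPolynomial.algebraMap_eq]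

/-- The representation is cofree: `𝕜[V]` is a free module over `𝕜[V]^G`. -/
def IsCofree (G : Set (Matrix (Fin n) (Fin n) 𝕜)) : Prop :=
  Module.Free ↥(invariantSubalgebra 𝕜 n G) (MvPolynomial (Fin n) 𝕜)

/-- The vanishing ideal of `π(Y)` in `𝕜[V//G] = 𝕜[V]^G`. -/
def quotVanishingIdeal (G : Set (Matrix (Fin n) (Fin n) 𝕜)) (Y : Set (Fin n → 𝕜)) :
    Ideal ↥(invariantSubalgebra 𝕜 n G) where
  carrier := {p | ∀ y ∈ Y, eval y (p : MvPolynomial (Fin n) 𝕜) = 0}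
  zero_mem' := by intro y hy; simp
  add_mem' := by intro a b ha hb y hy; simp [ha y hy, hb y hy]
  smul_mem' := by intro c p hp y hy; simp [smul_eq_mul, hp y hy]

/-- The module is stable: there is a nonempty Zariski-open set of points with closed orbit. -/
def IsStableModule (G : Set (Matrix (Fin n) (Fin n) 𝕜)) : Prop :=
  ∃ U : Set (Fin n → 𝕜), U.Nonempty ∧ IsAlgebraicSet 𝕜 n Uᶜ ∧
    ∀ v ∈ U, HasClosedOrbit 𝕜 n G v

/-- `G` is Zariski closed in `GL_n(𝕜)`. -/
def IsZClosedInGL (G : Set (Matrix (Fin n) (Fin n) 𝕜)) : Prop :=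
  ∃ P : Set (MvPolynomial (Fin n × Fin n) 𝕜),
    G = {g | IsUnit g ∧ ∀ p ∈ P, eval (fun ij => g ij.1 ij.2) p = 0}

/-- `G` is a (linearly) reductive algebraic group: a Zariski closed subgroup of `GL_n`
containing a Zariski-dense compact subgroup (the unitarian trick characterization). -/
def IsReductiveGroup (G : Set (Matrix (Fin n) (Fin n) 𝕜)) : Prop :=
  IsMatSubgroup 𝕜 n G ∧ IsZClosedInGL 𝕜 n G ∧
    ∃ K : Set (Matrix (Fin n) (Fin n) 𝕜), K ⊆ G ∧ IsCompact K ∧ IsMatSubgroup 𝕜 n K ∧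
      ∀ p : MvPolynomial (Fin n × Fin n) 𝕜,
        (∀ k ∈ K, eval (fun ij => k ij.1 ij.2) p = 0) →
          ∀ g ∈ G, eval (fun ij => g ij.1 ij.2) p = 0

/-- The isotropy groups of `v` and `w` are conjugate in `G`. -/
def ConjIsotropy (G : Set (Matrix (Fin n) (Fin n) 𝕜)) (v w : Fin n → 𝕜) : Prop :=
  ∃ g ∈ G, isotropy 𝕜 n G w = (fun h => g * h * g⁻¹) '' isotropy 𝕜 n G v

/-- The (Luna) stratum of `V` determined by a point `v` with closed orbit: the inverse image
under `π` of the set of closed orbits with isotropy group conjugate to `G_v`. -/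
def stratumOf (G : Set (Matrix (Fin n) (Fin n) 𝕜)) (v : Fin n → 𝕜) : Set (Fin n → 𝕜) :=
  {u | ∃ w, HasClosedOrbit 𝕜 n G w ∧ w ∈ zclosure 𝕜 n (orbit 𝕜 n G u) ∧
    ConjIsotropy 𝕜 n G v w}

/-- Dimension of (the Zariski closure of) a subset of `𝕜ⁿ`, as the Krull dimension of its
coordinate ring. -/
def adim (X : Set (Fin n → 𝕜)) : WithBot ℕ∞ :=
  ringKrullDim (MvPolynomial (Fin n) 𝕜 ⧸ vanishingIdeal 𝕜 n X)

/-- A nonempty algebraic set with prime vanishing ideal, i.e. an irreducible algebraic set. -/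
def IsIrredAlg (Z : Set (Fin n → 𝕜)) : Prop :=
  IsAlgebraicSet 𝕜 n Z ∧ Z.Nonempty ∧ (vanishingIdeal 𝕜 n Z).IsPrime

/-- `Z` is an irreducible component of `Y`. -/
def IsIrredComponentOf (Y Z : Set (Fin n → 𝕜)) : Prop :=
  IsIrredAlg 𝕜 n Z ∧ Z ⊆ Y ∧
    ∀ Z', IsIrredAlg 𝕜 n Z' → Z ⊆ Z' → Z' ⊆ Y → Z' = Z

/-- The rank at `v` of the differential of `f = (f_1, …, f_d) : V → 𝕜^d`. -/
def jacRank {d : ℕ} (f : Fin d → MvPolynomial (Fin n) 𝕜) (v : Fin n → 𝕜) : ℕ :=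
  (Matrix.of fun (i : Fin d) (j : Fin n) => eval v (pderiv j (f i))).rank

/-- A polynomial is `H`-invariant as a function on the submodule `N`. -/
def InvariantOn (H : Set (Matrix (Fin n) (Fin n) 𝕜)) (N : Submodule 𝕜 (Fin n → 𝕜))
    (p : MvPolynomial (Fin n) 𝕜) : Prop :=
  ∀ g ∈ H, ∀ x ∈ N, eval (Matrix.mulVec g x) p = eval x p

/-- The null cone of the `H`-module `N`: points of `N` which the `H`-invariant functions on `N`
cannot separate from `0`. -/
def sliceNullCone (H : Set (Matrix (Fin n) (Fin n) 𝕜)) (N : Submodule 𝕜 (Fin n → 𝕜)) :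
    Set (Fin n → 𝕜) :=
  {x | x ∈ N ∧ ∀ p, InvariantOn 𝕜 n H N p → eval x p = eval (0 : Fin n → 𝕜) p}

/-- The `H`-module `N` is coreduced: the vanishing ideal of its null cone in `𝕜[N]` is
generated by `H`-invariant functions.  (Stated in `𝕜[V]`: the vanishing ideal of the null
cone equals the ideal generated by the invariant functions vanishing on it together with the
vanishing ideal of `N`.) -/
def CoreducedOn (H : Set (Matrix (Fin n) (Fin n) 𝕜)) (N : Submodule 𝕜 (Fin n → 𝕜)) : Prop :=
  vanishingIdeal 𝕜 n (sliceNullCone 𝕜 n H N) =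
    Ideal.span ({p | InvariantOn 𝕜 n H N p ∧ ∀ x ∈ sliceNullCone 𝕜 n H N, eval x p = 0} ∪
      {p | ∀ x ∈ (N : Set (Fin n → 𝕜)), eval x p = 0})

/-- Complexification of a real vector. -/
def cVec (w : Fin n → ℝ) : Fin n → ℂ := fun i => (w i : ℂ)

/-- The complexification `G = K_ℂ` of a compact matrix group `K ⊆ GL_n(ℝ)`: the Zariski
closure of `K` in the complex matrices. -/
def complexifiedGroup (K : Set (Matrix (Fin n) (Fin n) ℝ)) :
    Set (Matrix (Fin n) (Fin n) ℂ) :=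
  {g | ∀ p : MvPolynomial (Fin n × Fin n) ℂ,
    (∀ k ∈ K, eval (fun ij => (k ij.1 ij.2 : ℂ)) p = 0) →
      eval (fun ij => g ij.1 ij.2) p = 0}

/-- The complexification `Y = X_ℂ ⊆ ℂⁿ` of `X ⊆ ℝⁿ`: the Zariski closure of `X` in `ℂⁿ`. -/
def complexification (X : Set (Fin n → ℝ)) : Set (Fin n → ℂ) :=
  zclosure ℂ n (cVec n '' X)

section Birational

open scoped TensorProduct

lemma nonempty_algHom_of_finiteType (F L : Type*) [Field F] [IsAlgClosed F] [Field L]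
    [Algebra F L] [Algebra.FiniteType F L] : Nonempty (L →ₐ[F] F) :=
  have := finite_of_finite_type_of_isJacobsonRing F L
  ⟨IsAlgClosed.lift⟩

lemma exists_algHom_of_ne_top {F T : Type*} [Field F] [IsAlgClosed F] [CommRing T]
    [Algebra F T] [Algebra.FiniteType F T] {I : Ideal T} (hI : I ≠ ⊤) :
    ∃ ψ : T →ₐ[F] F, ∀ x ∈ I, ψ x = 0 := by
  obtain ⟨m, hm, hIm⟩ := Ideal.exists_le_maximal I hI
  obtain ⟨ψ⟩ : Nonempty ((T ⧸ m) →ₐ[F] F) :=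
    let := Ideal.Quotient.field m
    nonempty_algHom_of_finiteType F (T ⧸ m)
  refine ⟨ψ.comp (Ideal.Quotient.mkₐ F m), fun x hx => ?_⟩
  have : Ideal.Quotient.mkₐ F m x = 0 := Ideal.Quotient.eq_zero_iff_mem.2 (hIm hx)
  rw [AlgHom.comp_apply, this, map_zero]

lemma isNilpotent_of_forall_algHom_eq_zero {F T : Type*} [Field F] [IsAlgClosed F] [CommRing T]
    [Algebra F T] [Algebra.FiniteType F T] {x : T} (hx : ∀ ψ : T →ₐ[F] F, ψ x = 0) :
    IsNilpotent x := by
  have : IsJacobsonRing T := isJacobsonRing_of_finiteType (A := F)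
  change x ∈ Ideal.radical (⊥ : Ideal T)
  rw [Ideal.radical_eq_jacobson]
  refine Ideal.mem_sInf.2 fun {m} hm => ?_
  by_contra hxm
  obtain ⟨y, i, hi, hy⟩ := hm.2.exists_inv hxm
  obtain ⟨ψ, hψ⟩ := exists_algHom_of_ne_top (F := F) hm.2.ne_top
  have := congrArg ψ hy
  rw [map_add, map_mul, hx, hψ i hi, mul_zero, add_zero, map_one] at this
  exact zero_ne_one this

/-- An element `h` of a reduced algebra over a perfect field which is infinitesimally constant
along the two projections is a scalar. -/
lemma mem_range_algebraMap_of_isNilpotent {F C : Type*} [Field F] [PerfectField F] [CommRing C]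
    [IsReduced C] [Algebra F C] {h : C} (hn : IsNilpotent (h ⊗ₜ[F] (1 : C) - (1 : C) ⊗ₜ[F] h)) :
    h ∈ Set.range (algebraMap F C) := by
  have heq : ∀ r s : AlgebraicClosure F,
      (∀ p ∈ RingHom.ker (Polynomial.aeval (R := F) h), Polynomial.aeval r p = 0) →
      (∀ p ∈ RingHom.ker (Polynomial.aeval (R := F) h), Polynomial.aeval s p = 0) → r = s := by
    intro r s hr hs
    let ι := Ideal.kerLiftAlg (Polynomial.aeval (R := F) h)
    have hι : Function.Injective ι := Ideal.kerLiftAlg_injective _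
    let x : Polynomial F ⧸ RingHom.ker (Polynomial.aeval (R := F) h) :=
      Ideal.Quotient.mk _ Polynomial.X
    have hιx : ι x = h := by
      simp [ι, x]
    have hinj : Function.Injective (Algebra.TensorProduct.map ι ι) :=
      TensorProduct.map_injective_of_flat_flat ι.toLinearMap ι.toLinearMap hι hι
    have hnil : IsNilpotent (x ⊗ₜ[F] 1 - 1 ⊗ₜ[F] x) := by
      rw [← IsNilpotent.map_iff hinj]
      simpa [hιx] using hn
    have := hnil.map (Algebra.TensorProduct.lift (Ideal.Quotient.liftₐ _ (Polynomial.aeval r) hr)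
      (Ideal.Quotient.liftₐ _ (Polynomial.aeval s) hs) fun _ _ => Commute.all _ _)
    have := this.eq_zero
    rw [map_sub, Algebra.TensorProduct.lift_tmul, Algebra.TensorProduct.lift_tmul, map_one,
      map_one, mul_one, one_mul, sub_eq_zero] at this
    change Polynomial.aeval r Polynomial.X = Polynomial.aeval s Polynomial.X at this
    simpa using this
  obtain ⟨m, hm⟩ : ∃ m, RingHom.ker (Polynomial.aeval (R := F) h) = Ideal.span {m} :=
    (IsPrincipalIdealRing.principal _).principal
  have hmem : ∀ p, Polynomial.aeval h p = 0 ↔ m ∣ p := fun p => by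
    rw [← Ideal.mem_span_singleton, ← hm, RingHom.mem_ker]
  have heq' : ∀ r s : AlgebraicClosure F, Polynomial.aeval r m = 0 → Polynomial.aeval s m = 0 →
      r = s := by
    intro r s hr hs
    refine heq r s ?_ ?_ <;>
    · intro p hp
      obtain ⟨c, rfl⟩ := (hmem p).1 hp
      simp [hr, hs]
  have hm0 : m ≠ 0 := by
    rintro rfl
    exact zero_ne_one (heq' 0 1 (by simp) (by simp))
  have hsq : Squarefree m := by
    rintro x ⟨y, hy⟩
    have hxy : x * y ≠ 0 := by
      intro h0
      rw [hy, mul_assoc, h0, mul_zero] at hm0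
      exact hm0 rfl
    have h1 : Polynomial.aeval h (x * y) = 0 := by
      have : Polynomial.aeval h ((x * y) ^ 2) = 0 := (hmem _).2 ⟨y, by rw [hy]; ring⟩
      rw [map_pow] at this
      exact pow_eq_zero_iff two_ne_zero |>.1 this
    obtain ⟨c, hc⟩ := (hmem _).1 h1
    refine IsUnit.of_mul_eq_one c (mul_left_cancel₀ hxy ?_)
    rw [mul_one]
    conv_rhs => rw [hc, hy]
    ring
  have hsep := PerfectField.separable_iff_squarefree.2 hsq
  have hcard := Polynomial.card_rootSet_eq_natDegree (K := AlgebraicClosure F) hsep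
    (IsAlgClosed.splits _)
  have hdeg : m.natDegree ≤ 1 := by
    rw [← hcard, Fintype.card_le_one_iff]
    rintro ⟨r, hr⟩ ⟨s, hs⟩
    exact Subtype.ext (heq' r s (Polynomial.mem_rootSet.1 hr).2 (Polynomial.mem_rootSet.1 hs).2)
  obtain ⟨a, b, rfl⟩ := Polynomial.exists_eq_X_add_C_of_natDegree_le_one hdeg
  have h0 := (hmem _).2 dvd_rfl
  simp only [map_add, map_mul, Polynomial.aeval_C, Polynomial.aeval_X] at h0
  by_cases ha : a = 0
  · subst ha
    have hb : b ≠ 0 := by rintro rfl; simp at hm0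
    have : (algebraMap F C b) = 0 := by simpa using h0
    have h1 : (1 : C) = 0 := by
      rw [← map_one (algebraMap F C), ← inv_mul_cancel₀ hb, map_mul, this, mul_zero]
    exact ⟨0, by rw [← mul_one h, h1, mul_zero, map_zero]⟩
  · refine ⟨-(a⁻¹ * b), ?_⟩
    have : algebraMap F C a⁻¹ * algebraMap F C a = 1 := by
      rw [← map_mul, inv_mul_cancel₀ ha, map_one]
    rw [map_neg, map_mul]
    linear_combination (-algebraMap F C a⁻¹) * h0 + h * this

lemma isField_localization_of_mem_minimalPrimes {A : Type*} [CommRing A] [IsReduced A]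
    {𝔭 : Ideal A} [𝔭.IsPrime] (h𝔭 : 𝔭 ∈ minimalPrimes A) :
    IsField (Localization.AtPrime 𝔭) := by
  have hred : IsReduced (Localization.AtPrime 𝔭) :=
    isReduced_localizationPreserves 𝔭.primeCompl _ inferInstance
  have := IsLocalization.AtPrime.radical_map_of_mem_minimalPrimes (Localization.AtPrime 𝔭) 𝔭 ⊥ h𝔭
  rw [IsLocalRing.isField_iff_maximalIdeal_eq, ← Localization.AtPrime.map_eq_maximalIdeal, ← this,
    Ideal.map_bot]
  exact nilradical_eq_zero _

/-- The previous lemma over the generic point of a component of the base. -/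
lemma exists_notMem_mul_eq_of_isNilpotent {A B : Type*} [CommRing A] [CommRing B] [Algebra A B]
    [Algebra ℚ A] [IsReduced A] [IsReduced B] {h : B}
    (hn : IsNilpotent (h ⊗ₜ[A] (1 : B) - (1 : B) ⊗ₜ[A] h)) {𝔭 : Ideal A}
    (h𝔭 : 𝔭 ∈ minimalPrimes A) :
    ∃ a b : A, b ∉ 𝔭 ∧ algebraMap A B b * h = algebraMap A B a := by
  have hp : 𝔭.IsPrime := h𝔭.1.1
  let _ : Field (Localization.AtPrime 𝔭) := (isField_localization_of_mem_minimalPrimes h𝔭).toField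
  let C := Localization (Algebra.algebraMapSubmonoid B 𝔭.primeCompl)
  have : CharZero (Localization.AtPrime 𝔭) := algebraRat.charZero _
  have hred : IsReduced C := isReduced_localizationPreserves
    (Algebra.algebraMapSubmonoid B 𝔭.primeCompl) C ‹_›
  have hn' : IsNilpotent ((algebraMap B C h) ⊗ₜ[Localization.AtPrime 𝔭] (1 : C) -
      (1 : C) ⊗ₜ[Localization.AtPrime 𝔭] (algebraMap B C h)) := by
    have := hn.map (Algebra.TensorProduct.lift (S := A)
      ((Algebra.TensorProduct.includeLeft (R := Localization.AtPrime 𝔭) (S := A) (A := C)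
        (B := C)).comp
        (IsScalarTower.toAlgHom A B C))
      (((Algebra.TensorProduct.includeRight (R := Localization.AtPrime 𝔭) (A := C)
        (B := C)).restrictScalars A).comp
        (IsScalarTower.toAlgHom A B C)) fun _ _ => Commute.all _ _)
    simpa using this
  obtain ⟨z, hz⟩ := mem_range_algebraMap_of_isNilpotent hn'
  obtain ⟨a, ⟨s, hs⟩, rfl⟩ := IsLocalization.exists_mk'_eq 𝔭.primeCompl z
  have h1 : algebraMap B C (algebraMap A B s * h) = algebraMap B C (algebraMap A B a) := by
    rw [map_mul, ← hz, ← IsScalarTower.algebraMap_apply, ← IsScalarTower.algebraMap_apply,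
      IsScalarTower.algebraMap_apply A (Localization.AtPrime 𝔭) C,
      IsScalarTower.algebraMap_apply A (Localization.AtPrime 𝔭) C a, ← map_mul]
    exact congrArg _ (IsLocalization.mk'_spec' _ a ⟨s, hs⟩)
  obtain ⟨⟨_, t, ht, rfl⟩, hc⟩ := (IsLocalization.eq_iff_exists
    (Algebra.algebraMapSubmonoid B 𝔭.primeCompl) C).1 h1
  refine ⟨t * a, t * s, fun h => (hp.mem_or_mem h).elim ht hs, ?_⟩
  rw [map_mul, map_mul, mul_assoc]
  exact hc

/-- Let `A ⊆ B` be reduced finitely generated algebras over an algebraically closed field of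
characteristic zero. A regular function on `Spec B` which is constant on the fibres of
`Spec B → Spec A` is a rational function on every component of `Spec A`. -/
theorem exists_notMem_mul_eq {F A B : Type*} [Field F] [IsAlgClosed F] [CharZero F] [CommRing A]
    [CommRing B] [Algebra F A] [Algebra F B] [Algebra A B] [IsScalarTower F A B]
    [Algebra.FiniteType F B] [IsReduced A] [IsReduced B] {h : B}
    (hconst : ∀ ψ χ : B →ₐ[F] F, (∀ a : A, ψ (algebraMap A B a) = χ (algebraMap A B a)) → ψ h = χ h)
    {𝔭 : Ideal A} (h𝔭 : 𝔭 ∈ minimalPrimes A) :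
    ∃ a b : A, b ∉ 𝔭 ∧ algebraMap A B b * h = algebraMap A B a := by
  let _ : Algebra ℚ A := ((algebraMap F A).comp (algebraMap ℚ F)).toAlgebra
  refine exists_notMem_mul_eq_of_isNilpotent ?_ h𝔭
  have : Algebra.FiniteType A B := .of_restrictScalars_finiteType F A B
  have : Algebra.FiniteType F (B ⊗[A] B) := .trans (S := B) inferInstance inferInstance
  refine isNilpotent_of_forall_algHom_eq_zero (F := F) fun ψ => ?_
  rw [map_sub, sub_eq_zero]
  refine hconst (ψ.comp Algebra.TensorProduct.includeLeft)
    (ψ.comp ((Algebra.TensorProduct.includeRight (R := A) (A := B) (B := B)).restrictScalars F))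
    fun a => ?_
  simp [Algebra.TensorProduct.tmul_one_eq_one_tmul]

end Birational

section Depth

open LinearMap RingTheory.Sequence Ideal CategoryTheory Abelian Limits Pointwise IsSMulRegular
  IsLocalRing

universe u

lemma maximalIdeal_smul_top_lt_top {A : Type*} [CommRing A] [IsLocalRing A] (M : Type*)
    [AddCommGroup M] [Module A M] [Module.Finite A M] [Nontrivial M] :
    maximalIdeal A • (⊤ : Submodule A M) < ⊤ :=
  (Submodule.top_ne_ideal_smul_of_le_jacobson_annihilator
    (maximalIdeal_le_jacobson _)).symm.lt_top

lemma ringKrullDim_quotient_le_supportDim {A : Type*} [CommRing A] (M : Type*)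
    [AddCommGroup M] [Module A M] [Module.Finite A M] {p : PrimeSpectrum A} (hp : p ∈ Module.support A M) :
    ringKrullDim (A ⧸ p.asIdeal) ≤ Module.supportDim A M := by
  rw [Module.supportDim_eq_ringKrullDim_quotient_annihilator]
  exact ringKrullDim_le_of_surjective
    (Ideal.Quotient.factor (Module.mem_support_iff_of_finite.1 hp))
    (Ideal.Quotient.factor_surjective _)

variable {A : Type u} [CommRing A] [IsLocalRing A] [IsNoetherianRing A]

lemma exists_isRegular_quotSMulTop (M : Type u) [AddCommGroup M] [Module A M]
    [Module.Finite A M] {a : A} (ha : a ∈ maximalIdeal A) (hreg : IsSMulRegular M a) (N : ℕ)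
    (h : ∃ rs : List A, rs.length = N + 1 ∧ (∀ r ∈ rs, r ∈ maximalIdeal A) ∧ IsRegular M rs) :
    ∃ rs : List A, rs.length = N ∧ (∀ r ∈ rs, r ∈ maximalIdeal A) ∧
      IsRegular (QuotSMulTop a M) rs := by
  obtain ⟨rs, hlen, hmem, hrs⟩ := h
  have : Nontrivial M := hrs.nontrivial
  have := nontrivial_quotSMulTop_of_mem_maximalIdeal M ha
  have hsupp : Module.support A (A ⧸ maximalIdeal A) =
      PrimeSpectrum.zeroLocus (maximalIdeal A : Set A) := by
    rw [Module.support_eq_zeroLocus, annihilator_quotient]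
  have hext := ModuleCat.subsingleton_ext_of_exists_isRegular (maximalIdeal A)
    (ModuleCat.of A (A ⧸ maximalIdeal A)) hsupp.subset (ModuleCat.of A M)
    (maximalIdeal_smul_top_lt_top M) rs hmem hrs
  refine ModuleCat.exists_isRegular_of_exists_subsingleton_ext (maximalIdeal A) N
    (ModuleCat.of A (QuotSMulTop a M)) (maximalIdeal_smul_top_lt_top _)
    (ModuleCat.of A (A ⧸ maximalIdeal A)) hsupp fun i hi => ?_
  have zero1 := AddCommGrpCat.isZero_of_iff_subsingleton.mpr (hext i (by omega))
  have zero2 := AddCommGrpCat.isZero_of_iff_subsingleton.mpr (hext (i + 1) (by omega))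
  have hreg' : IsSMulRegular (ModuleCat.of A M) a := hreg
  exact AddCommGrpCat.subsingleton_of_isZero <| ShortComplex.Exact.isZero_of_both_zeros
    ((Ext.covariant_sequence_exact₃' _ hreg'.smulShortComplex_shortExact) i (i + 1) rfl)
    (zero1.eq_zero_of_src _) (zero2.eq_zero_of_tgt _)

lemma ringKrullDim_quotient_add_one_le {R : Type*} [CommRing R] {P Q : Ideal R} [P.IsPrime]
    (hPQ : P ≤ Q) {x : R} (hxP : x ∉ P) (hxQ : x ∈ Q) :
    ringKrullDim (R ⧸ Q) + 1 ≤ ringKrullDim (R ⧸ P) := by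
  refine ringKrullDim_succ_le_of_surjective (Ideal.Quotient.factor hPQ)
    (Ideal.Quotient.factor_surjective hPQ) (r := Ideal.Quotient.mk P x) ?_ ?_
  · exact mem_nonZeroDivisors_of_ne_zero (by simpa [Ideal.Quotient.eq_zero_iff_mem] using hxP)
  · simpa [Ideal.Quotient.eq_zero_iff_mem] using hxQ

lemma length_le_ringKrullDim_quotient_of_isAssociatedPrime (rs : List A)
    (hmem : ∀ r ∈ rs, r ∈ maximalIdeal A) (M : Type u) [AddCommGroup M] [Module A M]
    [Module.Finite A M] (hrs : IsRegular M rs) {P : Ideal A} (hP : IsAssociatedPrime P M) :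
    (rs.length : WithBot ℕ∞) ≤ ringKrullDim (A ⧸ P) := by
  induction rs generalizing M P with
  | nil =>
    have := hP.isPrime
    simpa using ringKrullDim_nonneg_of_nontrivial
  | cons x rs ih =>
    have hPprime := hP.isPrime
    obtain ⟨y, hy⟩ := (isAssociatedPrime_iff.mp hP).2
    rw [isRegular_cons_iff] at hrs
    have hx : x ∈ maximalIdeal A := hmem x (by simp)
    let N : Submodule A M := Submodule.torsionBySet A M (P : Set A)
    have hmemN : ∀ z : M, z ∈ N ↔ ∀ a ∈ P, a • z = 0 := fun z => by
      simp [N, Submodule.mem_torsionBySet_iff]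
    have hyN : y ∈ N := (hmemN y).2 fun a ha => by
      rw [hy, Submodule.mem_colon_singleton] at ha; simpa using ha
    have hy0 : y ≠ 0 := by
      rintro rfl
      exact hPprime.ne_top (by rw [hy]; ext; simp)
    obtain ⟨z, hzN, hzx⟩ : ∃ z ∈ N, z ∉ x • (⊤ : Submodule A M) := by
      by_contra! hcon
      have : N ≤ Ideal.span {x} • N := fun z hz => by
        obtain ⟨w, -, rfl⟩ := (Submodule.mem_smul_pointwise_iff_exists _ _ _).1 (hcon z hz)
        refine Submodule.smul_mem_smul (Ideal.mem_span_singleton_self x)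
          ((hmemN w).2 fun a ha => ?_)
        refine hrs.1 (?_ : x • a • w = x • 0)
        rw [smul_comm, (hmemN _).1 hz a ha, smul_zero]
      have hbot := Submodule.eq_bot_of_le_smul_of_le_jacobson_bot _ N (IsNoetherian.noetherian N)
        this (by
          rw [Ideal.span_singleton_le_iff_mem]
          exact maximalIdeal_le_jacobson _ hx)
      exact hy0 (by simpa [hbot] using hyN)
    let zb : QuotSMulTop x M := Submodule.Quotient.mk z
    have hzb : zb ≠ 0 := fun h => hzx ((Submodule.Quotient.mk_eq_zero _).1 h)
    obtain ⟨P', hP', hle⟩ := exists_le_isAssociatedPrime_of_isNoetherianRing A zb hzb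
    have hPP' : P ≤ P' := fun a ha => hle <| by
      rw [Submodule.mem_colon_singleton, Submodule.mem_bot, ← Submodule.Quotient.mk_smul,
        (hmemN z).1 hzN a ha, Submodule.Quotient.mk_zero]
    have hxP' : x ∈ P' := hle <| by
      rw [Submodule.mem_colon_singleton, Submodule.mem_bot, ← Submodule.Quotient.mk_smul]
      exact (Submodule.Quotient.mk_eq_zero _).2
        (Submodule.smul_mem_pointwise_smul z x ⊤ trivial)
    have hxP : x ∉ P := fun hxP => by
      rw [hy, Submodule.mem_colon_singleton, Submodule.mem_bot] at hxP
      exact hy0 (hrs.1 (by simpa using hxP))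
    have h1 := ih (fun r hr => hmem r (by simp [hr])) (QuotSMulTop x M) hrs.2 hP'
    calc ((rs.length + 1 : ℕ) : WithBot ℕ∞) = rs.length + 1 := by push_cast; rfl
      _ ≤ ringKrullDim (A ⧸ P') + 1 := by gcongr
      _ ≤ _ := ringKrullDim_quotient_add_one_le hPP' hxP hxP'

lemma supportDim_le_supportDim_quotient_ofList_add (rs : List A)
    (hmem : ∀ r ∈ rs, r ∈ maximalIdeal A) (M : Type u) [AddCommGroup M] [Module A M]
    [Module.Finite A M] :
    Module.supportDim A M ≤
      Module.supportDim A (M ⧸ Ideal.ofList rs • (⊤ : Submodule A M)) + rs.length := by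
  induction rs generalizing M with
  | nil =>
    simp only [List.length_nil, Nat.cast_zero, add_zero]
    refine Module.supportDim_le_of_injective (Submodule.mkQ _) ?_
    rw [← LinearMap.ker_eq_bot, Submodule.ker_mkQ]
    simp
  | cons x rs ih =>
    have h1 := Module.supportDim_le_supportDim_quotSMulTop_succ (M := M) (hmem x (by simp))
    have h2 := ih (fun r hr => hmem r (by simp [hr])) (QuotSMulTop x M)
    rw [← Module.supportDim_eq_of_equiv
      (Submodule.quotOfListConsSMulTopEquivQuotSMulTopInner M x rs)] at h2
    refine h1.trans ((add_le_add_left h2 1).trans ?_)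
    simp [add_assoc]

/-- If `M` has depth at least `N + k`, and `k` elements of the maximal ideal cut the dimension of
`M` down to `N`, then these elements form an `M`-regular sequence and the quotient has depth at
least `N`. -/
lemma exists_isRegular_quotient_of_supportDim_le (N : ℕ) (rs : List A)
    (hmem : ∀ r ∈ rs, r ∈ maximalIdeal A) (M : Type u) [AddCommGroup M] [Module A M]
    [Module.Finite A M]
    (h : ∃ ss : List A, ss.length = N + rs.length ∧ (∀ r ∈ ss, r ∈ maximalIdeal A) ∧
      IsRegular M ss)
    (hdim : Module.supportDim A (M ⧸ Ideal.ofList rs • (⊤ : Submodule A M)) ≤ N) :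
    ∃ ss : List A, ss.length = N ∧ (∀ r ∈ ss, r ∈ maximalIdeal A) ∧
      IsRegular (M ⧸ Ideal.ofList rs • (⊤ : Submodule A M)) ss := by
  induction rs generalizing M with
  | nil =>
    obtain ⟨ss, h1, h2, h3⟩ := h
    refine ⟨ss, by simpa using h1, h2, ?_⟩
    exact (LinearEquiv.isRegular_congr
      (Submodule.quotEquivOfEqBot _ (by simp) : (M ⧸ Ideal.ofList [] • (⊤ : Submodule A M)) ≃ₗ[A] M)
      ss).2 h3
  | cons x rs ih =>
    have hmem' : ∀ r ∈ rs, r ∈ maximalIdeal A := fun r hr => hmem r (by simp [hr])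
    have hx : x ∈ maximalIdeal A := hmem x (by simp)
    let e := Submodule.quotOfListConsSMulTopEquivQuotSMulTopInner M x rs
    rw [Module.supportDim_eq_of_equiv e] at hdim
    have hreg : IsSMulRegular M x := by
      by_contra hcon
      have hx' : x ∈ ⋃ p ∈ associatedPrimes A M, (p : Set A) := by
        rw [biUnion_associatedPrimes_eq_compl_regular]; exact hcon
      obtain ⟨P, hP, hxP⟩ := Set.mem_iUnion₂.1 hx'
      have hPprime : P.IsPrime := hP.isPrime
      obtain ⟨ss, hlen, hss, hssr⟩ := h
      have h1 := length_le_ringKrullDim_quotient_of_isAssociatedPrime ss hss M hssr hP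
      have hPs : (⟨P, hPprime⟩ : PrimeSpectrum A) ∈ Module.support A (QuotSMulTop x M) := by
        rw [Module.support_quotSMulTop]
        refine ⟨Module.mem_support_iff_of_finite.2 fun a ha => ?_, by simpa using hxP⟩
        obtain ⟨y, hy⟩ := (isAssociatedPrime_iff.mp hP).2
        change a ∈ P
        rw [hy, Submodule.mem_colon_singleton, Submodule.mem_bot]
        exact Module.mem_annihilator.1 ha y
      have h2 := ringKrullDim_quotient_le_supportDim (QuotSMulTop x M) hPs
      have h3 := supportDim_le_supportDim_quotient_ofList_add rs hmem' (QuotSMulTop x M)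
      have h4 := h1.trans (h2.trans (h3.trans (add_le_add_left hdim _)))
      rw [hlen] at h4
      simp only [List.length_cons] at h4
      norm_cast at h4
      omega
    have h' := exists_isRegular_quotSMulTop M hx hreg (N + rs.length) h
    obtain ⟨ss, h1, h2, h3⟩ := ih hmem' (QuotSMulTop x M) h' hdim
    exact ⟨ss, h1, h2, (LinearEquiv.isRegular_congr e ss).2 h3⟩

end Depth

section Unmixed

open RingTheory.Sequence IsLocalRing

lemma ringKrullDim_le_of_isLocalization {R : Type*} [CommRing R] (S : Submonoid R)
    (R' : Type*) [CommRing R'] [Algebra R R'] [IsLocalization S R'] :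
    ringKrullDim R' ≤ ringKrullDim R := by
  refine Order.krullDim_le_of_strictMono (PrimeSpectrum.comap (algebraMap R R')) ?_
  refine Monotone.strictMono_of_injective (fun p q h => Ideal.comap_mono h) ?_
  exact PrimeSpectrum.localization_comap_injective R' S

lemma isWeaklyRegular_X_sub_C {F : Type*} [Field F] (n : ℕ) (a : Fin n → F) :
    IsWeaklyRegular (MvPolynomial (Fin n) F)
      (List.ofFn fun i => (X i - C (a i) : MvPolynomial (Fin n) F)) := by
  set L := List.ofFn fun i => (X i - C (a i) : MvPolynomial (Fin n) F) with hL
  have hlen : L.length = n := by simp [hL]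
  rw [isWeaklyRegular_iff]
  intro i hi
  have hin : i < n := hlen ▸ hi
  have hLi : L[i] = X ⟨i, hin⟩ - C (a ⟨i, hin⟩) := by simp [hL]
  rw [hLi]
  let I : Ideal (MvPolynomial (Fin n) F) := Ideal.ofList (L.take i)
  have hI : (I • ⊤ : Submodule (MvPolynomial (Fin n) F) (MvPolynomial (Fin n) F)) = I := by simp
  let φ : MvPolynomial (Fin n) F →ₐ[F] MvPolynomial (Fin n) F :=
    aeval fun j => if j.1 < i then C (a j) else X j
  have hmem : ∀ j : Fin n, j.1 < i → (X j - C (a j) : MvPolynomial (Fin n) F) ∈ I := fun j hj => by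
    refine Ideal.subset_span ?_
    simp only [Set.mem_ofPred_eq]
    rw [List.mem_take_iff_getElem]
    exact ⟨j, by simp [hlen, hj], by simp [hL]⟩
  have hφ : ∀ p, p - φ p ∈ I := fun p => by
    rw [← Ideal.Quotient.eq]
    have : (Ideal.Quotient.mkₐ F I) = (Ideal.Quotient.mkₐ F I).comp φ := by
      refine MvPolynomial.algHom_ext fun j => ?_
      simp only [φ, AlgHom.comp_apply, aeval_X]
      split_ifs with hj
      · exact Ideal.Quotient.eq.2 (hmem j hj)
      · rfl
    exact DFunLike.congr_fun this p
  have hφI : ∀ p ∈ I, φ p = 0 := fun p hp => by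
    have : I ≤ RingHom.ker φ := by
      refine Ideal.span_le.2 fun q hq => ?_
      simp only [Set.mem_ofPred_eq, List.mem_take_iff_getElem] at hq
      obtain ⟨j, hj, rfl⟩ := hq
      have hj' : j < i := by omega
      have : L[j] = X ⟨j, by omega⟩ - C (a ⟨j, by omega⟩) := by simp [hL]
      rw [this]
      simp [φ, hj', RingHom.mem_ker, ← algebraMap_eq]
    exact this hp
  change IsSMulRegular (_ ⧸ (I • ⊤ : Submodule _ _)) _
  rw [hI, isSMulRegular_iff_right_eq_zero_of_smul]
  intro x
  obtain ⟨p, rfl⟩ := Ideal.Quotient.mk_surjective x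
  intro hx
  have hx' : (X ⟨i, hin⟩ - C (a ⟨i, hin⟩)) * p ∈ I := Ideal.Quotient.eq_zero_iff_mem.1 hx
  have h1 := hφI _ hx'
  rw [map_mul] at h1
  have h2 : φ (X ⟨i, hin⟩ - C (a ⟨i, hin⟩)) ≠ 0 := by
    simp only [map_sub, φ, aeval_X, lt_irrefl, if_false]
    intro h
    have := congrArg (MvPolynomial.eval (fun j => a j + 1)) h
    simp [← algebraMap_eq] at this
  have h3 : φ p = 0 := (mul_eq_zero.1 h1).resolve_left h2
  have := hφ p
  rw [h3, sub_zero] at this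
  exact Ideal.Quotient.eq_zero_iff_mem.2 this

lemma exists_isRegular_localization_atPrime {F : Type*} [Field F] [IsAlgClosed F] (n : ℕ)
    (M : Ideal (MvPolynomial (Fin n) F)) [hM : M.IsMaximal] :
    ∃ ss : List (Localization.AtPrime M), ss.length = n ∧
      (∀ r ∈ ss, r ∈ maximalIdeal (Localization.AtPrime M)) ∧
      IsRegular (Localization.AtPrime M) ss := by
  obtain ⟨a, ha⟩ := (MvPolynomial.isMaximal_iff_eq_vanishingIdeal_singleton).1 hM
  have hmem : ∀ r ∈ List.ofFn fun i => (X i - C (a i) : MvPolynomial (Fin n) F), r ∈ M := by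
    intro r hr
    obtain ⟨i, rfl⟩ := List.mem_ofFn.1 hr
    rw [ha, MvPolynomial.mem_vanishingIdeal_singleton_iff]
    simp [← algebraMap_eq]
  refine ⟨_, ?_, ?_, (isWeaklyRegular_X_sub_C n a).isRegular_of_isLocalization_of_mem
    (Localization.AtPrime M) M hmem⟩
  · simp
  · intro r hr
    obtain ⟨s, hs, rfl⟩ := List.mem_map.1 hr
    exact (IsLocalization.AtPrime.to_map_mem_maximal_iff _ M s).2 (hmem s hs)

lemma isAssociatedPrime_map_of_isLocalization {R : Type*} [CommRing R] [IsNoetherianRing R]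
    (S : Submonoid R) (R' : Type*) [CommRing R'] [Algebra R R'] [IsLocalization S R']
    [IsNoetherianRing R']
    {J Q : Ideal R} (hQ : IsAssociatedPrime Q (R ⧸ J)) (hdisj : Disjoint (S : Set R) Q) :
    IsAssociatedPrime (Q.map (algebraMap R R')) (R' ⧸ J.map (algebraMap R R')) := by
  have hp := hQ.isPrime
  obtain ⟨y, hy⟩ := (isAssociatedPrime_iff.mp hQ).2
  obtain ⟨y, rfl⟩ := Ideal.Quotient.mk_surjective y
  have hQmem : ∀ r, r ∈ Q ↔ r * y ∈ J := fun r => by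
    rw [hy, Submodule.mem_colon_singleton, Submodule.mem_bot]
    exact Ideal.Quotient.eq_zero_iff_mem
  rw [isAssociatedPrime_iff]
  refine ⟨IsLocalization.isPrime_of_isPrime_disjoint S R' Q hp hdisj,
    Ideal.Quotient.mk _ (algebraMap R R' y), ?_⟩
  ext a
  rw [Submodule.mem_colon_singleton, Submodule.mem_bot]
  change _ ↔ Ideal.Quotient.mk _ (a * algebraMap R R' y) = 0
  rw [Ideal.Quotient.eq_zero_iff_mem]
  obtain ⟨r, s, rfl⟩ := IsLocalization.exists_mk'_eq S a
  rw [IsLocalization.mk'_mem_map_algebraMap_iff S, ← IsLocalization.mk'_one (M := S) R' y,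
    ← IsLocalization.mk'_mul, IsLocalization.mk'_mem_map_algebraMap_iff S]
  simp only [hQmem, mul_assoc]

/-- Unmixedness: if `k` polynomials in `n` variables over an algebraically closed field cut out a
scheme of dimension at most `n - k`, then it has no embedded primes. -/
theorem mem_minimalPrimes_of_isAssociatedPrime {F : Type*} [Field F] [IsAlgClosed F] {n k : ℕ}
    (f : Fin k → MvPolynomial (Fin n) F)
    (hdim : ringKrullDim (MvPolynomial (Fin n) F ⧸ Ideal.span (Set.range f)) +
      (k : WithBot ℕ∞) ≤ (n : WithBot ℕ∞))
    {Q : Ideal (MvPolynomial (Fin n) F)}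
    (hQ : IsAssociatedPrime Q (MvPolynomial (Fin n) F ⧸ Ideal.span (Set.range f))) :
    Q ∈ (Ideal.span (Set.range f)).minimalPrimes := by
  set J := Ideal.span (Set.range f) with hJ
  have hp := hQ.isPrime
  have hJQ : J ≤ Q := by
    obtain ⟨y, hy⟩ := (isAssociatedPrime_iff.mp hQ).2
    intro a ha
    obtain ⟨y, rfl⟩ := Ideal.Quotient.mk_surjective y
    rw [hy, Submodule.mem_colon_singleton, Submodule.mem_bot]
    exact Ideal.Quotient.eq_zero_iff_mem.2 (J.mul_mem_right _ ha)
  have hnt : Nontrivial (MvPolynomial (Fin n) F ⧸ J) :=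
    Ideal.Quotient.nontrivial_iff.2 (ne_top_of_le_ne_top hp.ne_top hJQ)
  obtain ⟨N, hN, hdimN⟩ : ∃ N : ℕ, n = N + k ∧
      ringKrullDim (MvPolynomial (Fin n) F ⧸ J) ≤ N := by
    have hpos : 0 ≤ ringKrullDim (MvPolynomial (Fin n) F ⧸ J) := ringKrullDim_nonneg_of_nontrivial
    generalize ringKrullDim (MvPolynomial (Fin n) F ⧸ J) = d at hdim hpos
    obtain ⟨d, rfl⟩ : ∃ d' : ℕ∞, d = d' := ⟨d.unbot (by rintro rfl; simp at hpos), by simp⟩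
    have hdim' : d + k ≤ n := by exact_mod_cast hdim
    have hd : d ≠ ⊤ := by rintro rfl; simp at hdim'
    lift d to ℕ using hd
    have : d + k ≤ n := by exact_mod_cast hdim'
    refine ⟨n - k, by omega, ?_⟩
    have : ((d : ℕ∞)) ≤ ((n - k : ℕ) : ℕ∞) := Nat.cast_le.2 (by omega)
    exact WithBot.coe_le_coe.2 this
  obtain ⟨M, hM, hQM⟩ := Ideal.exists_le_maximal Q hp.ne_top
  let A := Localization.AtPrime M
  let φ := algebraMap (MvPolynomial (Fin n) F) A
  let rs : List A := (List.ofFn f).map φ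
  have hrsJ : Ideal.ofList rs = J.map φ := by
    rw [← Ideal.map_ofList, hJ]
    congr 1
    simp [Ideal.ofList, Set.range, List.mem_ofFn]
  have hrs : ∀ r ∈ rs, r ∈ maximalIdeal A := by
    intro r hr
    obtain ⟨s, hs, rfl⟩ := List.mem_map.1 hr
    obtain ⟨i, rfl⟩ := List.mem_ofFn.1 hs
    exact (IsLocalization.AtPrime.to_map_mem_maximal_iff _ M _).2
      (hQM (hJQ (Ideal.subset_span ⟨i, rfl⟩)))
  have hdimA : ringKrullDim (A ⧸ J.map φ) ≤ N :=
    (ringKrullDim_le_of_isLocalization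
      (Algebra.algebraMapSubmonoid (MvPolynomial (Fin n) F ⧸ J) M.primeCompl) (A ⧸ J.map φ)).trans
      hdimN
  have hreg := exists_isRegular_quotient_of_supportDim_le N rs hrs A
    (by simpa [rs, ← hN] using exists_isRegular_localization_atPrime n M)
    (by
      have : (Ideal.ofList rs • ⊤ : Submodule A A) = J.map φ := by simp [hrsJ]
      rw [this, Module.supportDim_quotient_eq_ringKrullDim]
      exact hdimA)
  have h1 : (Ideal.ofList rs • ⊤ : Submodule A A) = J.map φ := by simp [hrsJ]
  rw [h1] at hreg
  obtain ⟨ss, hlen, hss, hssreg⟩ := hreg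
  have hdisj : ∀ P : Ideal (MvPolynomial (Fin n) F), P ≤ Q →
      Disjoint (M.primeCompl : Set (MvPolynomial (Fin n) F)) P := fun P hPQ =>
    Set.disjoint_left.2 fun x hx hxP => hx (hQM (hPQ hxP))
  have h2 := length_le_ringKrullDim_quotient_of_isAssociatedPrime ss hss _ hssreg
    (isAssociatedPrime_map_of_isLocalization M.primeCompl A hQ (hdisj Q le_rfl))
  rw [hlen] at h2
  obtain ⟨P, hP, hPQ⟩ := Ideal.exists_minimalPrimes_le hJQ
  by_cases hPQ' : Q ≤ P
  · exact le_antisymm hPQ hPQ' ▸ hP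
  exfalso
  obtain ⟨x, hxQ, hxP⟩ := Set.not_subset.1 hPQ'
  have hPp : P.IsPrime := hP.1.1
  have hPA := IsLocalization.isPrime_of_isPrime_disjoint M.primeCompl A P hPp (hdisj P hPQ)
  have hxPA : φ x ∉ P.map φ := fun h => by
    have := IsLocalization.under_map_of_isPrime_disjoint M.primeCompl A hPp (hdisj P hPQ)
    exact hxP (this ▸ Ideal.mem_comap.2 h)
  have h3 := ringKrullDim_quotient_add_one_le (Ideal.map_mono hPQ) hxPA (Ideal.mem_map_of_mem φ hxQ)
  have h4 : ringKrullDim (A ⧸ P.map φ) ≤ ringKrullDim (A ⧸ J.map φ) :=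
    ringKrullDim_le_of_surjective (Ideal.Quotient.factor (Ideal.map_mono hP.1.2))
      (Ideal.Quotient.factor_surjective _)
  have h5 : ((N + 1 : ℕ) : WithBot ℕ∞) ≤ N := by
    push_cast
    exact (add_le_add_left h2 1).trans (h3.trans (h4.trans hdimA))
  norm_cast at h5
  omega

end Unmixed

section Taylor

lemma aeval_add_eq_of_mul_eq_zero {σ F S : Type*} [Fintype σ] [CommRing F] [CommRing S]
    [Algebra F S] (x ε : σ → S) (hε : ∀ i j, ε i * ε j = 0) (p : MvPolynomial σ F) :
    aeval (x + ε) p = aeval x p + ∑ j, aeval x (pderiv j p) * ε j := by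
  classical
  induction p using MvPolynomial.induction_on with
  | C a => simp
  | add p q hp hq => simp only [map_add, hp, hq, add_mul, Finset.sum_add_distrib]; ring
  | mul_X p i hp =>
    have h1 : (∑ j, aeval x (pderiv j p) * ε j) * ε i = 0 := by
      rw [Finset.sum_mul]
      exact Finset.sum_eq_zero fun j _ => by rw [mul_assoc, hε, mul_zero]
    have h2 : ∑ j, aeval x (pderiv j (p * X i)) * ε j =
        (∑ j, aeval x (pderiv j p) * ε j) * x i + aeval x p * ε i := by
      simp only [Derivation.leibniz, smul_eq_mul, map_add, map_mul, aeval_X, pderiv_X, add_mul,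
        Finset.sum_add_distrib, Finset.sum_mul]
      rw [add_comm]
      congr 1
      · exact Finset.sum_congr rfl fun j _ => by ring
      · rw [Finset.sum_eq_single i]
        · simp
        · intro j _ hj
          simp [hj.symm]
        · simp
    rw [map_mul, aeval_X, hp, h2, map_mul, aeval_X, Pi.add_apply]
    linear_combination h1

/-- A polynomial vanishes under a homomorphism to a square-zero extension of a formally smooth
algebra as soon as it and its partial derivatives vanish modulo the square-zero ideal. -/
lemma algHom_eq_zero_of_formallySmooth {σ F S κ : Type*} [Finite σ] [CommRing F] [CommRing S]
    [CommRing κ] [Algebra F S] [Algebra F κ] [Algebra.FormallySmooth F κ]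
    (g : S →ₐ[F] κ) (hg : Function.Surjective g)
    (hker : ∀ a b : S, g a = 0 → g b = 0 → a * b = 0)
    (ψ : MvPolynomial σ F →ₐ[F] S) {q : MvPolynomial σ F} (hq : g (ψ q) = 0)
    (hdq : ∀ j, g (ψ (pderiv j q)) = 0) : ψ q = 0 := by
  cases nonempty_fintype σ
  have hnil : IsNilpotent (RingHom.ker (g : S →+* κ)) := by
    refine ⟨2, eq_bot_iff.2 ((pow_two (RingHom.ker (g : S →+* κ))).le.trans
      (Ideal.mul_le.2 fun a ha b hb => hker a b ha hb))⟩
  obtain ⟨s, hs⟩ : ∃ s : κ →ₐ[F] S, ∀ z, g (s z) = z :=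
    ⟨Algebra.FormallySmooth.liftOfSurjective (AlgHom.id F κ) g hg hnil,
      Algebra.FormallySmooth.liftOfSurjective_apply (AlgHom.id F κ) g hg hnil⟩
  have hx : aeval (fun j => s (g (ψ (X j)))) = s.comp (g.comp ψ) :=
    MvPolynomial.algHom_ext fun j => by simp
  have hxε : aeval ((fun j => s (g (ψ (X j)))) + fun j => ψ (X j) - s (g (ψ (X j)))) = ψ :=
    MvPolynomial.algHom_ext fun j => by simp
  have key := aeval_add_eq_of_mul_eq_zero (fun j => s (g (ψ (X j))))
    (fun j => ψ (X j) - s (g (ψ (X j)))) (fun i j => by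
      refine hker _ _ ?_ ?_ <;> simp only [map_sub, hs, sub_self]) q
  rw [hxε, hx, AlgHom.comp_apply, AlgHom.comp_apply, hq, map_zero, zero_add] at key
  rw [key]
  exact Finset.sum_eq_zero fun j _ => by
    rw [AlgHom.comp_apply, AlgHom.comp_apply, hdq, map_zero, zero_mul]

open IsLocalRing in
/-- Over a perfect field, a polynomial which lies in a prime `Q` together with its partial
derivatives belongs to the square of the maximal ideal of the localization at `Q`. -/
lemma algebraMap_mem_maximalIdeal_sq {σ F : Type*} [Finite σ] [Field F] [PerfectField F]
    (Q : Ideal (MvPolynomial σ F)) [Q.IsPrime] {q : MvPolynomial σ F} (hq : q ∈ Q)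
    (hdq : ∀ j, pderiv j q ∈ Q) :
    algebraMap (MvPolynomial σ F) (Localization.AtPrime Q) q ∈
      maximalIdeal (Localization.AtPrime Q) ^ 2 := by
  have hess : Algebra.EssFiniteType F (Localization.AtPrime Q) :=
    have := Algebra.EssFiniteType.of_isLocalization (Localization.AtPrime Q) Q.primeCompl
    Algebra.EssFiniteType.comp F (MvPolynomial σ F) _
  have : Algebra.EssFiniteType F Q.ResidueField :=
    have : Algebra.FiniteType (Localization.AtPrime Q) Q.ResidueField :=
      Algebra.FiniteType.of_surjective (IsScalarTower.toAlgHom (Localization.AtPrime Q)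
        (Localization.AtPrime Q) Q.ResidueField) IsLocalRing.residue_surjective
    Algebra.EssFiniteType.comp F (Localization.AtPrime Q) _
  have hfs : Algebra.FormallySmooth F Q.ResidueField := Algebra.FormallySmooth.of_perfectField
  refine Ideal.Quotient.eq_zero_iff_mem.1 (algHom_eq_zero_of_formallySmooth
    (S := Localization.AtPrime Q ⧸ maximalIdeal (Localization.AtPrime Q) ^ 2)
    (κ := Q.ResidueField)
    (Ideal.Quotient.liftₐ _ (IsScalarTower.toAlgHom F (Localization.AtPrime Q) Q.ResidueField)
      fun a ha => (IsLocalRing.residue_eq_zero_iff a).2 (Ideal.pow_le_self two_ne_zero ha))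
    ?_ ?_ ((Ideal.Quotient.mkₐ F _).comp
      (IsScalarTower.toAlgHom F (MvPolynomial σ F) (Localization.AtPrime Q)))
    (q := q) ?_ ?_)
  · intro z
    obtain ⟨a, rfl⟩ := IsLocalRing.residue_surjective z
    exact ⟨Ideal.Quotient.mk _ a, rfl⟩
  · intro a b ha hb
    obtain ⟨a, rfl⟩ := Ideal.Quotient.mk_surjective a
    obtain ⟨b, rfl⟩ := Ideal.Quotient.mk_surjective b
    have ha' := (IsLocalRing.residue_eq_zero_iff a).1 ha
    have hb' := (IsLocalRing.residue_eq_zero_iff b).1 hb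
    rw [← map_mul, Ideal.Quotient.eq_zero_iff_mem, pow_two]
    exact Ideal.mul_mem_mul ha' hb'
  · exact Ideal.algebraMap_residueField_eq_zero.2 hq
  · exact fun j => Ideal.algebraMap_residueField_eq_zero.2 (hdq j)

end Taylor

section Jacobian

open IsLocalRing

/-- A vector over a domain annihilated by every common zero of a finite family of linear forms
has a nonzero multiple in the span of the family. -/
lemma exists_mul_eq_sum_of_forall_sum_eq_zero {A σ ι : Type*} [CommRing A] [IsDomain A]
    [Fintype σ] [Fintype ι] (a : σ → A) (b : ι → σ → A)
    (h : ∀ w : σ → A, (∀ i, ∑ j, b i j * w j = 0) → ∑ j, a j * w j = 0) :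
    ∃ s : A, s ≠ 0 ∧ ∃ c : ι → A, ∀ j, s * a j = ∑ i, c i * b i j := by
  classical
  let K := FractionRing A
  have hinj : Function.Injective (algebraMap A K) := IsFractionRing.injective A K
  let m : (σ → A) → σ → K := fun u j => algebraMap A K (u j)
  have hspan : m a ∈ Submodule.span K (Set.range fun i => m (b i)) := by
    by_contra hn
    obtain ⟨φ, hφ, hle⟩ := Submodule.exists_le_ker_of_notMem hn
    have hφs : ∀ u : σ → K, φ u = ∑ j, u j * φ (Pi.single j 1) := fun u => by
      conv_lhs => rw [pi_eq_sum_univ' u]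
      simp
    obtain ⟨d, hd⟩ := IsLocalization.exist_integer_multiples_of_finite (nonZeroDivisors A)
      (fun j => φ (Pi.single j 1))
    choose w hw using hd
    have hd0 : algebraMap A K d ≠ 0 := by simp
    have hcomp : ∀ u : σ → A, algebraMap A K (∑ j, u j * w j) = algebraMap A K d * φ (m u) := by
      intro u
      rw [hφs, map_sum, Finset.mul_sum]
      refine Finset.sum_congr rfl fun j _ => ?_
      rw [map_mul, hw, Algebra.smul_def]
      change algebraMap A K (u j) * (algebraMap A K d * _) =
        algebraMap A K d * (algebraMap A K (u j) * _)
      ring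
    refine hφ ?_
    have := h w fun i => hinj (by
      rw [hcomp, map_zero, LinearMap.mem_ker.1 (hle (Submodule.subset_span ⟨i, rfl⟩)), mul_zero])
    have h2 := hcomp a
    rw [this, map_zero] at h2
    exact (mul_eq_zero.1 h2.symm).resolve_left hd0
  obtain ⟨c, hc⟩ := (Submodule.mem_span_range_iff_exists_fun K).1 hspan
  obtain ⟨d, hd⟩ := IsLocalization.exist_integer_multiples_of_finite (nonZeroDivisors A) c
  choose c' hc' using hd
  refine ⟨d, nonZeroDivisors.coe_ne_zero d, c', fun j => hinj ?_⟩
  have := congrFun hc j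
  rw [Finset.sum_apply] at this
  rw [map_mul, map_sum]
  change _ * m a j = _
  rw [← this, Finset.mul_sum]
  refine Finset.sum_congr rfl fun i _ => ?_
  rw [map_mul, hc', Algebra.smul_def (d : A) (c i), mul_assoc]
  rfl

/-- Jacobian criterion: let `I` be the ideal of a set `D` and `J ⊆ I` an ideal with the same
radical and without embedded primes. If the differentials of the generators of `J` cut out the
tangent spaces defined by `I` at the points of `D`, then `I = J`. -/
lemma le_span_of_forall_tangent {F : Type*} [Field F] [PerfectField F] {n k : ℕ}
    (f : Fin k → MvPolynomial (Fin n) F) (I : Ideal (MvPolynomial (Fin n) F))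
    (D : Set (Fin n → F)) (hI : ∀ p, p ∈ I ↔ ∀ v ∈ D, eval v p = 0)
    (hJI : Ideal.span (Set.range f) ≤ I) (hIJ : I ≤ (Ideal.span (Set.range f)).radical)
    (hass : ∀ Q, IsAssociatedPrime Q (MvPolynomial (Fin n) F ⧸ Ideal.span (Set.range f)) →
      Q ∈ (Ideal.span (Set.range f)).minimalPrimes)
    (hD : ∀ v ∈ D, ∀ w : Fin n → F, (∀ i, ∑ j, eval v (pderiv j (f i)) * w j = 0) →
      ∀ p ∈ I, ∑ j, eval v (pderiv j p) * w j = 0) :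
    I ≤ Ideal.span (Set.range f) := by
  set J := Ideal.span (Set.range f) with hJ
  intro p hp
  by_contra hpJ
  have hp0 : (Ideal.Quotient.mk J p) ≠ 0 := fun h => hpJ (Ideal.Quotient.eq_zero_iff_mem.1 h)
  obtain ⟨Q, hQ, hle⟩ := exists_le_isAssociatedPrime_of_isNoetherianRing
    (MvPolynomial (Fin n) F) (Ideal.Quotient.mk J p) hp0
  have hQmin := hass Q hQ
  have hQp : Q.IsPrime := hQmin.1.1
  have hIQ : I ≤ Q := hIJ.trans (hQp.radical_le_iff.2 hQmin.1.2)
  have claim1 : ∀ q ∈ Q, ∃ s ∉ Q, s * q ∈ I := by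
    intro q hq
    have hq' : algebraMap _ (Localization.AtPrime Q) q ∈ (J.map (algebraMap _ _)).radical := by
      rw [IsLocalization.AtPrime.radical_map_of_mem_minimalPrimes _ Q J hQmin]
      exact Ideal.mem_map_of_mem _ hq
    obtain ⟨N, hN⟩ := hq'
    rw [← map_pow, IsLocalization.algebraMap_mem_map_algebraMap_iff Q.primeCompl] at hN
    obtain ⟨s, hs, hsJ⟩ := hN
    refine ⟨s, hs, (hI _).2 fun v hv => pow_eq_zero_iff (n := N + 1) (by simp) |>.1 ?_⟩
    rw [← map_pow]
    refine (hI _).1 (hJI ?_) v hv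
    rw [show (s * q) ^ (N + 1) = s ^ N * q * (s * q ^ N) by ring]
    exact J.mul_mem_left _ hsJ
  have claim2 : ∀ p ∈ I, ∃ s ∉ Q, ∃ c : Fin k → MvPolynomial (Fin n) F,
      ∀ j, s * pderiv j p - ∑ i, c i * pderiv j (f i) ∈ Q := by
    intro p hp
    obtain ⟨s, hs, c, hc⟩ := exists_mul_eq_sum_of_forall_sum_eq_zero
      (A := MvPolynomial (Fin n) F ⧸ Q) (fun j => Ideal.Quotient.mk Q (pderiv j p))
      (fun i j => Ideal.Quotient.mk Q (pderiv j (f i))) (by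
        intro w hw
        choose w' hw' using fun j => Ideal.Quotient.mk_surjective (w j)
        have h1 : ∀ i, ∑ j, pderiv j (f i) * w' j ∈ Q := fun i => by
          rw [← Ideal.Quotient.eq_zero_iff_mem, map_sum, ← hw i]
          simp [hw']
        choose s hs hsI using fun i => claim1 _ (h1 i)
        have hprod : ∏ i, s i ∉ Q := fun h => by
          obtain ⟨i, -, hi⟩ := (hQp.prod_mem_iff).1 h
          exact hs i hi
        have h2 : (∏ i, s i) * ∑ j, pderiv j p * w' j ∈ I := by
          rw [hI]
          intro v hv
          have := hD v hv (fun j => eval v (∏ i, s i) * eval v (w' j)) (fun i => by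
            have h3 := (hI _).1 (hsI i) v hv
            obtain ⟨r, hr⟩ : s i ∣ ∏ i, s i := Finset.dvd_prod_of_mem _ (Finset.mem_univ i)
            rw [hr]
            have : eval v r * eval v (s i * ∑ j, pderiv j (f i) * w' j) = 0 := by rw [h3, mul_zero]
            rw [← this]
            simp only [map_mul, map_sum, Finset.mul_sum]
            exact Finset.sum_congr rfl fun j _ => by ring) p hp
          rw [← this]
          simp only [map_mul, map_sum, Finset.mul_sum]
          exact Finset.sum_congr rfl fun j _ => by ring
        have h3 := (hQp.mem_or_mem (hIQ h2)).resolve_left hprod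
        rw [← Ideal.Quotient.eq_zero_iff_mem, map_sum] at h3
        rw [← h3]
        simp [hw'])
    obtain ⟨s, rfl⟩ := Ideal.Quotient.mk_surjective s
    choose c' hc' using fun i => Ideal.Quotient.mk_surjective (c i)
    refine ⟨s, fun h => hs (Ideal.Quotient.eq_zero_iff_mem.2 h), c', fun j => ?_⟩
    rw [← Ideal.Quotient.eq_zero_iff_mem, map_sub, map_mul, hc, map_sum, sub_eq_zero]
    simp [hc']
  have hmap : maximalIdeal (Localization.AtPrime Q) = I.map (algebraMap _ _) := by
    rw [← Localization.AtPrime.map_eq_maximalIdeal]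
    refine le_antisymm (Ideal.map_le_iff_le_comap.2 fun q hq => ?_) (Ideal.map_mono hIQ)
    rw [Ideal.mem_comap, IsLocalization.algebraMap_mem_map_algebraMap_iff Q.primeCompl]
    exact claim1 q hq
  have hle2 : I.map (algebraMap _ (Localization.AtPrime Q)) ≤
      J.map (algebraMap _ _) ⊔ maximalIdeal (Localization.AtPrime Q) ^ 2 := by
    refine Ideal.map_le_iff_le_comap.2 fun p hp => ?_
    obtain ⟨s, hs, c, hc⟩ := claim2 p hp
    have hcJ : ∑ i, c i * f i ∈ J := J.sum_mem fun i _ =>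
      J.mul_mem_left _ (Ideal.subset_span ⟨i, rfl⟩)
    have hsq := algebraMap_mem_maximalIdeal_sq Q (q := s * p - ∑ i, c i * f i)
      (Q.sub_mem (Q.mul_mem_left _ (hIQ hp)) (hIQ (hJI hcJ))) fun j => by
        have h1 : pderiv j (s * p - ∑ i, c i * f i) =
            (s * pderiv j p - ∑ i, c i * pderiv j (f i)) +
              (pderiv j s * p - ∑ i, pderiv j (c i) * f i) := by
          simp only [map_sub, map_sum, Derivation.leibniz, smul_eq_mul, Finset.sum_add_distrib]
          simp only [mul_comm (f _), mul_comm p]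
          ring
        rw [h1]
        exact Q.add_mem (hc j) (Q.sub_mem (Q.mul_mem_left _ (hIQ hp)) (Q.sum_mem fun i _ =>
          Q.mul_mem_left _ (hIQ (hJI (Ideal.subset_span ⟨i, rfl⟩)))))
    rw [Ideal.mem_comap, ← Ideal.unit_mul_mem_iff_mem _
      (IsLocalization.map_units (Localization.AtPrime Q) (⟨s, hs⟩ : Q.primeCompl)), ← map_mul]
    have := Ideal.add_mem _ (Ideal.mem_sup_right (S := J.map (algebraMap _ _)) hsq)
      (Ideal.mem_sup_left (Ideal.mem_map_of_mem _ hcJ))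
    rwa [← map_add, sub_add_cancel] at this
  rw [← hmap, pow_two] at hle2
  have hle3 : maximalIdeal (Localization.AtPrime Q) ≤ J.map (algebraMap _ _) :=
    Submodule.le_of_le_smul_of_le_jacobson_bot (IsNoetherian.noetherian _)
      (maximalIdeal_le_jacobson _) hle2
  have hpm := hle3 (hmap ▸ Ideal.mem_map_of_mem _ hp)
  rw [IsLocalization.algebraMap_mem_map_algebraMap_iff Q.primeCompl] at hpm
  obtain ⟨s, hs, hsp⟩ := hpm
  refine hs (hle (Submodule.mem_colon_singleton.2 ?_))
  rw [Submodule.mem_bot]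
  exact Ideal.Quotient.eq_zero_iff_mem.2 hsp

end Jacobian

section Reynolds

/-- The action `p ↦ p ∘ g` of a matrix on polynomial functions. -/
def comp {n : ℕ} (g : Matrix (Fin n) (Fin n) ℂ) :
    MvPolynomial (Fin n) ℂ →ₐ[ℂ] MvPolynomial (Fin n) ℂ :=
  aeval fun i => ∑ j, C (g i j) * X j

lemma eval_comp {n : ℕ} (g : Matrix (Fin n) (Fin n) ℂ) (p : MvPolynomial (Fin n) ℂ)
    (v : Fin n → ℂ) : eval v (comp g p) = eval (g.mulVec v) p := by
  have : (aeval v).comp (comp g) = aeval (R := ℂ) (g.mulVec v) :=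
    MvPolynomial.algHom_ext fun i => by simp [comp, Matrix.mulVec, dotProduct]
  simpa [coe_aeval_eq_eval] using DFunLike.congr_fun this p

/-- The generic translate of a polynomial, with coefficients polynomial in the matrix entries. -/
def genericComp {n : ℕ} (p : MvPolynomial (Fin n) ℂ) :
    MvPolynomial (Fin n) (MvPolynomial (Fin n × Fin n) ℂ) :=
  aeval (fun i => ∑ j, C (X (i, j)) * X j) p

lemma map_genericComp {n : ℕ} (p : MvPolynomial (Fin n) ℂ) (g : Matrix (Fin n) (Fin n) ℂ) :
    map (eval fun ij : Fin n × Fin n => g ij.1 ij.2) (genericComp p) = comp g p := by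
  induction p using MvPolynomial.induction_on with
  | C a =>
    simp [genericComp, comp, MvPolynomial.algebraMap_eq, MvPolynomial.algebraMap_apply]
  | add p q hp hq =>
    simp only [genericComp, map_add] at *
    rw [hp, hq]
  | mul_X p i hp =>
    simp only [genericComp, map_mul] at *
    rw [hp]
    simp [comp]

lemma linear_comp_eq_sum {n : ℕ} (p : MvPolynomial (Fin n) ℂ)
    (ℓ : MvPolynomial (Fin n) ℂ →ₗ[ℂ] ℂ) (g : Matrix (Fin n) (Fin n) ℂ) :
    ℓ (comp g p) = ∑ m ∈ (genericComp p).support,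
      eval (fun ij : Fin n × Fin n => g ij.1 ij.2) (coeff m (genericComp p)) *
        ℓ (monomial m 1) := by
  conv_lhs => rw [← map_genericComp, (genericComp p).as_sum]
  simp only [map_sum, map_monomial]
  refine Finset.sum_congr rfl fun m _ => ?_
  rw [← smul_eq_mul, ← map_smul, smul_monomial, smul_eq_mul, mul_one]

open MeasureTheory in
/-- Averaging over a compact matrix group. -/
lemma exists_average {n : ℕ} (K : Set (Matrix (Fin n) (Fin n) ℂ)) (hK : IsCompact K)
    (hKg : IsMatSubgroup ℂ n K) (p : MvPolynomial (Fin n) ℂ) :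
    ∃ p' : MvPolynomial (Fin n) ℂ, Invariant ℂ n K p' ∧
      ∀ (ℓ : MvPolynomial (Fin n) ℂ →ₗ[ℂ] ℂ) (c : ℂ), (∀ g ∈ K, ℓ (comp g p) = c) → ℓ p' = c := by
  let H : Subgroup (Matrix (Fin n) (Fin n) ℂ)ˣ :=
    { carrier := {u | (u : Matrix (Fin n) (Fin n) ℂ) ∈ K}
      mul_mem' := fun {a b} ha hb => hKg.2.1 _ ha _ hb
      one_mem' := hKg.1
      inv_mem' := fun {a} ha => by
        have := (hKg.2.2 _ ha).2
        rwa [← Matrix.coe_units_inv] at this }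
  have hHc : IsCompact (H : Set (Matrix (Fin n) (Fin n) ℂ)ˣ) := by
    have hu : ∀ g : K, IsUnit (g : Matrix (Fin n) (Fin n) ℂ) := fun g => (hKg.2.2 _ g.2).1
    have hcont : Continuous fun g : K => (hu g).unit := by
      rw [Units.continuous_iff]
      refine ⟨continuous_subtype_val, ?_⟩
      have : ∀ g : K, (((hu g).unit⁻¹ : (Matrix (Fin n) (Fin n) ℂ)ˣ) : Matrix _ _ ℂ) =
          (g : Matrix (Fin n) (Fin n) ℂ).det⁻¹ • (g : Matrix (Fin n) (Fin n) ℂ).adjugate := by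
        intro g
        rw [Matrix.coe_units_inv, IsUnit.unit_spec, Matrix.inv_def, Ring.inverse_eq_inv']
      simp only [this]
      refine Continuous.smul
        (continuous_subtype_val.matrix_det.inv₀ fun g => ?_) continuous_subtype_val.matrix_adjugate
      exact ((Matrix.isUnit_iff_isUnit_det _).1 (hu g)).ne_zero
    have : CompactSpace K := isCompact_iff_compactSpace.1 hK
    convert isCompact_range hcont
    ext u
    refine ⟨fun h => ⟨⟨u, h⟩, Units.ext rfl⟩, ?_⟩
    rintro ⟨g, rfl⟩
    exact g.2
  have : CompactSpace H := isCompact_iff_compactSpace.1 hHc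
  let _ : MeasurableSpace H := borel H
  have : BorelSpace H := ⟨rfl⟩
  let μ : Measure H := Measure.haarMeasure ⊤
  have hμ : IsProbabilityMeasure μ := ⟨by
    simpa using Measure.haarMeasure_self (G := H) (K₀ := ⊤)⟩
  let mat : H → Matrix (Fin n) (Fin n) ℂ := fun h => ((h⁻¹ : H) : (Matrix (Fin n) (Fin n) ℂ)ˣ)
  have hmat : Continuous mat :=
    Units.continuous_val.comp (continuous_subtype_val.comp continuous_inv)
  have hmatK : ∀ h, mat h ∈ K := fun h => (h⁻¹).2
  have hint : ∀ q : MvPolynomial (Fin n × Fin n) ℂ,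
      Integrable (fun h => eval (fun ij : Fin n × Fin n => mat h ij.1 ij.2) q) μ := by
    intro q
    refine Continuous.integrable_of_hasCompactSupport ?_ (HasCompactSupport.of_compactSpace _)
    refine (MvPolynomial.continuous_eval q).comp ?_
    fun_prop
  let p' : MvPolynomial (Fin n) ℂ := ∑ m ∈ (genericComp p).support,
    monomial m (∫ h, eval (fun ij : Fin n × Fin n => mat h ij.1 ij.2) (coeff m (genericComp p)) ∂μ)
  have hℓ : ∀ ℓ : MvPolynomial (Fin n) ℂ →ₗ[ℂ] ℂ, ℓ p' = ∫ h, ℓ (comp (mat h) p) ∂μ := by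
    intro ℓ
    simp only [linear_comp_eq_sum]
    rw [integral_finsetSum _ fun m _ => (hint _).mul_const _, map_sum]
    refine Finset.sum_congr rfl fun m _ => ?_
    rw [integral_mul_const, ← smul_eq_mul, ← map_smul, smul_monomial, smul_eq_mul, mul_one]
  refine ⟨p', fun g hg v => ?_, fun ℓ c hc => ?_⟩
  · have hev : ∀ u : Fin n → ℂ, eval u p' = ∫ h, eval ((mat h).mulVec u) p ∂μ := fun u => by
      simpa [coe_aeval_eq_eval, eval_comp] using hℓ (aeval u).toLinearMap
    obtain ⟨u, rfl⟩ := (hKg.2.2 g hg).1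
    let k : H := ⟨u, hg⟩
    rw [hev, hev, ← integral_mul_left_eq_self _ k]
    refine integral_congr_ae (Filter.Eventually.of_forall fun h => ?_)
    have : mat (k * h) * (u : Matrix (Fin n) (Fin n) ℂ) = mat h :=
      congrArg (fun x : H => ((x : (Matrix (Fin n) (Fin n) ℂ)ˣ) : Matrix (Fin n) (Fin n) ℂ))
        (show (k * h)⁻¹ * k = h⁻¹ by group)
    simp only [Matrix.mulVec_mulVec, this]
  · rw [hℓ]
    simp [hc _ (hmatK _)]

/-- Reynolds averaging for reductive groups. -/
lemma exists_invariant_average {n : ℕ} {G : Set (Matrix (Fin n) (Fin n) ℂ)}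
    (hG : IsReductiveGroup ℂ n G) (p : MvPolynomial (Fin n) ℂ) :
    ∃ p' : MvPolynomial (Fin n) ℂ, Invariant ℂ n G p' ∧
      ∀ (ℓ : MvPolynomial (Fin n) ℂ →ₗ[ℂ] ℂ) (c : ℂ), (∀ g ∈ G, ℓ (comp g p) = c) → ℓ p' = c := by
  obtain ⟨-, -, K, hKG, hK, hKg, hdense⟩ := hG
  obtain ⟨p', hp', hℓ⟩ := exists_average K hK hKg p
  refine ⟨p', fun g hg v => ?_, fun ℓ c hc => hℓ ℓ c fun g hg => hc g (hKG hg)⟩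
  have hev : ∀ g : Matrix (Fin n) (Fin n) ℂ, eval (fun ij : Fin n × Fin n => g ij.1 ij.2)
      (aeval (fun i => ∑ j, C (v j) * X (i, j)) p' - C (eval v p')) =
        eval (g.mulVec v) p' - eval v p' := by
    intro g
    have : (aeval (R := ℂ) fun ij : Fin n × Fin n => g ij.1 ij.2).comp
        (aeval fun i => ∑ j, C (v j) * X (i, j)) = aeval (R := ℂ) (g.mulVec v) :=
      MvPolynomial.algHom_ext fun i => by simp [Matrix.mulVec, dotProduct, mul_comm]
    have := DFunLike.congr_fun this p'
    rw [map_sub, eval_C]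
    exact congrArg (· - eval v p') this
  have := hdense _ (fun k hk => by rw [hev, hp' k hk v, sub_self]) g hg
  rwa [hev, sub_eq_zero] at this

end Reynolds

section DirDeriv

/-- The derivative of a polynomial function at `v` in the direction `w`, as a functional. -/
def dirDeriv {n : ℕ} (v w : Fin n → ℂ) : MvPolynomial (Fin n) ℂ →ₗ[ℂ] ℂ :=
  ∑ j, w j • (aeval v).toLinearMap ∘ₗ (pderiv j).toLinearMap

lemma dirDeriv_apply {n : ℕ} (v w : Fin n → ℂ) (p : MvPolynomial (Fin n) ℂ) :
    dirDeriv v w p = ∑ j, eval v (pderiv j p) * w j := by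
  simp [dirDeriv, mul_comm]

lemma dirDeriv_mul {n : ℕ} (v w : Fin n → ℂ) (p q : MvPolynomial (Fin n) ℂ) :
    dirDeriv v w (p * q) = eval v p * dirDeriv v w q + eval v q * dirDeriv v w p := by
  simp only [dirDeriv_apply, Derivation.leibniz, smul_eq_mul, map_add, map_mul, Finset.mul_sum,
    ← Finset.sum_add_distrib]
  exact Finset.sum_congr rfl fun j _ => by ring

@[simp]
lemma dirDeriv_C {n : ℕ} (v w : Fin n → ℂ) (a : ℂ) : dirDeriv v w (C a) = 0 := by
  simp [dirDeriv_apply]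

@[simp]
lemma dirDeriv_X {n : ℕ} (v w : Fin n → ℂ) (i : Fin n) : dirDeriv v w (X i) = w i := by
  classical
  simp only [dirDeriv_apply, pderiv_X]
  rw [Finset.sum_eq_single i] <;> simp +contextual [eq_comm]

lemma dirDeriv_add_right {n : ℕ} (v w w' : Fin n → ℂ) (p : MvPolynomial (Fin n) ℂ) :
    dirDeriv v (w + w') p = dirDeriv v w p + dirDeriv v w' p := by
  simp [dirDeriv_apply, mul_add, Finset.sum_add_distrib]

lemma dirDeriv_smul_right {n : ℕ} (v w : Fin n → ℂ) (a : ℂ) (p : MvPolynomial (Fin n) ℂ) :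
    dirDeriv v (a • w) p = a * dirDeriv v w p := by
  simp [dirDeriv_apply, Finset.mul_sum, mul_left_comm]

lemma dirDeriv_eq_zero_of_mem_span {n : ℕ} {v w : Fin n → ℂ} {S : Set (MvPolynomial (Fin n) ℂ)}
    (hv : ∀ p ∈ S, eval v p = 0) (hw : ∀ p ∈ S, dirDeriv v w p = 0) {p : MvPolynomial (Fin n) ℂ}
    (hp : p ∈ Ideal.span S) : dirDeriv v w p = 0 := by
  have hker : Ideal.span S ≤ RingHom.ker (eval v) := Ideal.span_le.2 hv
  induction hp using Submodule.span_induction with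
  | mem p hp => exact hw p hp
  | zero => exact map_zero _
  | add p q _ _ hp hq => rw [map_add, hp, hq, add_zero]
  | smul r p hp hp' =>
    rw [smul_eq_mul, dirDeriv_mul, hp', (RingHom.mem_ker).1 (hker hp), mul_zero, zero_mul,
      add_zero]

lemma dirDeriv_comp {n : ℕ} (g : Matrix (Fin n) (Fin n) ℂ) (v w : Fin n → ℂ)
    (p : MvPolynomial (Fin n) ℂ) :
    dirDeriv v w (comp g p) = dirDeriv (g.mulVec v) (g.mulVec w) p := by
  induction p using MvPolynomial.induction_on with
  | C a =>
    rw [show comp g (C a) = C a from (comp g).commutes a, dirDeriv_C, dirDeriv_C]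
  | add p q hp hq => simp only [map_add, hp, hq]
  | mul_X p i hp =>
    rw [map_mul, dirDeriv_mul, dirDeriv_mul, hp, eval_comp, eval_comp, dirDeriv_X]
    congr 2
    simp [comp, dirDeriv_mul, Matrix.mulVec, dotProduct]

lemma hasDerivAt_eval {n : ℕ} (p : MvPolynomial (Fin n) ℂ) {γ : ℂ → Fin n → ℂ} {w : Fin n → ℂ}
    {t : ℂ} (hγ : HasDerivAt γ w t) :
    HasDerivAt (fun s => eval (γ s) p) (dirDeriv (γ t) w p) t := by
  induction p using MvPolynomial.induction_on with
  | C a => simpa using hasDerivAt_const t a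
  | add p q hp hq => simpa only [map_add] using hp.fun_add hq
  | mul_X p i hp =>
    simp only [map_mul, eval_X, dirDeriv_mul, dirDeriv_X]
    exact (hp.fun_mul (hasDerivAt_pi.1 hγ i)).congr_deriv (by ring)

attribute [local instance] Matrix.linftyOpNormedRing Matrix.linftyOpNormedAlgebra in
lemma hasDerivAt_mexp_mulVec {n : ℕ} (A : Matrix (Fin n) (Fin n) ℂ) (v : Fin n → ℂ) :
    HasDerivAt (fun t : ℂ => (mexp ℂ n (t • A)).mulVec v) (A.mulVec v) 0 := by
  have h1 : ∀ B : Matrix (Fin n) (Fin n) ℂ, mexp ℂ n B = NormedSpace.exp B := fun B => by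
    rw [NormedSpace.exp_eq_tsum ℂ]
    rfl
  have h2 : HasDerivAt (fun t : ℂ => mexp ℂ n (t • A)) A 0 := by
    simp only [h1]
    have h := hasDerivAt_exp_smul_const (𝕂 := ℂ) A (0 : ℂ)
    rw [zero_smul, NormedSpace.exp_zero, one_mul] at h
    exact h
  let L : Matrix (Fin n) (Fin n) ℂ →L[ℂ] (Fin n → ℂ) :=
    LinearMap.toContinuousLinearMap
      { toFun := fun B => B.mulVec v
        map_add' := fun B B' => Matrix.add_mulVec B B' v
        map_smul' := fun a B => Matrix.smul_mulVec a B v }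
  exact L.hasFDerivAt.comp_hasDerivAt (0 : ℂ) h2

lemma algHom_apply_eq_eval {n : ℕ} (ψ : MvPolynomial (Fin n) ℂ →ₐ[ℂ] ℂ)
    (c : MvPolynomial (Fin n) ℂ) : ψ c = eval (fun i => ψ (X i)) c := by
  rw [← coe_aeval_eq_eval]
  exact DFunLike.congr_fun (MvPolynomial.algHom_ext (f := ψ)
    (g := aeval fun i => ψ (X i)) fun i => by simp) c

lemma mem_vanishingIdeal {n : ℕ} {Y : Set (Fin n → ℂ)} {p : MvPolynomial (Fin n) ℂ} :
    p ∈ vanishingIdeal ℂ n Y ↔ ∀ y ∈ Y, eval y p = 0 :=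
  Iff.rfl

lemma mexp_zero {n : ℕ} : mexp ℂ n 0 = 1 := by
  rw [mexp, tsum_eq_single 0] <;> simp +contextual

/-- A polynomial vanishing along a curve has zero derivative in the direction of the curve. -/
lemma dirDeriv_eq_zero_of_curve {n : ℕ} {p : MvPolynomial (Fin n) ℂ} {γ : ℂ → Fin n → ℂ}
    {v w : Fin n → ℂ} (hγ : HasDerivAt γ w 0) (h0 : γ 0 = v) (hp : ∀ t, eval (γ t) p = 0) :
    dirDeriv v w p = 0 := by
  have h := hasDerivAt_eval p hγ
  rw [h0] at h
  simp only [hp] at h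
  exact h.unique (hasDerivAt_const (0 : ℂ) (0 : ℂ))

/-- Functions vanishing on a stable set have zero derivative along the orbits. -/
lemma dirDeriv_eq_zero_of_mem_orbitTangent {n : ℕ} {G : Set (Matrix (Fin n) (Fin n) ℂ)}
    {Y : Set (Fin n → ℂ)} (hY : Stabilizes ℂ n G Y) {v : Fin n → ℂ} (hv : v ∈ Y)
    {p : MvPolynomial (Fin n) ℂ} (hp : p ∈ vanishingIdeal ℂ n Y) {w : Fin n → ℂ}
    (hw : w ∈ orbitTangent ℂ n G v) : dirDeriv v w p = 0 := by
  induction hw using Submodule.span_induction with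
  | mem w hw =>
    obtain ⟨A, hA, rfl⟩ := hw
    have hA' : ∀ t : ℂ, mexp ℂ n (t • A) ∈ G := hA
    refine dirDeriv_eq_zero_of_curve (hasDerivAt_mexp_mulVec A v) ?_ fun t => ?_
    · rw [zero_smul, mexp_zero, Matrix.one_mulVec]
    · exact mem_vanishingIdeal.1 hp _ (hY _ (hA' t) v hv)
  | zero => simp [dirDeriv_apply]
  | add w w' _ _ hw hw' => rw [dirDeriv_add_right, hw, hw', add_zero]
  | smul a w _ hw => rw [dirDeriv_smul_right, hw, mul_zero]

end DirDeriv

section CoordinateRing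

/-- The generating functions of the coordinate ring of a matrix group: the matrix entries
and the inverse of the determinant. -/
def coordFun {n : ℕ} (G : Set (Matrix (Fin n) (Fin n) ℂ)) :
    Option (Fin n × Fin n) → G → ℂ
  | none => fun g => (g.1.det)⁻¹
  | some ij => fun g => g.1 ij.1 ij.2

/-- The ring of regular functions on a matrix group. -/
abbrev coordRing {n : ℕ} (G : Set (Matrix (Fin n) (Fin n) ℂ)) : Subalgebra ℂ (G → ℂ) :=
  Algebra.adjoin ℂ (Set.range (coordFun G))

instance {n : ℕ} (G : Set (Matrix (Fin n) (Fin n) ℂ)) : Algebra.FiniteType ℂ (coordRing G) :=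
  (Subalgebra.fg_iff_finiteType _).1
    (Subalgebra.fg_def.2 ⟨_, Set.finite_range (coordFun G), rfl⟩)

/-- The generators, as elements of the coordinate ring. -/
def coordGen {n : ℕ} (G : Set (Matrix (Fin n) (Fin n) ℂ)) (o : Option (Fin n × Fin n)) :
    coordRing G :=
  ⟨coordFun G o, Algebra.subset_adjoin ⟨o, rfl⟩⟩

lemma coe_aeval_coordGen {n : ℕ} {G : Set (Matrix (Fin n) (Fin n) ℂ)} (g : G)
    (p : MvPolynomial (Fin n × Fin n) ℂ) :
    (aeval (fun ij => coordGen G (some ij)) p : coordRing G).1 g =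
      eval (fun ij => g.1 ij.1 ij.2) p := by
  have : ((Pi.evalAlgHom ℂ (fun _ : G => ℂ) g).comp (coordRing G).val).comp
      (aeval fun ij => coordGen G (some ij)) = aeval (R := ℂ) fun ij => g.1 ij.1 ij.2 :=
    MvPolynomial.algHom_ext fun i => by simp [coordGen, coordFun]
  simpa [coe_aeval_eq_eval] using DFunLike.congr_fun this p

/-- The points of the coordinate ring of a linear algebraic group are the group elements. -/
lemma exists_eq_eval_of_isZClosedInGL {n : ℕ} {G : Set (Matrix (Fin n) (Fin n) ℂ)}
    (hG : IsZClosedInGL ℂ n G) (ψ : coordRing G →ₐ[ℂ] ℂ) :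
    ∃ g : G, ∀ h : coordRing G, ψ h = h.1 g := by
  obtain ⟨P, hP⟩ := hG
  have hGu : ∀ g ∈ G, IsUnit g ∧ ∀ p ∈ P, eval (fun ij => g ij.1 ij.2) p = 0 := fun g hg => by
    rw [hP] at hg
    exact hg
  let M : Matrix (Fin n) (Fin n) ℂ := Matrix.of fun i j => ψ (coordGen G (some (i, j)))
  have hev : ∀ p : MvPolynomial (Fin n × Fin n) ℂ,
      ψ (aeval (fun ij => coordGen G (some ij)) p) = eval (fun ij => M ij.1 ij.2) p := fun p => by
    have : ψ.comp (aeval fun ij => coordGen G (some ij)) =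
        aeval (R := ℂ) fun ij => M ij.1 ij.2 :=
      MvPolynomial.algHom_ext fun i => by simp [M]
    simpa [coe_aeval_eq_eval] using DFunLike.congr_fun this p
  have hdetp : ∀ N : Matrix (Fin n) (Fin n) ℂ, eval (fun ij : Fin n × Fin n => N ij.1 ij.2)
      (Matrix.det (Matrix.of fun i j => X (i, j))) = N.det := fun N => by
    rw [RingHom.map_det]
    congr 1
    ext i j
    simp
  have hdet : ψ (coordGen G none) * M.det = 1 := by
    rw [← hdetp M, ← hev, ← map_mul, ← map_one ψ]
    congr 1
    ext g
    have hg := (Matrix.isUnit_iff_isUnit_det _).1 (hGu g.1 g.2).1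
    change (coordGen G none).1 g * (aeval (fun ij => coordGen G (some ij)) _ : coordRing G).1 g = 1
    rw [coe_aeval_coordGen, hdetp]
    exact inv_mul_cancel₀ hg.ne_zero
  have hM : M ∈ G := by
    rw [hP]
    refine ⟨(Matrix.isUnit_iff_isUnit_det _).2 (IsUnit.of_mul_eq_one _ ((mul_comm _ _).trans hdet)),
      fun p hp => ?_⟩
    rw [← hev, ← map_zero ψ]
    congr 1
    ext g
    rw [coe_aeval_coordGen]
    exact (hGu g.1 g.2).2 p hp
  refine ⟨⟨M, hM⟩, ?_⟩
  rintro ⟨h, hh⟩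
  induction hh using Algebra.adjoin_induction with
  | mem h hh =>
    obtain ⟨o, rfl⟩ := hh
    cases o with
    | none => exact eq_inv_of_mul_eq_one_left hdet
    | some ij => rfl
  | algebraMap r => exact ψ.commutes r
  | add x y hx hy ihx ihy => exact (map_add ψ ⟨x, hx⟩ ⟨y, hy⟩).trans (congr_arg₂ _ ihx ihy)
  | mul x y hx hy ihx ihy => exact (map_mul ψ ⟨x, hx⟩ ⟨y, hy⟩).trans (congr_arg₂ _ ihx ihy)

/-- The orbit map `g ↦ g v` on the level of functions. -/
def orbitMap {n : ℕ} (G : Set (Matrix (Fin n) (Fin n) ℂ)) (v : Fin n → ℂ) :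
    MvPolynomial (Fin n) ℂ →ₐ[ℂ] coordRing G :=
  aeval fun j => ∑ l, v l • coordGen G (some (j, l))

lemma coe_orbitMap {n : ℕ} {G : Set (Matrix (Fin n) (Fin n) ℂ)} (v : Fin n → ℂ) (g : G)
    (p : MvPolynomial (Fin n) ℂ) : (orbitMap G v p).1 g = eval (g.1.mulVec v) p := by
  have : ((Pi.evalAlgHom ℂ (fun _ : G => ℂ) g).comp (coordRing G).val).comp (orbitMap G v) =
      aeval (R := ℂ) (g.1.mulVec v) :=
    MvPolynomial.algHom_ext fun i => by
      simp [orbitMap, coordGen, coordFun, Matrix.mulVec, dotProduct, mul_comm]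
  simpa [coe_aeval_eq_eval] using DFunLike.congr_fun this p

/-- The function `g ↦ dirDeriv (g v) (g w) p` on the group. -/
def translateDeriv {n : ℕ} (G : Set (Matrix (Fin n) (Fin n) ℂ)) (v w : Fin n → ℂ)
    (p : MvPolynomial (Fin n) ℂ) : coordRing G :=
  ∑ j, orbitMap G v (pderiv j p) * ∑ l, w l • coordGen G (some (j, l))

lemma coe_translateDeriv {n : ℕ} {G : Set (Matrix (Fin n) (Fin n) ℂ)} (v w : Fin n → ℂ) (g : G)
    (p : MvPolynomial (Fin n) ℂ) :
    (translateDeriv G v w p).1 g = dirDeriv (g.1.mulVec v) (g.1.mulVec w) p := by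
  simp [translateDeriv, dirDeriv_apply, coe_orbitMap, coordGen, coordFun, Matrix.mulVec,
    dotProduct, mul_comm]

end CoordinateRing

section PrincipalOrbits

lemma comp_mem_vanishingIdeal {n : ℕ} {G : Set (Matrix (Fin n) (Fin n) ℂ)} {Y : Set (Fin n → ℂ)}
    (hY : Stabilizes ℂ n G Y) {g : Matrix (Fin n) (Fin n) ℂ} (hg : g ∈ G)
    {p : MvPolynomial (Fin n) ℂ} (hp : p ∈ vanishingIdeal ℂ n Y) :
    comp g p ∈ vanishingIdeal ℂ n Y := fun y hy => by
  rw [eval_comp]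
  exact hp _ (hY g hg y hy)

lemma IsMatSubgroup.inv_mul_cancel {n : ℕ} {G : Set (Matrix (Fin n) (Fin n) ℂ)}
    (hG : IsMatSubgroup ℂ n G) {g : Matrix (Fin n) (Fin n) ℂ} (hg : g ∈ G) : g⁻¹ * g = 1 :=
  Matrix.nonsing_inv_mul _ ((Matrix.isUnit_iff_isUnit_det _).1 (hG.2.2 g hg).1)

lemma IsMatSubgroup.mul_inv_cancel {n : ℕ} {G : Set (Matrix (Fin n) (Fin n) ℂ)}
    (hG : IsMatSubgroup ℂ n G) {g : Matrix (Fin n) (Fin n) ℂ} (hg : g ∈ G) : g * g⁻¹ = 1 :=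
  Matrix.mul_nonsing_inv _ ((Matrix.isUnit_iff_isUnit_det _).1 (hG.2.2 g hg).1)

/-- Along a principal orbit, the derivative at `g v` in the direction `g w` depends only
on `g v`. -/
lemma dirDeriv_mulVec_eq {n : ℕ} {G : Set (Matrix (Fin n) (Fin n) ℂ)} (hG : IsMatSubgroup ℂ n G)
    {Y : Set (Fin n → ℂ)} (hY : Stabilizes ℂ n G Y) {v : Fin n → ℂ} (hv : v ∈ Y)
    (hpr : IsPrincipalPt ℂ n G v) (w : Fin n → ℂ) {p : MvPolynomial (Fin n) ℂ}
    (hp : p ∈ vanishingIdeal ℂ n Y) {g₁ g₂ : Matrix (Fin n) (Fin n) ℂ} (hg₁ : g₁ ∈ G)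
    (hg₂ : g₂ ∈ G) (h : g₁.mulVec v = g₂.mulVec v) :
    dirDeriv (g₁.mulVec v) (g₁.mulVec w) p = dirDeriv (g₂.mulVec v) (g₂.mulVec w) p := by
  obtain ⟨-, N, hN, htriv⟩ := hpr
  have hs : g₁⁻¹ * g₂ ∈ isotropy ℂ n G v :=
    ⟨hG.2.1 _ (hG.2.2 _ hg₁).2 _ hg₂, by
      rw [← Matrix.mulVec_mulVec, ← h, Matrix.mulVec_mulVec, hG.inv_mul_cancel hg₁,
        Matrix.one_mulVec]⟩
  have hsplit : g₂ = g₁ * (g₁⁻¹ * g₂) := by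
    rw [← mul_assoc, hG.mul_inv_cancel hg₁, one_mul]
  obtain ⟨t, ht, ν, hν, rfl⟩ : ∃ t ∈ orbitTangent ℂ n G v, ∃ ν ∈ N, t + ν = w :=
    Submodule.mem_sup.1 (hN.1.sup_eq_top ▸ Submodule.mem_top)
  have htan : ∀ g ∈ G, dirDeriv (g.mulVec v) (g.mulVec t) p = 0 := fun g hg => by
    rw [← dirDeriv_comp]
    exact dirDeriv_eq_zero_of_mem_orbitTangent hY hv (comp_mem_vanishingIdeal hY hg hp) ht
  have hfix : g₂.mulVec ν = g₁.mulVec ν := by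
    rw [hsplit, ← Matrix.mulVec_mulVec, htriv _ hs ν hν]
  rw [Matrix.mulVec_add, Matrix.mulVec_add, dirDeriv_add_right, dirDeriv_add_right,
    htan g₁ hg₁, htan g₂ hg₂, hfix, h]

/-- For a principal point `v`, the functions `g v ↦ dirDeriv (g v) (g w) p` on the orbit are
rational, with a common denominator. -/
lemma exists_common_denominator {n : ℕ} {G : Set (Matrix (Fin n) (Fin n) ℂ)}
    (hG : IsMatSubgroup ℂ n G) (hGz : IsZClosedInGL ℂ n G)
    {Y : Set (Fin n → ℂ)} (hY : Stabilizes ℂ n G Y) {v : Fin n → ℂ} (hv : v ∈ Y)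
    (hpr : IsPrincipalPt ℂ n G v) (w : Fin n → ℂ) :
    ∃ β : MvPolynomial (Fin n) ℂ, (∃ g ∈ G, eval (g.mulVec v) β ≠ 0) ∧
      ∀ p ∈ vanishingIdeal ℂ n Y, ∃ α : MvPolynomial (Fin n) ℂ, ∀ g ∈ G,
        eval (g.mulVec v) β * dirDeriv (g.mulVec v) (g.mulVec w) p = eval (g.mulVec v) α := by
  classical
  let A : Subalgebra ℂ (coordRing G) := (orbitMap G v).range
  have : Nonempty G := ⟨⟨1, hG.1⟩⟩
  have : IsReduced (coordRing G) :=
    isReduced_of_injective (coordRing G).val Subtype.val_injective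
  have : IsReduced A := isReduced_of_injective A.val Subtype.val_injective
  obtain ⟨𝔭, h𝔭⟩ : (minimalPrimes A).Nonempty :=
    Set.nonempty_coe_sort.1 (Ideal.nonempty_minimalPrimes bot_ne_top)
  have : 𝔭.IsPrime := h𝔭.1.1
  have hrat : ∀ p ∈ vanishingIdeal ℂ n Y, ∃ b : MvPolynomial (Fin n) ℂ,
      (orbitMap G v).rangeRestrict b ∉ 𝔭 ∧ ∃ a : MvPolynomial (Fin n) ℂ, ∀ g ∈ G,
        eval (g.mulVec v) b * dirDeriv (g.mulVec v) (g.mulVec w) p = eval (g.mulVec v) a := by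
    intro p hp
    obtain ⟨⟨_, a, rfl⟩, ⟨_, b, rfl⟩, hb, hab⟩ :=
      exists_notMem_mul_eq (F := ℂ) (A := A) (h := translateDeriv G v w p) (fun ψ χ hψχ => by
        obtain ⟨g₁, hg₁⟩ := exists_eq_eval_of_isZClosedInGL hGz ψ
        obtain ⟨g₂, hg₂⟩ := exists_eq_eval_of_isZClosedInGL hGz χ
        rw [hg₁, hg₂, coe_translateDeriv, coe_translateDeriv]
        refine dirDeriv_mulVec_eq hG hY hv hpr w hp g₁.2 g₂.2 (funext fun j => ?_)
        have := hψχ ⟨orbitMap G v (X j), X j, rfl⟩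
        change ψ (orbitMap G v (X j)) = χ (orbitMap G v (X j)) at this
        rw [hg₁, hg₂, coe_orbitMap, coe_orbitMap] at this
        simpa using this) h𝔭
    refine ⟨b, hb, a, fun g hg => ?_⟩
    have := congr_fun (congr_arg Subtype.val hab) ⟨g, hg⟩
    change (orbitMap G v b).1 ⟨g, hg⟩ * (translateDeriv G v w p).1 ⟨g, hg⟩ =
      (orbitMap G v a).1 ⟨g, hg⟩ at this
    rwa [coe_orbitMap, coe_orbitMap, coe_translateDeriv] at this
  obtain ⟨S, hS⟩ : (vanishingIdeal ℂ n Y).FG := IsNoetherian.noetherian _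
  have hSI : ∀ q ∈ S, q ∈ vanishingIdeal ℂ n Y := fun q hq => hS ▸ Submodule.subset_span hq
  have : ∀ q : S, ∃ b : MvPolynomial (Fin n) ℂ,
      (orbitMap G v).rangeRestrict b ∉ 𝔭 ∧ ∃ a : MvPolynomial (Fin n) ℂ, ∀ g ∈ G,
        eval (g.mulVec v) b * dirDeriv (g.mulVec v) (g.mulVec w) q.1 = eval (g.mulVec v) a :=
    fun q => hrat q.1 (hSI q.1 q.2)
  choose b hb a ha using this
  refine ⟨∏ q, b q, ?_, fun p hp => ?_⟩
  · by_contra! h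
    have hzero : (orbitMap G v).rangeRestrict (∏ q, b q) = 0 :=
      Subtype.ext (Subtype.ext (funext fun g => (coe_orbitMap v g _).trans (h g.1 g.2)))
    have hprod := hzero ▸ 𝔭.zero_mem
    rw [map_prod] at hprod
    obtain ⟨q, -, hq⟩ := (Ideal.IsPrime.prod_mem_iff (p := 𝔭)).1 hprod
    exact hb q hq
  · rw [← hS] at hp
    induction hp using Submodule.span_induction with
    | mem q hq =>
      refine ⟨a ⟨q, hq⟩ * ∏ q' ∈ Finset.univ.erase ⟨q, hq⟩, b q', fun g hg => ?_⟩
      rw [← Finset.mul_prod_erase _ _ (Finset.mem_univ (⟨q, hq⟩ : S)), map_mul, map_mul,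
        ← ha ⟨q, hq⟩ g hg]
      ring
    | zero => exact ⟨0, by simp⟩
    | add x y _ _ hx hy =>
      obtain ⟨α, hα⟩ := hx
      obtain ⟨α', hα'⟩ := hy
      exact ⟨α + α', fun g hg => by rw [map_add, map_add, mul_add, hα g hg, hα' g hg]⟩
    | smul r x hx hx' =>
      obtain ⟨α, hα⟩ := hx'
      refine ⟨r * α, fun g hg => ?_⟩
      have h0 : eval (g.mulVec v) x = 0 :=
        mem_vanishingIdeal.1 (hS ▸ hx) _ (hY g hg v hv)
      rw [smul_eq_mul, dirDeriv_mul, h0, map_mul, ← hα g hg]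
      ring

/-- At a principal point, the differentials of the functions vanishing on a stable set are
detected by the differentials of the invariants vanishing on it. -/
lemma exists_invariant_dirDeriv_eq_one {n : ℕ} {G : Set (Matrix (Fin n) (Fin n) ℂ)}
    (hG : IsReductiveGroup ℂ n G) {Y : Set (Fin n → ℂ)} (hY : Stabilizes ℂ n G Y)
    {v : Fin n → ℂ} (hv : v ∈ Y) (hpr : IsPrincipalPt ℂ n G v) {w : Fin n → ℂ}
    {p : MvPolynomial (Fin n) ℂ} (hp : p ∈ vanishingIdeal ℂ n Y) (hpw : dirDeriv v w p ≠ 0) :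
    ∃ q ∈ vanishingIdeal ℂ n Y, Invariant ℂ n G q ∧ dirDeriv v w q = 1 := by
  have hGg := hG.1
  obtain ⟨β, ⟨g₀, hg₀, hβ⟩, hα⟩ := exists_common_denominator hGg hG.2.1 hY hv hpr w
  let E : Ideal (MvPolynomial (Fin n) ℂ) :=
    { carrier := {c | ∃ q ∈ vanishingIdeal ℂ n Y, ∀ g ∈ G,
        eval (g.mulVec v) c = dirDeriv (g.mulVec v) (g.mulVec w) q}
      zero_mem' := ⟨0, Ideal.zero_mem _, by simp⟩
      add_mem' := by
        rintro c c' ⟨q, hq, h⟩ ⟨q', hq', h'⟩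
        exact ⟨q + q', Ideal.add_mem _ hq hq', fun g hg => by
          rw [map_add, map_add, h g hg, h' g hg]⟩
      smul_mem' := by
        rintro r c ⟨q, hq, h⟩
        refine ⟨r * q, Ideal.mul_mem_left _ _ hq, fun g hg => ?_⟩
        rw [dirDeriv_mul, mem_vanishingIdeal.1 hq _ (hY g hg v hv), zero_mul, add_zero,
          smul_eq_mul, map_mul, h g hg] }
  have hEcomp : ∀ c ∈ E, ∀ g ∈ G, comp g c ∈ E := by
    rintro c ⟨q, hq, h⟩ g hg
    refine ⟨comp g q, comp_mem_vanishingIdeal hY hg hq, fun g' hg' => ?_⟩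
    rw [eval_comp, dirDeriv_comp, Matrix.mulVec_mulVec, Matrix.mulVec_mulVec,
      h _ (hGg.2.1 _ hg _ hg')]
  have hE : E = ⊤ := by
    by_contra hne
    obtain ⟨ψ, hψ⟩ := exists_algHom_of_ne_top (F := ℂ) hne
    obtain ⟨g₁, hg₁, hu⟩ : (fun i => ψ (X i)) ∈ orbit ℂ n G v := hpr.1 fun c hc => by
      rw [← algHom_apply_eq_eval]
      exact hψ c ⟨0, Ideal.zero_mem _, fun g hg => by
        rw [map_zero]
        exact hc _ ⟨g, hg, rfl⟩⟩
    have hu' : ∀ c ∈ E, eval (g₁.mulVec v) c = 0 := fun c hc => by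
      rw [← hψ c hc, algHom_apply_eq_eval, ← hu]
    have hg₀' := (hGg.2.2 _ hg₀).2
    obtain ⟨α, hα⟩ := hα _ (comp_mem_vanishingIdeal hY hg₀' hp)
    have hαE : α ∈ E :=
      ⟨β * comp g₀⁻¹ p, Ideal.mul_mem_left _ _ (comp_mem_vanishingIdeal hY hg₀' hp),
        fun g hg => by
          rw [← hα g hg, dirDeriv_mul, mem_vanishingIdeal.1
            (comp_mem_vanishingIdeal hY hg₀' hp) _ (hY g hg v hv), zero_mul, add_zero]⟩
    have h1 := hu' _ (hEcomp α hαE (g₀ * g₁⁻¹) (hGg.2.1 _ hg₀ _ (hGg.2.2 _ hg₁).2))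
    rw [eval_comp, Matrix.mulVec_mulVec, mul_assoc, hGg.inv_mul_cancel hg₁, mul_one,
      ← hα g₀ hg₀, dirDeriv_comp, Matrix.mulVec_mulVec, Matrix.mulVec_mulVec,
      hGg.inv_mul_cancel hg₀, Matrix.one_mulVec, Matrix.one_mulVec] at h1
    exact mul_ne_zero hβ hpw h1
  obtain ⟨q, hq, h⟩ : (1 : MvPolynomial (Fin n) ℂ) ∈ E := hE ▸ Submodule.mem_top
  obtain ⟨q', hinv, hq'⟩ := exists_invariant_average hG q
  refine ⟨q', fun y hy => ?_, hinv, hq' _ 1 fun g hg => ?_⟩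
  · exact hq' (aeval y).toLinearMap 0 fun g hg => by
      simpa [coe_aeval_eq_eval] using comp_mem_vanishingIdeal hY hg hq y hy
  · rw [dirDeriv_comp, ← h g hg, map_one]

end PrincipalOrbits

section Saturated

lemma invariantIdeal_eq_span {n : ℕ} {G : Set (Matrix (Fin n) (Fin n) ℂ)} {Y : Set (Fin n → ℂ)}
    {k : ℕ} {f : Fin k → ↥(invariantSubalgebra ℂ n G)}
    (hgen : quotVanishingIdeal ℂ n G Y = Ideal.span (Set.range f)) :
    invariantIdeal ℂ n G Y =
      Ideal.span (Set.range fun i => (f i : MvPolynomial (Fin n) ℂ)) := by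
  apply le_antisymm
  · refine Ideal.span_le.2 ?_
    rintro p ⟨hinv, hp⟩
    have hmem : (⟨p, hinv⟩ : invariantSubalgebra ℂ n G) ∈ quotVanishingIdeal ℂ n G Y := hp
    rw [hgen] at hmem
    have := Ideal.mem_map_of_mem (invariantSubalgebra ℂ n G).val.toRingHom hmem
    rw [Ideal.map_span, ← Set.range_comp] at this
    exact this
  · refine Ideal.span_le.2 ?_
    rintro _ ⟨i, rfl⟩
    have hmem : f i ∈ quotVanishingIdeal ℂ n G Y := hgen ▸ Ideal.subset_span ⟨i, rfl⟩
    exact Ideal.subset_span ⟨(f i).2, hmem⟩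

lemma invariantIdeal_le_vanishingIdeal {n : ℕ} (G : Set (Matrix (Fin n) (Fin n) ℂ))
    (Y : Set (Fin n → ℂ)) : invariantIdeal ℂ n G Y ≤ vanishingIdeal ℂ n Y :=
  Ideal.span_le.2 fun _ hp => hp.2

/-- Invariants separate a saturated algebraic set from the points outside of it. -/
lemma exists_invariant_eval_eq_one {n : ℕ} {G : Set (Matrix (Fin n) (Fin n) ℂ)}
    (hG : IsReductiveGroup ℂ n G) {Y : Set (Fin n → ℂ)} (hYalg : IsAlgebraicSet ℂ n Y)
    (hY : Stabilizes ℂ n G Y) (hsat : IsSaturated ℂ n G Y) {z : Fin n → ℂ} (hz : z ∉ Y) :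
    ∃ p ∈ vanishingIdeal ℂ n Y, Invariant ℂ n G p ∧ eval z p = 1 := by
  have htop : vanishingIdeal ℂ n Y ⊔ vanishingIdeal ℂ n (orbit ℂ n G z) = ⊤ := by
    by_contra hne
    obtain ⟨ψ, hψ⟩ := exists_algHom_of_ne_top (F := ℂ) hne
    replace hψ : ∀ x ∈ _, eval (fun i => ψ (X i)) x = 0 := fun x hx =>
      (algHom_apply_eq_eval ψ x).symm.trans (hψ x hx)
    refine hz ?_
    rw [hsat]
    refine ⟨fun i => ψ (X i), ?_, fun p hp => ?_⟩
    · obtain ⟨S, hS⟩ := hYalg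
      rw [hS]
      refine fun p hp => hψ p (Ideal.mem_sup_left fun y hy => ?_)
      rw [hS] at hy
      exact hy p hp
    · have := hψ (p - C (eval z p)) (Ideal.mem_sup_right ?_)
      · rw [map_sub, eval_C, sub_eq_zero] at this
        exact this.symm
      · rintro _ ⟨g, hg, rfl⟩
        rw [map_sub, eval_C, hp g hg, sub_self]
  obtain ⟨a, ha, b, hb, hab⟩ := Submodule.mem_sup.1
    (htop ▸ Submodule.mem_top : (1 : MvPolynomial (Fin n) ℂ) ∈ _)
  obtain ⟨p, hinv, hp⟩ := exists_invariant_average hG a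
  refine ⟨p, fun y hy => ?_, hinv, ?_⟩
  · exact hp (aeval y).toLinearMap 0 fun g hg => by
      simpa [coe_aeval_eq_eval] using comp_mem_vanishingIdeal hY hg ha y hy
  · refine hp (aeval z).toLinearMap 1 fun g hg => ?_
    have h1 := congr_arg (eval (g.mulVec z)) hab
    rw [map_add, mem_vanishingIdeal.1 hb _ ⟨g, hg, rfl⟩, add_zero, map_one, ← eval_comp] at h1
    simpa [coe_aeval_eq_eval] using h1

/-- A saturated algebraic set is cut out by the invariants vanishing on it. -/
lemma vanishingIdeal_le_radical_invariantIdeal {n : ℕ} {G : Set (Matrix (Fin n) (Fin n) ℂ)}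
    (hG : IsReductiveGroup ℂ n G) {Y : Set (Fin n → ℂ)} (hYalg : IsAlgebraicSet ℂ n Y)
    (hY : Stabilizes ℂ n G Y) (hsat : IsSaturated ℂ n G Y) :
    vanishingIdeal ℂ n Y ≤ (invariantIdeal ℂ n G Y).radical := by
  rw [← MvPolynomial.vanishingIdeal_zeroLocus_eq_radical (K := ℂ)]
  intro p hp
  rw [MvPolynomial.mem_vanishingIdeal_iff]
  intro z hz
  rw [aeval_eq_eval]
  refine hp z ?_
  by_contra hzY
  obtain ⟨q, hq, hinv, h1⟩ := exists_invariant_eval_eq_one hG hYalg hY hsat hzY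
  have h0 := MvPolynomial.mem_zeroLocus_iff.1 hz q (Ideal.subset_span ⟨hinv, hq⟩)
  rw [aeval_eq_eval] at h0
  exact one_ne_zero (h1.symm.trans h0)

end Saturated

/-- **Theorem 1.4(2).** Let `G` be a complex reductive group, `V = ℂⁿ` a stable `G`-module
and `Y ⊆ V` a `G`-stable algebraic subset.  Suppose `Y_pr` is Zariski dense in `Y`, `Y` is
`G`-saturated, and the vanishing ideal of `π(Y)` in `ℂ[V//G] = ℂ[V]^G` is generated by
`f_1, …, f_k` where `k` is the codimension of `Y` in `V`.  Then `Y` is `G`-reduced. -/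
theorem G_reduced_of_pr_dense_saturated_codim
    (n : ℕ) (G : Set (Matrix (Fin n) (Fin n) ℂ)) (hG : IsReductiveGroup ℂ n G)
    (hstab : IsStableModule ℂ n G)
    (Y : Set (Fin n → ℂ)) (hYalg : IsAlgebraicSet ℂ n Y) (hYstab : Stabilizes ℂ n G Y)
    (hdense : ZDenseIn ℂ n (Y ∩ prPoints ℂ n G) Y)
    (hsat : IsSaturated ℂ n G Y)
    (k : ℕ) (f : Fin k → ↥(invariantSubalgebra ℂ n G))
    (hgen : quotVanishingIdeal ℂ n G Y = Ideal.span (Set.range f))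
    (hcodim : adim ℂ n Y + (k : WithBot ℕ∞) = (n : WithBot ℕ∞)) :
    IsGReduced ℂ n G Y := by
  have hspan := invariantIdeal_eq_span hgen
  have hle := invariantIdeal_le_vanishingIdeal G Y
  have hrad := vanishingIdeal_le_radical_invariantIdeal hG hYalg hYstab hsat
  refine le_antisymm hle ?_
  have hdim : ringKrullDim (MvPolynomial (Fin n) ℂ ⧸ invariantIdeal ℂ n G Y) ≤
      adim ℂ n Y := by
    rw [adim, ringKrullDim_quotient, ringKrullDim_quotient]
    rw [← PrimeSpectrum.zeroLocus_radical (invariantIdeal ℂ n G Y)]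
    exact Order.krullDim_le_of_strictMono (fun x => ⟨x.1, fun p hp => x.2 (hrad hp)⟩)
      fun x y hxy => hxy
  have hdim' := (add_le_add_left hdim (k : WithBot ℕ∞)).trans hcodim.le
  rw [hspan] at hle hrad hdim' ⊢
  refine le_span_of_forall_tangent _ (vanishingIdeal ℂ n Y) (Y ∩ prPoints ℂ n G)
    (fun p => ⟨fun hp v hv => hp v hv.1, hdense p⟩) hle hrad
    (fun Q => mem_minimalPrimes_of_isAssociatedPrime _ hdim') ?_
  rintro v ⟨hv, hpr⟩ w hw p hp
  simp only [← dirDeriv_apply] at hw ⊢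
  by_contra hne
  obtain ⟨q, hq, hinv, h1⟩ := exists_invariant_dirDeriv_eq_one hG hYstab hv hpr hp hne
  have hqs : q ∈ invariantIdeal ℂ n G Y := Ideal.subset_span ⟨hinv, hq⟩
  rw [hspan] at hqs
  have h0 : dirDeriv v w q = 0 := by
    refine dirDeriv_eq_zero_of_mem_span ?_ ?_ hqs
    · rintro _ ⟨i, rfl⟩
      exact hle (Ideal.subset_span ⟨i, rfl⟩) v hv
    · rintro _ ⟨i, rfl⟩
      exact hw i
  exact one_ne_zero (h1.symm.trans h0)

end ZPaper
end
end

section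
/- Let Y ⊆ V be a G-saturated algebraic subset and suppose I_G(Y) is generated by f_1, …, f_d ∈ ℂ[V]^G where d equals the codimension of Y in V. Then Y is G-reduced if and only if for every irreducible component Y_k of Y there is a point of Y_k at which the rank of the differential of f = (f_1, …, f_d): V → ℂ^d equals the codimension of Y_k. -/
/-!
Common framework: a "compact Lie group / complex reductive group acting on a
finite-dimensional module" is modelled as a subgroup of invertible `n × n`
matrices over `𝕜 = ℝ` or `ℂ` acting on `Fin n → 𝕜` by `Matrix.mulVec`.
Polynomial functions on the module are `MvPolynomial (Fin n) 𝕜`.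
-/

set_option synthInstance.maxHeartbeats 1000000
set_option maxHeartbeats 1000000

noncomputable section

open MvPolynomial

namespace ZPaper

variable (𝕜 : Type) [RCLike 𝕜] (n : ℕ)

section Shear

variable {k : Type*} [Field k] {n : ℕ}

/-- The algebra endomorphism sending `X i` to `X i + c X₀ ^ (u ^ i)` for `i ≠ 0`. -/
noncomputable def shearHom (k : Type*) [Field k] (n u : ℕ) (c : k) :
    MvPolynomial (Fin (n + 1)) k →ₐ[k] MvPolynomial (Fin (n + 1)) k :=
  aeval fun i ↦ if i = 0 then X 0 else X i + c • X 0 ^ (u ^ i.1)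

lemma shearHom_comp_neg (u : ℕ) (c : k) :
    (shearHom k n u c).comp (shearHom k n u (-c)) = AlgHom.id _ _ := by
  rw [shearHom, shearHom, comp_aeval, ← MvPolynomial.aeval_X_left]
  ext i v
  cases i using Fin.cases <;> simp

/-- The automorphism underlying `shearHom k n u 1`. -/
noncomputable def shear (k : Type*) [Field k] (n u : ℕ) :
    MvPolynomial (Fin (n + 1)) k ≃ₐ[k] MvPolynomial (Fin (n + 1)) k :=
  AlgEquiv.ofAlgHom (shearHom k n u 1) (shearHom k n u (-1))
    (shearHom_comp_neg u 1) (by simpa using shearHom_comp_neg (k := k) (n := n) u (-1))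

lemma finSuccEquiv_shear_X_zero (u : ℕ) :
    finSuccEquiv k n (shear k n u (X 0)) = Polynomial.X := by
  simp [shear, shearHom, finSuccEquiv_X_zero]

lemma finSuccEquiv_shear_X_succ (u : ℕ) (i : Fin n) :
    finSuccEquiv k n (shear k n u (X i.succ)) =
      Polynomial.X ^ u ^ (i.1 + 1) + Polynomial.C (X i) := by
  simp [shear, shearHom, finSuccEquiv_X_zero, finSuccEquiv_X_succ, add_comm]

/-- A sheared coordinate is monic of degree `u ^ i`. -/
lemma finSuccEquiv_shear_X_monic (u : ℕ) (hu : u ≠ 0) (i : Fin (n + 1)) :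
    (finSuccEquiv k n (shear k n u (X i))).Monic ∧
      (finSuccEquiv k n (shear k n u (X i))).natDegree = u ^ i.1 := by
  cases i using Fin.cases with
  | zero => simp [finSuccEquiv_shear_X_zero, Polynomial.monic_X]
  | succ i =>
    rw [finSuccEquiv_shear_X_succ]
    exact ⟨Polynomial.monic_X_pow_add_C _ (pow_ne_zero _ hu),
      by simp⟩

lemma finSuccEquiv_shear_monomial (u : ℕ) (hu : u ≠ 0) (v : Fin (n + 1) →₀ ℕ) :
    (finSuccEquiv k n (shear k n u (monomial v 1))).Monic ∧
      (finSuccEquiv k n (shear k n u (monomial v 1))).natDegree = ∑ i, u ^ i.1 * v i := by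
  have h := fun i => finSuccEquiv_shear_X_monic (k := k) (n := n) u hu i
  have e : finSuccEquiv k n (shear k n u (monomial v 1)) =
      ∏ i, (finSuccEquiv k n (shear k n u (X i))) ^ v i := by
    rw [monomial_eq, Finsupp.prod_fintype _ _ (fun i => pow_zero _)]
    simp
  rw [e]
  refine ⟨Polynomial.monic_prod_of_monic _ _ fun i _ => (h i).1.pow _, ?_⟩
  rw [Polynomial.natDegree_prod_of_monic _ _ fun i _ => (h i).1.pow _]
  refine Finset.sum_congr rfl fun i _ => ?_
  rw [(h i).1.natDegree_pow, (h i).2, mul_comm]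

lemma finSuccEquiv_shear_natDegree_ne (u : ℕ) (v w : Fin (n + 1) →₀ ℕ) (hu : 1 < u)
    (hv : ∀ i, v i < u) (hw : ∀ i, w i < u) (ne : v ≠ w) :
    ∑ i : Fin (n + 1), u ^ i.1 * v i ≠ ∑ i : Fin (n + 1), u ^ i.1 * w i := by
  intro h
  refine ne <| Finsupp.ext <| congrFun <| List.ofFn_inj.mp ?_
  apply Nat.ofDigits_inj_of_len_eq hu (by simp) 
    (fun l hl => by obtain ⟨i, rfl⟩ := List.mem_ofFn.mp hl; exact hv i)
    (fun l hl => by obtain ⟨i, rfl⟩ := List.mem_ofFn.mp hl; exact hw i)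
  simpa only [Nat.ofDigits_eq_sum_mapIdx, List.mapIdx_eq_ofFn, List.get_ofFn, List.length_ofFn,
    Fin.val_cast, mul_comm, List.sum_ofFn] using! h

/-- After a change of coordinates, a nonzero polynomial becomes monic in the first variable,
up to a unit. -/
lemma exists_algEquiv_polynomial_isUnit_leadingCoeff (f : MvPolynomial (Fin (n + 1)) k)
    (hf : f ≠ 0) : ∃ e : MvPolynomial (Fin (n + 1)) k ≃ₐ[k] Polynomial (MvPolynomial (Fin n) k),
      IsUnit (e f).leadingCoeff := by
  set u := 2 + f.totalDegree
  refine ⟨(shear k n u).trans (finSuccEquiv k n), ?_⟩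
  set e := (shear k n u).trans (finSuccEquiv k n) with he
  have hmon (w : Fin (n + 1) →₀ ℕ) (a : k) : e (monomial w a) =
      a • finSuccEquiv k n (shear k n u (monomial w 1)) := by
    rw [he, AlgEquiv.trans_apply, ← map_smul, ← map_smul, smul_monomial, smul_eq_mul, mul_one]
  have hM := fun w => finSuccEquiv_shear_monomial (k := k) (n := n) u (by omega) w
  set D : (Fin (n + 1) →₀ ℕ) → ℕ := fun w => ∑ i, u ^ i.1 * w i
  have hlt : ∀ w ∈ f.support, ∀ i, w i < u := fun w hw i =>
    lt_of_le_of_lt ((monomial_le_degreeOf i hw).trans (degreeOf_le_totalDegree f i))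
      (by omega)
  obtain ⟨v, hv, hmax⟩ := Finset.exists_max_image f.support D (support_nonempty.mpr hf)
  have hsum : e f = e (monomial v (coeff v f)) +
      ∑ w ∈ f.support \ {v}, e (monomial w (coeff w f)) := by
    conv_lhs => rw [← f.support_sum_monomial_coeff]
    rw [Finset.sum_eq_add_sum_sdiff_singleton_of_mem hv, map_add, map_sum]
  have hdeg (w) (hw : w ∈ f.support) : (e (monomial w (coeff w f))).degree = (D w : WithBot ℕ) := by
    rw [hmon, Polynomial.degree_smul_of_smul_regular _
      (IsSMulRegular.of_ne_zero (mem_support_iff.mp hw)),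
      Polynomial.degree_eq_natDegree (hM w).1.ne_zero, (hM w).2]
  have hlow : (∑ w ∈ f.support \ {v}, e (monomial w (coeff w f))).degree <
      (e (monomial v (coeff v f))).degree := by
    refine lt_of_le_of_lt (Polynomial.degree_sum_le _ _) ?_
    rw [hdeg v hv, Finset.sup_lt_iff (WithBot.bot_lt_coe _)]
    intro w hw
    obtain ⟨hw1, hw2⟩ := Finset.mem_sdiff.mp hw
    rw [hdeg w hw1]
    exact_mod_cast lt_of_le_of_ne (hmax w hw1) (finSuccEquiv_shear_natDegree_ne u w v (by omega)
      (hlt w hw1) (hlt v hv) (by simpa using hw2))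
  rw [hsum, add_comm, Polynomial.leadingCoeff_add_of_degree_lt hlow, hmon,
    Algebra.smul_def, IsScalarTower.algebraMap_apply k (MvPolynomial (Fin n) k),
    Polynomial.algebraMap_apply, Polynomial.leadingCoeff_mul, (hM v).1.leadingCoeff]
  simpa using mem_support_iff.mp hv

end Shear

section NoetherNormalization

open RingTheory.Sequence

/-- A monic polynomial is regular modulo an extended ideal. -/
lemma isSMulRegular_quotient_map_C_of_monic {B : Type*} [CommRing B] (J : Ideal B)
    {g : Polynomial B} (hg : g.Monic) :
    IsSMulRegular (Polynomial B ⧸ (J.map Polynomial.C)) g := by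
  rw [isSMulRegular_iff_right_eq_zero_of_smul]
  intro x hx
  obtain ⟨p, rfl⟩ := Ideal.Quotient.mk_surjective x
  have h1 : g * p ∈ J.map Polynomial.C := by
    rw [← Ideal.Quotient.eq_zero_iff_mem, ← hx]
    rfl
  rw [Ideal.Quotient.eq_zero_iff_mem]
  have key : ∀ q : Polynomial B, q ∈ J.map Polynomial.C ↔
      q.map (Ideal.Quotient.mk J) = 0 := by
    intro q
    rw [← Polynomial.coe_mapRingHom, ← RingHom.mem_ker, Polynomial.ker_mapRingHom, Ideal.mk_ker]
  rw [key] at h1 ⊢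
  rw [Polynomial.map_mul] at h1
  exact (hg.map _).mem_nonZeroDivisors.1 _ h1

/-- Noether normalization together with a maximal regular sequence: an ideal `Q` of a polynomial
ring in `n` variables contains a regular sequence of length `n - s`, where `s` is the number of
variables in a Noether normalization of the quotient by `Q`. -/
theorem exists_isWeaklyRegular_integral_inj_algHom {k : Type*} [Field k] (n : ℕ)
    (Q : Ideal (MvPolynomial (Fin n) k)) (hQ : Q ≠ ⊤) :
    ∃ s : ℕ, ∃ rs : List (MvPolynomial (Fin n) k), rs.length + s = n ∧ (∀ r ∈ rs, r ∈ Q) ∧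
      IsWeaklyRegular (MvPolynomial (Fin n) k) rs ∧
      ∃ g : MvPolynomial (Fin s) k →ₐ[k] (MvPolynomial (Fin n) k ⧸ Q),
        Function.Injective g ∧ g.IsIntegral := by
  induction n with
  | zero =>
    have hbij : Function.Bijective (algebraMap k (MvPolynomial (Fin 0) k)) :=
      (isEmptyAlgEquiv k (Fin 0)).symm.bijective
    have hQ0 : Q = ⊥ := by
      rw [eq_bot_iff]
      intro x hx
      obtain ⟨c, rfl⟩ := hbij.2 x
      by_contra hc
      refine hQ (Ideal.eq_top_of_isUnit_mem _ hx ((IsUnit.mk0 c ?_).map _))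
      rintro rfl
      exact hc (by simp)
    have bij := (Ideal.Quotient.mk_bijective_iff_eq_bot Q).mpr hQ0
    exact ⟨0, [], rfl, by simp, .nil _ _, Ideal.Quotient.mkₐ k Q, bij.1,
      RingHom.isIntegral_of_surjective _ bij.2⟩
  | succ n ih =>
    by_cases hQ0 : Q = ⊥
    · have bij := (Ideal.Quotient.mk_bijective_iff_eq_bot Q).mpr hQ0
      exact ⟨n + 1, [], by simp, by simp, .nil _ _, Ideal.Quotient.mkₐ k Q, bij.1,
        RingHom.isIntegral_of_surjective _ bij.2⟩
    obtain ⟨f, hfQ, hf0⟩ := Submodule.exists_mem_ne_zero_of_ne_bot hQ0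
    obtain ⟨e, he⟩ := exists_algEquiv_polynomial_isUnit_leadingCoeff f hf0
    set g : Polynomial (MvPolynomial (Fin n) k) := he.unit⁻¹.val • e f with hg
    have hgmonic : g.Monic := Polynomial.monic_of_isUnit_leadingCoeff_inv_smul he
    set π : Polynomial (MvPolynomial (Fin n) k) →ₐ[k] (MvPolynomial (Fin (n + 1)) k ⧸ Q) :=
      (Ideal.Quotient.mkₐ k Q).comp e.symm.toAlgHom with hπ
    have hπg : π g = 0 := by
      have : π g = π (Polynomial.C he.unit⁻¹.val) * π (e f) := by
        rw [hg, Polynomial.smul_eq_C_mul, map_mul]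
      rw [this, hπ]
      simp [Ideal.Quotient.eq_zero_iff_mem.mpr hfQ]
    set φ : MvPolynomial (Fin n) k →ₐ[k] (MvPolynomial (Fin (n + 1)) k ⧸ Q) :=
      π.comp (Algebra.ofId _ (Polynomial (MvPolynomial (Fin n) k)) |>.restrictScalars k) with hφ
    have hπs : Function.Surjective π :=
      (Ideal.Quotient.mkₐ_surjective k Q).comp e.symm.surjective
    have hφint : φ.toRingHom.IsIntegral := by
      intro x
      obtain ⟨p, rfl⟩ := hπs x
      obtain ⟨q, hq, hq0⟩ := hgmonic.quotient_isIntegral (I := RingHom.ker π) hπg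
        (Ideal.Quotient.mk _ p)
      refine ⟨q, hq, ?_⟩
      have := congrArg (RingHom.kerLift π.toRingHom) hq0
      erw [Polynomial.hom_eval₂, map_zero] at this
      exact this
    have : Nontrivial (MvPolynomial (Fin (n + 1)) k ⧸ Q) := Ideal.Quotient.nontrivial_iff.mpr hQ
    obtain ⟨s, rs, hlen, hmem, hreg, h, hinj, hint⟩ := ih (RingHom.ker φ) (RingHom.ker_ne_top φ)
    refine ⟨s, (rs.map Polynomial.C ++ [g]).map e.symm, ?_, ?_, ?_,
      (Ideal.kerLiftAlg φ).comp h, ?_, ?_⟩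
    · simp; omega
    · simp only [List.map_append, List.map_map, List.mem_append, List.mem_map, List.mem_singleton,
        Function.comp, List.map_cons, List.map_nil]
      rintro r (⟨b, hb, rfl⟩ | rfl)
      · rw [← Ideal.Quotient.eq_zero_iff_mem]
        exact hmem b hb
      · rw [← Ideal.Quotient.eq_zero_iff_mem]
        exact hπg
    · have h1 : IsWeaklyRegular (Polynomial (MvPolynomial (Fin n) k))
          (rs.map Polynomial.C ++ [g]) := by
        rw [isWeaklyRegular_append_iff]
        refine ⟨hreg.of_flat, ?_⟩
        rw [isWeaklyRegular_cons_iff]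
        refine ⟨?_, .nil _ _⟩
        rw [← Ideal.map_ofList]
        rw [smul_eq_mul, Ideal.mul_top]
        have hreg_g := isSMulRegular_quotient_map_C_of_monic (Ideal.ofList rs) hgmonic
        exact hreg_g
      refine (AddEquiv.isWeaklyRegular_congr (e := e.symm.toRingEquiv.toAddEquiv) ?_).mp h1
      refine List.forall₂_map_right_iff.mpr (List.forall₂_same.mpr fun r _ x => ?_)
      exact map_mul e.symm r x
    · exact (Ideal.kerLiftAlg_injective φ).comp hinj
    · have comp : (Ideal.kerLiftAlg φ).comp (Ideal.Quotient.mkₐ k <| RingHom.ker φ) = φ :=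
        AlgHom.ext fun a ↦ by
          simp only [AlgHom.coe_comp, Ideal.Quotient.mkₐ_eq_mk, Function.comp_apply,
            Ideal.kerLiftAlg_mk]
      exact hint.trans _ _ (RingHom.IsIntegral.tower_top _ _
        (show ((Ideal.kerLiftAlg φ).toRingHom.comp _).IsIntegral from comp ▸ hφint))

end NoetherNormalization

section Dimension

/-- Going up: the dimension does not drop along an injective integral map. -/
theorem ringKrullDim_le_of_injective_of_isIntegral {A B : Type*} [CommRing A] [CommRing B]
    (φ : A →+* B) (hinj : Function.Injective φ) (hint : φ.IsIntegral) :
    ringKrullDim A ≤ ringKrullDim B := by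
  algebraize [φ]
  refine iSup_le fun l => ?_
  obtain ⟨Q, -, hQ, hQl⟩ := Ideal.exists_ideal_over_prime_of_isIntegral l.head.asIdeal (⊥ : Ideal B)
    (by
      rw [← RingHom.ker_eq_comap_bot, (RingHom.injective_iff_ker_eq_bot (algebraMap A B)).mp hinj]
      exact bot_le)
  have : Q.LiesOver l.head.asIdeal := ⟨hQl.symm⟩
  obtain ⟨L, hL, -⟩ := Ideal.exists_ltSeries_of_hasGoingUp l Q
  rw [← hL]
  exact Order.LTSeries.length_le_krullDim L

/-- The number of variables in a Noether normalization is at most the dimension. -/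
theorem le_ringKrullDim_of_noether {k : Type*} [Field k] {B : Type*} [CommRing B] [Algebra k B]
    {s : ℕ} (g : MvPolynomial (Fin s) k →ₐ[k] B) (hinj : Function.Injective g)
    (hint : g.IsIntegral) : (s : WithBot ℕ∞) ≤ ringKrullDim B := by
  have := ringKrullDim_le_of_injective_of_isIntegral g.toRingHom hinj hint
  simpa [MvPolynomial.ringKrullDim_of_isNoetherianRing] using this

end Dimension

section Unmixed

open RingTheory.Sequence CategoryTheory Abelian IsSMulRegular in
/-- If the low `Ext`s from `N` to `M` vanish, then so do the linear maps from `N` to the quotient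
of `M` by a short regular sequence. -/
theorem subsingleton_linearMap_quotient_of_ext {R : Type} [CommRing R]
    (N : ModuleCat.{0} R) (gs : List R) : ∀ (M : ModuleCat.{0} R) (m : ℕ),
      (∀ j < m, Subsingleton (Ext N M j)) → IsWeaklyRegular M gs → gs.length < m →
      Subsingleton (N →ₗ[R] (M ⧸ (Ideal.ofList gs • ⊤ : Submodule R M))) := by
  induction gs with
  | nil =>
    intro M m hext _ hm
    have h0 : Subsingleton (N →ₗ[R] M) :=
      (Ext.addEquiv₀.trans ModuleCat.homAddEquiv).subsingleton_congr.mp (hext 0 hm)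
    have e : (M ⧸ (Ideal.ofList ([] : List R) • ⊤ : Submodule R M)) ≃ₗ[R] M :=
      Submodule.quotEquivOfEqBot _ (by simp)
    exact ⟨fun a b => LinearMap.ext fun y => e.injective
      (LinearMap.congr_fun (Subsingleton.elim (e.toLinearMap ∘ₗ a) (e.toLinearMap ∘ₗ b)) y)⟩
  | cons x gs ih =>
    intro M m hext hreg hm
    obtain ⟨hx, hreg⟩ := (isWeaklyRegular_cons_iff _ _ _).mp hreg
    have h := ih (ModuleCat.of R (QuotSMulTop x M)) (m - 1) (fun i hi => ?_) hreg
      (by simp at hm; omega)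
    · have e := Submodule.quotOfListConsSMulTopEquivQuotSMulTopInner M x gs
      exact ⟨fun a b => LinearMap.ext fun y => e.injective
        (LinearMap.congr_fun (Subsingleton.elim (e.toLinearMap ∘ₗ a) (e.toLinearMap ∘ₗ b)) y)⟩
    · have zero1 := AddCommGrpCat.isZero_of_iff_subsingleton.mpr (hext i (by omega))
      have zero2 := AddCommGrpCat.isZero_of_iff_subsingleton.mpr (hext (i + 1) (by omega))
      exact AddCommGrpCat.subsingleton_of_isZero <| ShortComplex.Exact.isZero_of_both_zeros
        ((Ext.covariant_sequence_exact₃' N hx.smulShortComplex_shortExact) i (i + 1) rfl)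
        (zero1.eq_zero_of_src _) (zero2.eq_zero_of_tgt _)

open RingTheory.Sequence in
/-- An associated prime of the quotient by a regular sequence `gs` cannot contain a longer regular
sequence. -/
theorem length_le_of_mem_associatedPrimes {R : Type} [CommRing R] [IsNoetherianRing R]
    (gs rs : List R) (hgs : IsWeaklyRegular R gs) (hrs : IsWeaklyRegular R rs) (Q : Ideal R)
    (hQ : Q ∈ associatedPrimes R (R ⧸ Ideal.ofList gs)) (hmem : ∀ r ∈ rs, r ∈ Q) :
    rs.length ≤ gs.length := by
  by_contra! hlt
  have hQp : Q.IsPrime := hQ.isPrime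
  have hQ0 : Q • (⊤ : Submodule R R) ≠ ⊤ := by
    rw [smul_eq_mul, Ideal.mul_top]; exact hQp.ne_top
  have hreg : IsRegular R rs := by
    refine ⟨hrs, fun h => hQp.ne_top (top_le_iff.mp ?_)⟩
    rw [h, smul_eq_mul, Ideal.mul_top]
    exact Ideal.span_le.mpr hmem
  have hext := ModuleCat.subsingleton_ext_of_exists_isRegular Q (ModuleCat.of R (R ⧸ Q))
    (by rw [Module.support_eq_zeroLocus, Ideal.annihilator_quotient])
    (ModuleCat.of R R) hQ0.lt_top rs hmem hreg
  have hs : Subsingleton ((R ⧸ Q) →ₗ[R] (R ⧸ (Ideal.ofList gs • ⊤ : Submodule R R))) :=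
    subsingleton_linearMap_quotient_of_ext _ gs _ _ hext hgs hlt
  rw [smul_eq_mul, Ideal.mul_top] at hs
  obtain ⟨-, x, hx⟩ := isAssociatedPrime_iff.mp hQ
  let φ : (R ⧸ Q) →ₗ[R] (R ⧸ Ideal.ofList gs) :=
    Submodule.liftQ Q (LinearMap.toSpanSingleton R _ x) fun r hr => by
      rw [hx, Submodule.mem_colon_singleton] at hr
      simpa using hr
  have hx0 : x = 0 := by
    have : φ (Ideal.Quotient.mk Q 1) = x := by
      change LinearMap.toSpanSingleton R _ x 1 = x
      simp
    rw [← this, Subsingleton.elim φ 0, LinearMap.zero_apply]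
  refine hQp.ne_top ((Ideal.eq_top_iff_one _).mpr ?_)
  rw [hx, Submodule.mem_colon_singleton, hx0, smul_zero]
  exact Submodule.zero_mem _

end Unmixed

section RegularGenerators

open RingTheory.Sequence

variable {k : Type} [Field k] {n d : ℕ}

/-- The quotient by an associated prime of a regular sequence of length `l` has a Noether
normalization in at least `n - l` variables. -/
theorem exists_noether_of_mem_associatedPrimes
    (gs : List (MvPolynomial (Fin n) k)) (hgs : IsWeaklyRegular (MvPolynomial (Fin n) k) gs)
    (Q : Ideal (MvPolynomial (Fin n) k))
    (hQ : Q ∈ associatedPrimes (MvPolynomial (Fin n) k)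
      (MvPolynomial (Fin n) k ⧸ Ideal.ofList gs)) :
    ∃ s : ℕ, n ≤ gs.length + s ∧ ∃ g : MvPolynomial (Fin s) k →ₐ[k] (MvPolynomial (Fin n) k ⧸ Q),
      Function.Injective g ∧ g.IsIntegral := by
  obtain ⟨s, rs, hlen, hmem, hreg, hg⟩ :=
    exists_isWeaklyRegular_integral_inj_algHom n Q hQ.isPrime.ne_top
  have := length_le_of_mem_associatedPrimes gs rs hgs hreg Q hQ hmem
  exact ⟨s, by omega, hg⟩

/-- A subspace contained in no associated prime contains a nonzerodivisor. -/
lemma exists_mem_isSMulRegular_of_not_le {R M : Type*} [CommRing R] [IsNoetherianRing R]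
    [Algebra k R] [Infinite k] [AddCommGroup M] [Module R M] [Module.Finite R M]
    (W : Submodule k R) (hW : ∀ P ∈ associatedPrimes R M, ¬ (W : Set R) ⊆ P) :
    ∃ g ∈ W, IsSMulRegular M g := by
  classical
  by_contra! hno
  have hfin := associatedPrimes.finite R M
  let F : Ideal R → Subspace k W := fun P => (P.restrictScalars k).comap W.subtype
  have hcov : ⋃ p ∈ hfin.toFinset.image F, (p : Set W) = Set.univ := by
    rw [Set.eq_univ_iff_forall]
    rintro ⟨w, hw⟩
    have h1 : w ∈ { r : R | ∃ x : M, x ≠ 0 ∧ r • x = 0 } := by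
      have := hno w hw
      rw [isSMulRegular_iff_right_eq_zero_of_smul] at this
      push Not at this
      obtain ⟨x, hx, hx0⟩ := this
      exact ⟨x, hx0, hx⟩
    rw [← biUnion_associatedPrimes_eq_zero_divisors R M] at h1
    simp only [Set.mem_iUnion] at h1 ⊢
    obtain ⟨P, hP, hwP⟩ := h1
    exact ⟨F P, Finset.mem_image_of_mem _ (hfin.mem_toFinset.mpr hP), hwP⟩
  obtain ⟨P, hP, hPt⟩ := Finset.mem_image.mp (Subspace.top_mem_of_biUnion_eq_univ hcov)
  refine hW P (hfin.mem_toFinset.mp hP) fun w hw => ?_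
  have : (⟨w, hw⟩ : W) ∈ F P := hPt ▸ Submodule.mem_top
  exact this

/-- An ideal of the expected codimension `d` with `d` generators is generated by a regular
sequence of length `d`. -/
theorem exists_isWeaklyRegular_ofList_eq [Infinite k] (f : Fin d → MvPolynomial (Fin n) k)
    (hne : Ideal.span (Set.range f) ≠ ⊤)
    (hdim : ∀ Q : Ideal (MvPolynomial (Fin n) k), Q.IsPrime → Ideal.span (Set.range f) ≤ Q →
      ringKrullDim (MvPolynomial (Fin n) k ⧸ Q) + (d : WithBot ℕ∞) ≤ n) :
    ∃ gs : List (MvPolynomial (Fin n) k), gs.length = d ∧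
      IsWeaklyRegular (MvPolynomial (Fin n) k) gs ∧
      Ideal.ofList gs = Ideal.span (Set.range f) := by
  set I := Ideal.span (Set.range f) with hIdef
  set W : Submodule k (MvPolynomial (Fin n) k) := Submodule.span k (Set.range f) with hWdef
  have hWI : ∀ w ∈ W, w ∈ I := fun w hw =>
    Submodule.span_le_restrictScalars k (MvPolynomial (Fin n) k) _ hw
  have hWfin : Module.Finite k W := Module.Finite.span_of_finite k (Set.finite_range f)
  have main : ∀ i ≤ d, ∃ gs : List (MvPolynomial (Fin n) k), gs.length = i ∧ (∀ g ∈ gs, g ∈ W) ∧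
      IsWeaklyRegular (MvPolynomial (Fin n) k) gs ∧
      i ≤ Module.finrank k (Submodule.span k {g | g ∈ gs}) := by
    intro i
    induction i with
    | zero => exact fun _ => ⟨[], rfl, by simp, .nil _ _, by simp⟩
    | succ i ih =>
      intro hi
      obtain ⟨gs, hlen, hmem, hreg, hrank⟩ := ih (by omega)
      have hle : Ideal.ofList gs ≤ I := Ideal.span_le.mpr fun g hg => hWI g (hmem g hg)
      obtain ⟨g, hgW, hg⟩ := exists_mem_isSMulRegular_of_not_le
        (M := MvPolynomial (Fin n) k ⧸ Ideal.ofList gs) W fun P hP hWP => by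
          obtain ⟨s, hs, φ, hinj, hint⟩ := exists_noether_of_mem_associatedPrimes gs hreg P hP
          have h1 := hdim P hP.isPrime
            (Ideal.span_le.mpr fun x hx => hWP (Submodule.subset_span hx))
          have h2 : (s : WithBot ℕ∞) + (d : WithBot ℕ∞) ≤ n :=
            (add_le_add_left (le_ringKrullDim_of_noether φ hinj hint) _).trans h1
          have h3 : s + d ≤ n := by exact_mod_cast h2
          omega
      have hgnot : g ∉ Ideal.ofList gs := by
        intro hmem'
        have hz : g • (Ideal.Quotient.mk (Ideal.ofList gs) 1) = 0 := by
          rw [← Ideal.Quotient.eq_zero_iff_mem] at hmem'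
          exact (congrArg (Ideal.Quotient.mk (Ideal.ofList gs)) (mul_one g)).trans hmem'
        have h0 := isSMulRegular_iff_right_eq_zero_of_smul.mp hg _ hz
        rw [Ideal.Quotient.eq_zero_iff_mem] at h0
        exact hne ((Ideal.eq_top_iff_one _).mpr (hle h0))
      refine ⟨gs ++ [g], by simp [hlen], ?_, ?_, ?_⟩
      · intro x hx
        rcases List.mem_append.mp hx with hx | hx
        · exact hmem x hx
        · rwa [List.mem_singleton.mp hx]
      · rw [isWeaklyRegular_append_iff, isWeaklyRegular_cons_iff]
        refine ⟨hreg, ?_, .nil _ _⟩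
        rw [smul_eq_mul, Ideal.mul_top]
        exact hg
      · have hfin : {x | x ∈ gs ++ [g]}.Finite := List.finite_toSet _
        have : Module.Finite k (Submodule.span k {x | x ∈ gs ++ [g]}) :=
          Module.Finite.span_of_finite k hfin
        refine Nat.lt_of_le_of_lt hrank (Submodule.finrank_lt_finrank_of_lt ?_)
        refine lt_of_le_of_ne (Submodule.span_mono fun x hx => List.mem_append_left _ hx)
          fun heq => hgnot ?_
        have : g ∈ Submodule.span k {x | x ∈ gs} :=
          heq ▸ Submodule.subset_span (by simp)
        exact Submodule.span_le_restrictScalars k (MvPolynomial (Fin n) k) _ this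
  obtain ⟨gs, hlen, hmem, hreg, hrank⟩ := main d le_rfl
  refine ⟨gs, hlen, hreg, le_antisymm (Ideal.span_le.mpr fun g hg => hWI g (hmem g hg)) ?_⟩
  have heq : Submodule.span k {g | g ∈ gs} = W := by
    refine Submodule.eq_of_le_of_finrank_le (Submodule.span_le.mpr hmem) (le_trans ?_ hrank)
    exact (finrank_range_le_card f).trans (by simp)
  refine Ideal.span_le.mpr ?_
  rintro _ ⟨i, rfl⟩
  have : f i ∈ Submodule.span k {g | g ∈ gs} := heq ▸ Submodule.subset_span ⟨i, rfl⟩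
  exact Submodule.span_le_restrictScalars k (MvPolynomial (Fin n) k) _ this

/-- The Krull dimension drops strictly along a strict inclusion of primes. -/
lemma ringKrullDim_quotient_add_one_le_of_lt {R : Type*} [CommRing R] {P Q : Ideal R} [P.IsPrime]
    (h : P < Q) : ringKrullDim (R ⧸ Q) + 1 ≤ ringKrullDim (R ⧸ P) := by
  obtain ⟨x, hxQ, hxP⟩ := SetLike.exists_of_lt h
  refine ringKrullDim_succ_le_of_surjective (Ideal.Quotient.factor h.le)
    (Ideal.Quotient.factor_surjective h.le) (r := Ideal.Quotient.mk P x) ?_ ?_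
  · exact mem_nonZeroDivisors_of_ne_zero (by rwa [Ne, Ideal.Quotient.eq_zero_iff_mem])
  · rw [Ideal.Quotient.factor_mk, Ideal.Quotient.eq_zero_iff_mem]
    exact hxQ

/-- The dimension of a nontrivial quotient of a polynomial ring is a natural number. -/
lemma exists_ringKrullDim_quotient_eq (Q : Ideal (MvPolynomial (Fin n) k)) (hQ : Q ≠ ⊤) :
    ∃ m : ℕ, ringKrullDim (MvPolynomial (Fin n) k ⧸ Q) = m := by
  have := Ideal.Quotient.nontrivial_iff.mpr hQ
  have h0 := ringKrullDim_nonneg_of_nontrivial (R := MvPolynomial (Fin n) k ⧸ Q)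
  have hn : ringKrullDim (MvPolynomial (Fin n) k ⧸ Q) ≤ n :=
    (ringKrullDim_quotient_le Q).trans
      (by simp [MvPolynomial.ringKrullDim_of_isNoetherianRing])
  generalize ringKrullDim (MvPolynomial (Fin n) k ⧸ Q) = x at h0 hn
  induction x using WithBot.recBotCoe with
  | bot => simp at h0
  | coe x =>
    induction x using ENat.recTopCoe with
    | top =>
      have : (⊤ : ℕ∞) ≤ n := by exact_mod_cast hn
      simp at this
    | coe m => exact ⟨m, rfl⟩

/-- Every associated prime of an ideal of the expected codimension `d` with `d` generators has a
Noether normalization of its quotient in `n - d` variables. -/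
theorem exists_noether_of_mem_associatedPrimes_span [Infinite k]
    (f : Fin d → MvPolynomial (Fin n) k)
    (hdim : ∀ Q : Ideal (MvPolynomial (Fin n) k), Q.IsPrime → Ideal.span (Set.range f) ≤ Q →
      ringKrullDim (MvPolynomial (Fin n) k ⧸ Q) + (d : WithBot ℕ∞) ≤ n)
    (Q : Ideal (MvPolynomial (Fin n) k))
    (hQ : Q ∈ associatedPrimes (MvPolynomial (Fin n) k)
      (MvPolynomial (Fin n) k ⧸ Ideal.span (Set.range f))) :
    ∃ s : ℕ, n = d + s ∧ ringKrullDim (MvPolynomial (Fin n) k ⧸ Q) = s ∧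
      ∃ g : MvPolynomial (Fin s) k →ₐ[k] (MvPolynomial (Fin n) k ⧸ Q),
        Function.Injective g ∧ g.IsIntegral := by
  have hIQ : Ideal.span (Set.range f) ≤ Q := by
    have := hQ.annihilator_le
    rwa [Submodule.annihilator_top, Ideal.annihilator_quotient] at this
  obtain ⟨gs, hlen, hreg, hgs⟩ := exists_isWeaklyRegular_ofList_eq f
    (fun h => hQ.isPrime.ne_top (top_le_iff.mp (h ▸ hIQ))) hdim
  rw [← hgs] at hQ
  obtain ⟨s, hs, g, hinj, hint⟩ := exists_noether_of_mem_associatedPrimes gs hreg Q hQ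
  have h1 := hdim Q hQ.isPrime hIQ
  have h2 := le_ringKrullDim_of_noether g hinj hint
  have h3 : (s : WithBot ℕ∞) + (d : WithBot ℕ∞) ≤ n := (add_le_add_left h2 _).trans h1
  have h4 : s + d ≤ n := by exact_mod_cast h3
  have h5 : n = d + s := by omega
  refine ⟨s, h5, le_antisymm ?_ h2, g, hinj, hint⟩
  obtain ⟨m, hm⟩ := exists_ringKrullDim_quotient_eq Q hQ.isPrime.ne_top
  rw [hm] at h1 ⊢
  have h6 : m + d ≤ n := by exact_mod_cast h1
  exact_mod_cast (by omega : m ≤ s)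

/-- Unmixedness: the associated primes of an ideal of the expected codimension `d` with `d`
generators are exactly its minimal primes. -/
theorem mem_associatedPrimes_span_iff_mem_minimalPrimes [Infinite k]
    (f : Fin d → MvPolynomial (Fin n) k)
    (hdim : ∀ Q : Ideal (MvPolynomial (Fin n) k), Q.IsPrime → Ideal.span (Set.range f) ≤ Q →
      ringKrullDim (MvPolynomial (Fin n) k ⧸ Q) + (d : WithBot ℕ∞) ≤ n)
    (Q : Ideal (MvPolynomial (Fin n) k)) :
    Q ∈ associatedPrimes (MvPolynomial (Fin n) k)
      (MvPolynomial (Fin n) k ⧸ Ideal.span (Set.range f)) ↔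
      Q ∈ (Ideal.span (Set.range f)).minimalPrimes := by
  have hmin : ∀ P ∈ (Ideal.span (Set.range f)).minimalPrimes,
      P ∈ associatedPrimes (MvPolynomial (Fin n) k)
        (MvPolynomial (Fin n) k ⧸ Ideal.span (Set.range f)) := by
    intro P hP
    refine Module.associatedPrimes.minimalPrimes_annihilator_subset_associatedPrimes _ _ ?_
    rwa [Ideal.annihilator_quotient]
  refine ⟨fun hQ => ?_, hmin Q⟩
  have hIQ : Ideal.span (Set.range f) ≤ Q := by
    have := hQ.annihilator_le
    rwa [Submodule.annihilator_top, Ideal.annihilator_quotient] at this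
  have hQp : Q.IsPrime := hQ.isPrime
  obtain ⟨P, hP, hPQ⟩ := Ideal.exists_minimalPrimes_le hIQ
  rcases hPQ.eq_or_lt with rfl | hlt
  · exact hP
  obtain ⟨s, hs, hsd, -⟩ := exists_noether_of_mem_associatedPrimes_span f hdim Q hQ
  obtain ⟨t, ht, htd, -⟩ := exists_noether_of_mem_associatedPrimes_span f hdim P (hmin P hP)
  have := hP.1.1
  have h := ringKrullDim_quotient_add_one_le_of_lt hlt
  rw [hsd, htd] at h
  have : s + 1 ≤ t := by exact_mod_cast h
  omega

end RegularGenerators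

section JacobianCriterion

variable {k : Type} [Field k] {n d : ℕ}

theorem mem_of_forall_sum_mul_pderiv_mem {P : Ideal (MvPolynomial (Fin n) k)} [P.IsPrime]
    {f : Fin d → MvPolynomial (Fin n) k} {v : Fin n → k} (hv : ∀ p ∈ P, eval v p = 0)
    (hrank : (Matrix.of fun (i : Fin d) (j : Fin n) => eval v (pderiv j (f i))).rank = d)
    {b : Fin d → MvPolynomial (Fin n) k} (hb : ∀ j, ∑ i, b i * pderiv j (f i) ∈ P) (i : Fin d) :
    b i ∈ P := by
  set M := Matrix.of fun (i : Fin d) (j : Fin n) => eval v (pderiv j (f i)) with hM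
  have hsurj : Function.Surjective M.mulVec := by
    have : LinearMap.range M.mulVecLin = ⊤ := by
      apply Submodule.eq_top_of_finrank_eq
      rw [← Matrix.rank, hrank]; simp
    exact LinearMap.range_eq_top.mp this
  obtain ⟨N, hN⟩ := Matrix.mulVec_surjective_iff_exists_right_inverse.mp hsurj
  set J : Matrix (Fin d) (Fin n) (MvPolynomial (Fin n) k) :=
    Matrix.of fun i j => pderiv j (f i) with hJ
  set A : Matrix (Fin d) (Fin d) (MvPolynomial (Fin n) k) :=
    J * (N.map C : Matrix (Fin n) (Fin d) (MvPolynomial (Fin n) k)) with hA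
  have hAv : A.map (eval v) = 1 := by
    rw [← hN, hA, Matrix.map_mul]
    congr 1
    ext i j
    simp
  have hdet : A.det ∉ P := by
    intro h
    have h1 := hv _ h
    rw [RingHom.map_det, RingHom.mapMatrix_apply, hAv, Matrix.det_one] at h1
    exact one_ne_zero h1
  have hdet' : (A.map (Ideal.Quotient.mk P)).det ≠ 0 := by
    rw [← RingHom.mapMatrix_apply, ← RingHom.map_det]
    rwa [Ne, Ideal.Quotient.eq_zero_iff_mem]
  have hzero : Matrix.vecMul (fun i => Ideal.Quotient.mk P (b i))
      (A.map (Ideal.Quotient.mk P)) = 0 := by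
    rw [hA, Matrix.map_mul, ← Matrix.vecMul_vecMul]
    have : Matrix.vecMul (fun i => Ideal.Quotient.mk P (b i)) (J.map (Ideal.Quotient.mk P)) = 0 := by
      ext j
      have := Ideal.Quotient.eq_zero_iff_mem.mpr (hb j)
      simpa [Matrix.vecMul, dotProduct, hJ] using this
    rw [this, Matrix.zero_vecMul]
  have := congrFun (Matrix.eq_zero_of_vecMul_eq_zero hdet' hzero) i
  exact Ideal.Quotient.eq_zero_iff_mem.mp this

theorem pderiv_mem_of_mem_sq {P : Ideal (MvPolynomial (Fin n) k)} {p : MvPolynomial (Fin n) k}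
    (hp : p ∈ P ^ 2) (j : Fin n) : pderiv j p ∈ P := by
  rw [pow_two] at hp
  refine Submodule.mul_induction_on hp (fun a ha b hb => ?_) (fun a b ha hb => ?_)
  · rw [Derivation.leibniz]
    exact P.add_mem (P.mul_mem_right _ ha) (P.mul_mem_right _ hb)
  · rw [map_add]; exact P.add_mem ha hb

theorem exists_mul_mem_span_of_rank_eq {P : Ideal (MvPolynomial (Fin n) k)}
    {f : Fin d → MvPolynomial (Fin n) k} (hP : P ∈ (Ideal.span (Set.range f)).minimalPrimes)
    {v : Fin n → k} (hv : ∀ p ∈ P, eval v p = 0)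
    (hrank : (Matrix.of fun (i : Fin d) (j : Fin n) => eval v (pderiv j (f i))).rank = d)
    {p : MvPolynomial (Fin n) k} (hp : p ∈ P) :
    ∃ s ∉ P, s * p ∈ Ideal.span (Set.range f) := by
  have : P.IsPrime := hP.1.1
  have hfP (i : Fin d) : f i ∈ P := hP.1.2 (Ideal.subset_span ⟨i, rfl⟩)
  let L := Localization.AtPrime P
  have hmax : Ideal.map (algebraMap _ L) P = IsLocalRing.maximalIdeal L :=
    IsLocalization.AtPrime.map_eq_maximalIdeal P L
  have hfL (i : Fin d) : algebraMap _ L (f i) ∈ IsLocalRing.maximalIdeal L := by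
    rw [← hmax]; exact Ideal.mem_map_of_mem _ (hfP i)
  let g : Fin d → IsLocalRing.maximalIdeal L := fun i => ⟨_, hfL i⟩
  let c : Fin d → IsLocalRing.CotangentSpace L := fun i =>
    (IsLocalRing.maximalIdeal L).toCotangent (g i)
  have hli : LinearIndependent (IsLocalRing.ResidueField L) c := by
    rw [Fintype.linearIndependent_iff]
    intro a ha i
    choose l hl using fun i => IsLocalRing.residue_surjective (a i)
    have h1 : (IsLocalRing.maximalIdeal L).toCotangent (∑ i, l i • g i) = 0 := by
      rw [← ha, map_sum]
      refine Finset.sum_congr rfl fun i _ => ?_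
      rw [map_smul, ← hl i]
      rfl
    rw [Ideal.toCotangent_eq_zero] at h1
    obtain ⟨t, ht⟩ := IsLocalization.exist_integer_multiples_of_finite P.primeCompl l
    choose b hb using ht
    have h2 : algebraMap _ L (∑ i, b i * f i) ∈ Ideal.map (algebraMap _ L) (P ^ 2) := by
      rw [Ideal.map_pow, hmax]
      have := Ideal.mul_mem_left _ (algebraMap _ L (t : MvPolynomial (Fin n) k)) h1
      convert this using 1
      rw [map_sum, Submodule.coe_sum, Finset.mul_sum]
      refine Finset.sum_congr rfl fun i _ => ?_
      rw [map_mul, hb i]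
      simp [g, Algebra.smul_def, mul_assoc]
    rw [IsLocalization.algebraMap_mem_map_algebraMap_iff P.primeCompl] at h2
    obtain ⟨m, hm, h3⟩ := h2
    have h4 : ∀ j, ∑ i, (m * b i) * pderiv j (f i) ∈ P := by
      intro j
      have h5 := pderiv_mem_of_mem_sq h3 j
      rw [Finset.mul_sum, map_sum] at h5
      have h6 : ∑ i, pderiv j (m * b i) * f i ∈ P :=
        P.sum_mem fun i _ => P.mul_mem_left _ (hfP i)
      convert P.sub_mem h5 h6 using 1
      rw [← Finset.sum_sub_distrib]
      refine Finset.sum_congr rfl fun i _ => ?_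
      rw [← mul_assoc, Derivation.leibniz (pderiv j) (m * b i) (f i)]
      simp only [smul_eq_mul]
      ring
    have h5 : b i ∈ P :=
      (‹P.IsPrime›.mem_or_mem (mem_of_forall_sum_mul_pderiv_mem hv hrank h4 i)).resolve_left hm
    have h6 : algebraMap _ L (t : MvPolynomial (Fin n) k) * l i ∈ IsLocalRing.maximalIdeal L := by
      have := Ideal.mem_map_of_mem (algebraMap _ L) h5
      rw [hmax, hb i] at this
      simpa [Algebra.smul_def, Submonoid.smul_def] using this
    rw [← hl i, IsLocalRing.residue_eq_zero_iff]
    have hu : IsUnit (algebraMap _ L (t : MvPolynomial (Fin n) k)) := IsLocalization.map_units L t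
    exact (Ideal.unit_mul_mem_iff_mem _ hu).mp h6
  have hreg : IsRegularLocalRing L := isRegularRing_iff.mp inferInstance P
  have hdim := (IsRegularLocalRing.iff_finrank_cotangentSpace L).mp hreg
  rw [IsLocalization.AtPrime.ringKrullDim_eq_height P L] at hdim
  have hht : P.height ≤ d := by
    refine (Ideal.height_le_card_of_mem_minimalPrimes_span (Set.finite_range f) hP).trans ?_
    rw [← Set.image_univ]
    exact_mod_cast (Set.ncard_image_le Set.finite_univ).trans (by simp)
  have hfin : Module.finrank (IsLocalRing.ResidueField L) (IsLocalRing.CotangentSpace L) ≤ d := by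
    have : ((Module.finrank (IsLocalRing.ResidueField L) (IsLocalRing.CotangentSpace L) : ℕ∞) :
        WithBot ℕ∞) ≤ ((d : ℕ∞) : WithBot ℕ∞) := by
      rw [show ((Module.finrank (IsLocalRing.ResidueField L) (IsLocalRing.CotangentSpace L) : ℕ∞) :
        WithBot ℕ∞) = _ from hdim]
      exact WithBot.coe_le_coe.mpr hht
    exact_mod_cast this
  have hspan := hli.span_eq_top_of_card_eq_finrank' (by
    have := hli.fintype_card_le_finrank
    simp at this ⊢
    omega)
  have hgen : Submodule.span L (Set.range g) = ⊤ := by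
    rw [← IsLocalRing.CotangentSpace.span_image_eq_top_iff, ← Set.range_comp]
    exact hspan
  have hpL : algebraMap _ L p ∈ IsLocalRing.maximalIdeal L := by
    rw [← hmax]; exact Ideal.mem_map_of_mem _ hp
  have hmem : algebraMap _ L p ∈ Ideal.map (algebraMap _ L) (Ideal.span (Set.range f)) := by
    have h1 : (⟨_, hpL⟩ : IsLocalRing.maximalIdeal L) ∈ Submodule.span L (Set.range g) := by
      rw [hgen]; trivial
    rw [Submodule.mem_span_range_iff_exists_fun] at h1
    obtain ⟨a, ha⟩ := h1
    have h2 := congrArg Subtype.val ha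
    simp only at h2
    rw [← h2, Submodule.coe_sum]
    refine Ideal.sum_mem _ fun i _ => ?_
    exact Ideal.mul_mem_left _ _ (Ideal.mem_map_of_mem _ (Ideal.subset_span ⟨i, rfl⟩))
  rw [IsLocalization.algebraMap_mem_map_algebraMap_iff P.primeCompl] at hmem
  obtain ⟨m, hm, h⟩ := hmem
  exact ⟨m, hm, h⟩

end JacobianCriterion

section Radical

variable {k : Type} [Field k] [Infinite k] {n d : ℕ}

theorem isRadical_span_of_rank_eq {f : Fin d → MvPolynomial (Fin n) k}
    (hdim : ∀ Q : Ideal (MvPolynomial (Fin n) k), Q.IsPrime → Ideal.span (Set.range f) ≤ Q →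
      ringKrullDim (MvPolynomial (Fin n) k ⧸ Q) + (d : WithBot ℕ∞) ≤ n)
    (hrank : ∀ P ∈ (Ideal.span (Set.range f)).minimalPrimes, ∃ v : Fin n → k,
      (∀ p ∈ P, eval v p = 0) ∧
      (Matrix.of fun (i : Fin d) (j : Fin n) => eval v (pderiv j (f i))).rank = d) :
    (Ideal.span (Set.range f)).IsRadical := by
  intro p hp
  by_contra hpI
  have hne : Ideal.Quotient.mk (Ideal.span (Set.range f)) p ≠ 0 := by
    rwa [Ne, Ideal.Quotient.eq_zero_iff_mem]
  obtain ⟨Q, hQ, hle⟩ := exists_le_isAssociatedPrime_of_isNoetherianRing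
    (MvPolynomial (Fin n) k) _ hne
  have hmin := (mem_associatedPrimes_span_iff_mem_minimalPrimes f hdim Q).mp hQ
  have hQp : Q.IsPrime := hmin.1.1
  obtain ⟨v, hv, hr⟩ := hrank Q hmin
  have hpQ : p ∈ Q := (hQp.radical_le_iff.mpr hmin.1.2) hp
  obtain ⟨s, hs, hsp⟩ := exists_mul_mem_span_of_rank_eq hmin hv hr hpQ
  refine hs (hle ?_)
  rw [Submodule.mem_colon_singleton, Submodule.mem_bot, ← Ideal.Quotient.mk_eq_mk,
    ← Submodule.Quotient.mk_smul, smul_eq_mul, Ideal.Quotient.mk_eq_mk,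
    Ideal.Quotient.eq_zero_iff_mem]
  exact hsp

end Radical

section GenericRank

theorem Derivation.map_eval₂ {k A B M : Type*} [CommRing k] [CommRing A] [CommRing B]
    [Algebra k B] [AddCommGroup M] [Module k M] [Module B M] (D : Derivation k B M) (g : A →+* B)
    (hD : ∀ a, D (g a) = 0) (q : Polynomial A) (x : B) :
    D (q.eval₂ g x) = q.derivative.eval₂ g x • D x := by
  induction q using Polynomial.induction_on' with
  | add p q hp hq => simp [Polynomial.eval₂_add, hp, hq, add_smul]
  | monomial m a =>
    rw [Polynomial.eval₂_monomial, Derivation.leibniz, hD, smul_zero, add_zero,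
      Derivation.leibniz_pow, Polynomial.derivative_monomial, Polynomial.eval₂_monomial,
      map_mul, _root_.map_natCast g, ← Nat.cast_smul_eq_nsmul B, smul_smul, smul_smul, mul_assoc]

theorem Derivation.eq_zero_of_isIntegral {k A B M : Type*} [CommRing k] [CommRing A] [IsDomain A]
    [CharZero A] [CommRing B] [IsDomain B] [Algebra k B] [AddCommGroup M] [Module k M] [Module B M]
    (hM : ∀ (b : B) (m : M), b • m = 0 → b = 0 ∨ m = 0)
    (D : Derivation k B M) {g : A →+* B} (hg : Function.Injective g) (hint : g.IsIntegral)
    (hD : ∀ a, D (g a) = 0) : D = 0 := by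
  classical
  ext x
  have hex : ∃ m, ∃ q : Polynomial A, q ≠ 0 ∧ q.eval₂ g x = 0 ∧ q.natDegree = m := by
    obtain ⟨q, hq, hx⟩ := hint x
    exact ⟨_, q, hq.ne_zero, hx, rfl⟩
  obtain ⟨q, hq, hqx, hdeg⟩ := Nat.find_spec hex
  have h := Derivation.map_eval₂ D g hD q x
  rw [hqx, map_zero] at h
  refine (hM _ _ h.symm).resolve_left fun h0 => ?_
  have hpos : q.natDegree ≠ 0 := by
    intro h1
    rw [Polynomial.eq_C_of_natDegree_eq_zero h1, Polynomial.eval₂_C] at hqx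
    refine hq ?_
    rw [Polynomial.eq_C_of_natDegree_eq_zero h1, hg (hqx.trans (map_zero g).symm), map_zero]
  have hne : q.derivative ≠ 0 := fun h1 =>
    hpos (Polynomial.derivative_eq_zero.mp h1)
  have hlt : q.derivative.natDegree < Nat.find hex := by
    rw [← hdeg]; exact Polynomial.natDegree_derivative_lt hpos
  exact Nat.find_min hex hlt ⟨_, hne, h0, rfl⟩

variable {k : Type} [Field k] [CharZero k] {n d s : ℕ}

theorem mkDerivation_eq_sum_pderiv {R M : Type*} [CommRing R] [AddCommGroup M] [Module R M]
    [Module (MvPolynomial (Fin n) R) M] [IsScalarTower R (MvPolynomial (Fin n) R) M]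
    (D : Fin n → M) (p : MvPolynomial (Fin n) R) :
    mkDerivation R D p = ∑ j, pderiv j p • D j := by
  induction p using MvPolynomial.induction_on with
  | C a => simp
  | add p q hp hq => simp [hp, hq, add_smul, Finset.sum_add_distrib]
  | mul_X p i hp =>
    rw [Derivation.leibniz, hp, mkDerivation_X, Finset.smul_sum]
    have : ∀ j : Fin n, (pderiv j (p * X i) : MvPolynomial (Fin n) R) • D j =
        (p * (Pi.single j 1 : Fin n → MvPolynomial (Fin n) R) i) • D j
        + (X i : MvPolynomial (Fin n) R) • (pderiv j p : MvPolynomial (Fin n) R) • D j := by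
      intro j
      rw [Derivation.leibniz, add_smul, pderiv_X, smul_eq_mul, smul_eq_mul, smul_smul]
    simp_rw [this, Finset.sum_add_distrib]
    congr 1
    rw [Finset.sum_eq_single i]
    · simp
    · intro j _ hj
      simp [hj.symm]
    · simp

theorem Derivation.exists_comp_mk {k R M : Type*} [CommRing k] [CommRing R] [Algebra k R]
    (P : Ideal R) [AddCommGroup M] [Module k M] [Module R M] [Module (R ⧸ P) M]
    [IsScalarTower R (R ⧸ P) M]
    (δ : Derivation k R M) (hδ : ∀ p ∈ P, δ p = 0) :
    ∃ D : Derivation k (R ⧸ P) M, ∀ r, D (Ideal.Quotient.mk P r) = δ r := by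
  let l : (R ⧸ P) →ₗ[k] M :=
    ((P.restrictScalars k).liftQ δ.toLinearMap (fun p hp => hδ p hp)).comp
      (Submodule.Quotient.restrictScalarsEquiv k P).symm.toLinearMap
  have hl : ∀ r, l (Ideal.Quotient.mk P r) = δ r := fun r => rfl
  refine ⟨Derivation.mk' l fun a b => ?_, hl⟩
  obtain ⟨a, rfl⟩ := Ideal.Quotient.mk_surjective a
  obtain ⟨b, rfl⟩ := Ideal.Quotient.mk_surjective b
  rw [← map_mul, hl, hl, hl, Derivation.leibniz, ← algebraMap_smul (R ⧸ P) a,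
    ← algebraMap_smul (R ⧸ P) b]
  rfl

theorem exists_forall_rank_eq {P : Ideal (MvPolynomial (Fin n) k)} [P.IsPrime]
    {f : Fin d → MvPolynomial (Fin n) k} (hfP : ∀ i, f i ∈ P)
    (hP : ∀ p ∈ P, ∃ t ∉ P, t * p ∈ Ideal.span (Set.range f)) (hn : n = d + s)
    {g : MvPolynomial (Fin s) k →ₐ[k] MvPolynomial (Fin n) k ⧸ P}
    (hg : Function.Injective g) (hint : g.IsIntegral) :
    ∃ t ∉ P, ∀ v : Fin n → k, (∀ p ∈ P, eval v p = 0) → eval v t ≠ 0 →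
      (Matrix.of fun (i : Fin d) (j : Fin n) => eval v (pderiv j (f i))).rank = d := by
  let R := MvPolynomial (Fin n) k
  let K := FractionRing (R ⧸ P)
  have hKP (r : R) : algebraMap R K r = 0 ↔ r ∈ P := by
    rw [IsScalarTower.algebraMap_apply R (R ⧸ P) K,
      FaithfulSMul.algebraMap_eq_zero_iff, Ideal.Quotient.algebraMap_eq,
      Ideal.Quotient.eq_zero_iff_mem]
  choose y hy using fun l => Ideal.Quotient.mk_surjective (I := P) (g (X l))
  let J : Matrix (Fin d) (Fin n) K := Matrix.of fun i j => algebraMap R K (pderiv j (f i))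
  let T : Matrix (Fin s) (Fin n) K := Matrix.of fun i j => algebraMap R K (pderiv j (y i))
  have hinj : Function.Injective (J.mulVecLin.prod T.mulVecLin) := by
    rw [injective_iff_map_eq_zero]
    intro D hD
    have hJ (i : Fin d) : ∑ j, pderiv j (f i) • D j = 0 := by
      have := congrFun (congrArg Prod.fst hD) i
      simpa [J, Matrix.mulVec, dotProduct, Algebra.smul_def] using this
    have hT (i : Fin s) : ∑ j, pderiv j (y i) • D j = 0 := by
      have := congrFun (congrArg Prod.snd hD) i
      simpa [T, Matrix.mulVec, dotProduct, Algebra.smul_def] using this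
    let δ : Derivation k R K := mkDerivation k D
    have hδf (i : Fin d) : δ (f i) = 0 := by rw [← hJ i]; exact mkDerivation_eq_sum_pderiv D _
    have hδy (i : Fin s) : δ (y i) = 0 := by rw [← hT i]; exact mkDerivation_eq_sum_pderiv D _
    have hsmul {p : R} (hp : p ∈ P) (x : K) : p • x = 0 := by
      rw [Algebra.smul_def, (hKP p).mpr hp, zero_mul]
    have hδI (p : R) (hp : p ∈ Ideal.span (Set.range f)) : δ p = 0 := by
      refine Submodule.span_induction ?_ (map_zero _) ?_ ?_ hp
      rotate_left
      · intro a b _ _ ha hb; rw [map_add, ha, hb, add_zero]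
      · intro a b hb hb'
        rw [smul_eq_mul, Derivation.leibniz, hb', smul_zero, zero_add]
        refine hsmul ?_ _
        exact (Ideal.span_le.mpr (by rintro _ ⟨i, rfl⟩; exact hfP i)) hb
      · rintro _ ⟨i, rfl⟩; exact hδf i
    have hδP (p : R) (hp : p ∈ P) : δ p = 0 := by
      obtain ⟨t, ht, htp⟩ := hP p hp
      have := hδI _ htp
      rw [Derivation.leibniz, hsmul hp, add_zero, Algebra.smul_def, mul_eq_zero] at this
      exact this.resolve_left (mt (hKP t).mp ht)
    obtain ⟨D', hD'⟩ := Derivation.exists_comp_mk P δ hδP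
    have hD'g (a : MvPolynomial (Fin s) k) : D' (g a) = 0 := by
      induction a using MvPolynomial.induction_on with
      | C a => rw [← MvPolynomial.algebraMap_eq, AlgHom.commutes, Derivation.map_algebraMap]
      | add p q hp hq => rw [map_add, map_add, hp, hq, add_zero]
      | mul_X p i hp =>
        rw [map_mul, Derivation.leibniz, hp, ← hy i, hD', hδy, smul_zero, smul_zero, add_zero]
    have h0 : D' = 0 := by
      refine Derivation.eq_zero_of_isIntegral (g := (g : MvPolynomial (Fin s) k →+* R ⧸ P))
        ?_ D' hg hint hD'g
      intro b m hbm
      have h := (Algebra.smul_def (A := K) b m).symm.trans hbm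
      rw [mul_eq_zero] at h
      exact h.imp (fun h => (FaithfulSMul.algebraMap_eq_zero_iff (R ⧸ P) K).mp h) id
    ext j
    have := hD' (X j)
    rw [h0, Derivation.zero_apply] at this
    rw [Pi.zero_apply, this]
    exact (mkDerivation_X k D j).symm
  have hsurj : Function.Surjective J.mulVec := by
    have h1 : Function.Surjective (J.mulVecLin.prod T.mulVecLin) := by
      rw [← LinearMap.injective_iff_surjective_of_finrank_eq_finrank]
      · exact hinj
      · simp [hn]
    intro x
    obtain ⟨w, hw⟩ := h1 (x, 0)
    exact ⟨w, congrArg Prod.fst hw⟩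
  obtain ⟨N, hN⟩ := Matrix.mulVec_surjective_iff_exists_right_inverse.mp hsurj
  obtain ⟨b, hb⟩ := IsLocalization.exist_integer_multiples_of_finite (nonZeroDivisors (R ⧸ P))
    (fun ij : Fin n × Fin d => N ij.1 ij.2)
  choose c hc using hb
  obtain ⟨t, ht⟩ := Ideal.Quotient.mk_surjective (b : R ⧸ P)
  choose N' hN' using fun ij => Ideal.Quotient.mk_surjective (c ij)
  refine ⟨t, ?_, fun v hv hvt => ?_⟩
  · rw [← Ideal.Quotient.eq_zero_iff_mem, ht]
    exact nonZeroDivisors.coe_ne_zero b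
  have hmem (i i' : Fin d) :
      ∑ j, pderiv j (f i) * N' (j, i') - (if i = i' then t else 0) ∈ P := by
    rw [← hKP, map_sub, map_sum, sub_eq_zero]
    have h1 := congrFun (congrFun hN i) i'
    have hNj (j : Fin n) : algebraMap R K (N' (j, i')) = algebraMap R K t * N j i' := by
      have h2 := hc (j, i')
      rw [← hN'] at h2
      refine h2.trans ((Algebra.smul_def (A := K) (b : R ⧸ P) _).trans ?_)
      rw [← ht]
      rfl
    simp_rw [map_mul, hNj]
    calc ∑ j, algebraMap R K (pderiv j (f i)) * (algebraMap R K t * N j i')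
        = algebraMap R K t * (J * N) i i' := by
          rw [Matrix.mul_apply, Finset.mul_sum]
          exact Finset.sum_congr rfl fun j _ => mul_left_comm _ _ _
      _ = _ := by
          rw [hN, Matrix.one_apply]
          split_ifs <;> simp
  set M := Matrix.of fun (i : Fin d) (j : Fin n) => eval v (pderiv j (f i)) with hM
  have hMN : M * (Matrix.of fun j i => (eval v t)⁻¹ * eval v (N' (j, i)) :
      Matrix (Fin n) (Fin d) k) = 1 := by
    ext i i'
    have h1 := hv _ (hmem i i')
    rw [map_sub, map_sum, sub_eq_zero] at h1
    simp_rw [map_mul] at h1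
    rw [Matrix.mul_apply]
    simp only [Matrix.of_apply, hM]
    simp_rw [mul_left_comm _ (eval v t)⁻¹, ← Finset.mul_sum, h1, Matrix.one_apply]
    split_ifs <;> simp [hvt]
  apply le_antisymm
  · simpa using M.rank_le_height
  · have h2 := Matrix.rank_mul_le_left M (Matrix.of fun j i => (eval v t)⁻¹ * eval v (N' (j, i)) :
      Matrix (Fin n) (Fin d) k)
    rw [hMN, Matrix.rank_one, Fintype.card_fin] at h2
    exact h2

end GenericRank

section Averaging

open MeasureTheory

theorem exists_eval_eq_integral {n : ℕ} {U : Type*} [TopologicalSpace U] [CompactSpace U]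
    [MeasurableSpace U] [BorelSpace U] (μ : Measure U) [IsFiniteMeasure μ]
    {ρ : U → Matrix (Fin n) (Fin n) ℂ} (hρ : Continuous ρ) (h : MvPolynomial (Fin n) ℂ) :
    ∃ h' : MvPolynomial (Fin n) ℂ, ∀ x, eval x h' = ∫ u, eval (Matrix.mulVec (ρ u) x) h ∂μ := by
  let r (i j : Fin n) : C(U, ℂ) := ⟨fun u => ρ u i j, hρ.matrix_elem i j⟩
  let H : MvPolynomial (Fin n) C(U, ℂ) :=
    eval₂ (C.comp (algebraMap ℂ C(U, ℂ))) (fun i => ∑ j, C (r i j) * X j) h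
  let e (u : U) : C(U, ℂ) →+* ℂ := (ContinuousMap.evalAlgHom ℂ ℂ u : C(U, ℂ) →ₐ[ℂ] ℂ)
  have hH (u : U) (x : Fin n → ℂ) : eval₂ (e u) x H = eval (Matrix.mulVec (ρ u) x) h := by
    have : (eval₂Hom (e u) x).comp
        (eval₂Hom (C.comp (algebraMap ℂ C(U, ℂ))) (fun i => ∑ j, C (r i j) * X j)) =
        eval (Matrix.mulVec (ρ u) x) := by
      apply MvPolynomial.ringHom_ext
      · intro a
        simp [e]
      · intro i
        simp [e, r, Matrix.mulVec, dotProduct]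
    exact congrArg (fun F => F h) this
  refine ⟨∑ m ∈ H.support, monomial m (∫ u, coeff m H u ∂μ), fun x => ?_⟩
  simp_rw [← hH, eval₂_eq]
  rw [map_sum, integral_finsetSum]
  · refine Finset.sum_congr rfl fun m _ => ?_
    rw [eval_monomial, ← integral_mul_const]
    rfl
  · intro m _
    refine Continuous.integrable_of_hasCompactSupport ?_ (HasCompactSupport.of_compactSpace _)
    exact (coeff m H).continuous.mul continuous_const

theorem IsReductiveGroup.exists_invariant {n : ℕ} {G : Set (Matrix (Fin n) (Fin n) ℂ)}
    (hG : IsReductiveGroup ℂ n G) (h : MvPolynomial (Fin n) ℂ) :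
    ∃ p, Invariant ℂ n G p ∧
      ∀ (x : Fin n → ℂ) (c : ℂ), (∀ g ∈ G, eval (Matrix.mulVec g x) h = c) → eval x p = c := by
  obtain ⟨-, -, K, hKG, hKc, ⟨h1, hmul, hinv⟩, hdense⟩ := hG
  let : Group K :=
    { mul := fun a b => ⟨a.1 * b.1, hmul _ a.2 _ b.2⟩
      one := ⟨1, h1⟩
      inv := fun a => ⟨a.1⁻¹, (hinv _ a.2).2⟩
      mul_assoc := fun a b c => Subtype.ext (mul_assoc _ _ _)
      one_mul := fun a => Subtype.ext (one_mul _)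
      mul_one := fun a => Subtype.ext (mul_one _)
      inv_mul_cancel := fun a => Subtype.ext
        (Matrix.nonsing_inv_mul _ ((Matrix.isUnit_iff_isUnit_det _).mp (hinv _ a.2).1)) }
  have hcoe_mul (a b : K) : ((a * b : K) : Matrix (Fin n) (Fin n) ℂ) = a.1 * b.1 := rfl
  have hcont : Continuous fun a : K => (a.1)⁻¹ := by
    simp_rw [Matrix.inv_def, Ring.inverse_eq_inv']
    refine Continuous.smul (Continuous.inv₀ continuous_subtype_val.matrix_det fun a => ?_)
      continuous_subtype_val.matrix_adjugate
    exact ((Matrix.isUnit_iff_isUnit_det _).mp (hinv _ a.2).1).ne_zero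
  have : IsTopologicalGroup K :=
    { continuous_mul := ((continuous_subtype_val.comp continuous_fst).mul
        (continuous_subtype_val.comp continuous_snd)).subtype_mk _
      continuous_inv := hcont.subtype_mk _ }
  have : CompactSpace K := isCompact_iff_compactSpace.mp hKc
  let : MeasurableSpace K := borel K
  have : BorelSpace K := ⟨rfl⟩
  let μ : Measure K := Measure.haarMeasure (⊤ : TopologicalSpace.PositiveCompacts K)
  have hμ : μ Set.univ = 1 := Measure.haarMeasure_self
  have : IsProbabilityMeasure μ := ⟨hμ⟩
  obtain ⟨p, hp⟩ := exists_eval_eq_integral μ hcont h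
  have hpK (g : K) (x : Fin n → ℂ) : eval (Matrix.mulVec g.1 x) p = eval x p := by
    rw [hp, hp, ← integral_mul_left_eq_self _ g]
    refine integral_congr_ae (Filter.Eventually.of_forall fun u => ?_)
    have hu : ((g * u : K).1)⁻¹ * g.1 = u.1⁻¹ := by
      have : (g * u)⁻¹ * g = u⁻¹ := by group
      exact congrArg Subtype.val this
    simp only
    rw [Matrix.mulVec_mulVec, hu]
  refine ⟨p, fun g hg x => ?_, fun x c hx => ?_⟩
  · let q : MvPolynomial (Fin n × Fin n) ℂ :=
      eval₂ C (fun i => ∑ j, X (i, j) * C (x j)) p - C (eval x p)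
    have hq (a : Matrix (Fin n) (Fin n) ℂ) :
        eval (fun ij => a ij.1 ij.2) q = eval (Matrix.mulVec a x) p - eval x p := by
      have : (eval fun ij : Fin n × Fin n => a ij.1 ij.2).comp
          (eval₂Hom C (fun i => ∑ j, X (i, j) * C (x j))) = eval (Matrix.mulVec a x) := by
        apply MvPolynomial.ringHom_ext
        · intro a; simp
        · intro i; simp [Matrix.mulVec, dotProduct]
      rw [map_sub, eval_C, ← this]
      rfl
    have := hdense q (fun a ha => by rw [hq, hpK ⟨a, ha⟩ x, sub_self]) g hg
    rwa [hq, sub_eq_zero] at this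
  · rw [hp]
    have (u : K) : eval (Matrix.mulVec (u.1)⁻¹ x) h = c := hx _ (hKG (hinv _ u.2).2)
    simp [this]

theorem zeroSet_invariantIdeal_eq {n : ℕ} {G : Set (Matrix (Fin n) (Fin n) ℂ)}
    (hG : IsReductiveGroup ℂ n G) {Y : Set (Fin n → ℂ)} (hYalg : IsAlgebraicSet ℂ n Y)
    (hYstab : Stabilizes ℂ n G Y) (hsat : IsSaturated ℂ n G Y) :
    zeroSet ℂ n (invariantIdeal ℂ n G Y : Set (MvPolynomial (Fin n) ℂ)) = Y := by
  apply Set.Subset.antisymm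
  swap
  · intro y hy p hp
    have hle : invariantIdeal ℂ n G Y ≤ vanishingIdeal ℂ n Y :=
      Ideal.span_le.mpr fun p hp => hp.2
    exact hle hp y hy
  intro v hv
  by_contra hvY
  let W : Ideal (MvPolynomial (Fin n) ℂ) :=
    Ideal.span {q | ∃ p, Invariant ℂ n G p ∧ q = p - C (eval v p)}
  have hempty : zeroLocus ℂ (vanishingIdeal ℂ n Y ⊔ W) = ∅ := by
    rw [Set.eq_empty_iff_forall_notMem]
    intro y hy
    rw [mem_zeroLocus_iff] at hy
    have hyY : y ∈ Y := by
      obtain ⟨S, rfl⟩ := hYalg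
      intro p hp
      have := hy p (Ideal.mem_sup_left fun x hx => hx p hp)
      rwa [aeval_eq_eval] at this
    refine hvY ?_
    rw [hsat]
    refine ⟨y, hyY, fun p hp => ?_⟩
    have := hy _ (Ideal.mem_sup_right (Ideal.subset_span ⟨p, hp, rfl⟩))
    rw [aeval_eq_eval] at this
    simp [sub_eq_zero] at this
    exact this.symm
  have htop : (1 : MvPolynomial (Fin n) ℂ) ∈ vanishingIdeal ℂ n Y ⊔ W := by
    have h1 := vanishingIdeal_zeroLocus_eq_radical (K := ℂ) (vanishingIdeal ℂ n Y ⊔ W)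
    rw [hempty, vanishingIdeal_empty] at h1
    rw [← Ideal.eq_top_iff_one, ← Ideal.radical_eq_top, ← h1]
  obtain ⟨h, hh, w, hw, hhw⟩ := Submodule.mem_sup.mp htop
  have hw0 : ∀ g ∈ G, eval (Matrix.mulVec g v) w = 0 := by
    intro g hg
    have : W ≤ RingHom.ker (eval (Matrix.mulVec g v)) := by
      refine Ideal.span_le.mpr ?_
      rintro _ ⟨p, hp, rfl⟩
      simp [RingHom.mem_ker, hp g hg v]
    exact this hw
  obtain ⟨p, hp, hpc⟩ := hG.exists_invariant h
  have hpv : eval v p = 1 := hpc v 1 fun g hg => by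
    have := congrArg (eval (Matrix.mulVec g v)) hhw
    simpa [hw0 g hg] using this
  have hpY : ∀ y ∈ Y, eval y p = 0 := fun y hy => hpc y 0 fun g hg => hh _ (hYstab g hg y hy)
  have := hv p (Ideal.subset_span ⟨hp, hpY⟩)
  rw [hpv] at this
  exact one_ne_zero this

end Averaging

theorem Ideal.IsRadical.exists_mul_mem_of_mem_minimalPrimes {R : Type*} [CommRing R]
    {I P : Ideal R} (hI : I.IsRadical) (hP : P ∈ I.minimalPrimes) {p : R} (hp : p ∈ P) :
    ∃ t ∉ P, t * p ∈ I := by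
  have : P.IsPrime := hP.1.1
  by_contra! hcon
  have hdisj : Disjoint (I : Set R) (P.primeCompl ⊔ Submonoid.powers p : Submonoid R) := by
    rw [Set.disjoint_left]
    intro x hxI hx
    obtain ⟨t, ht, _, ⟨m, rfl⟩, rfl⟩ := Submonoid.mem_sup.mp hx
    refine hcon t ht (hI ⟨m + 1, ?_⟩)
    rw [show (t * p) ^ (m + 1) = t ^ m * p * (t * p ^ m) by ring]
    exact I.mul_mem_left _ hxI
  obtain ⟨Q, hQ, hIQ, hdQ⟩ := Ideal.exists_le_prime_disjoint I _ hdisj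
  rw [Set.disjoint_left] at hdQ
  have hQP : Q ≤ P := fun x hx => by
    by_contra hxP
    exact hdQ hx (Submonoid.mem_sup_left hxP)
  exact hdQ (hP.2 ⟨hQ, hIQ⟩ hQP hp) (Submonoid.mem_sup_right (Submonoid.mem_powers p))

section Components

variable {n : ℕ}

theorem vanishingIdeal_zeroSet (I : Ideal (MvPolynomial (Fin n) ℂ)) :
    vanishingIdeal ℂ n (zeroSet ℂ n (I : Set (MvPolynomial (Fin n) ℂ))) = I.radical := by
  rw [← MvPolynomial.vanishingIdeal_zeroLocus_eq_radical (K := ℂ)]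
  ext p
  rw [mem_vanishingIdeal_iff]
  rfl

theorem isIrredComponentOf_zeroSet {I P : Ideal (MvPolynomial (Fin n) ℂ)}
    (hP : P ∈ I.minimalPrimes) :
    IsIrredComponentOf ℂ n (zeroSet ℂ n (I : Set (MvPolynomial (Fin n) ℂ)))
      (zeroSet ℂ n (P : Set (MvPolynomial (Fin n) ℂ))) := by
  have hPp : P.IsPrime := hP.1.1
  have hvan := vanishingIdeal_zeroSet P
  rw [hPp.radical] at hvan
  refine ⟨⟨⟨_, rfl⟩, ?_, by rwa [hvan]⟩, fun v hv p hp => hv p (hP.1.2 hp), ?_⟩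
  · rw [Set.nonempty_iff_ne_empty]
    intro h
    rw [h] at hvan
    refine hPp.ne_top ((Ideal.eq_top_iff_one _).mpr ?_)
    rw [← hvan]
    exact fun x hx => hx.elim
  · intro Z' ⟨hZ'alg, _, hZ'p⟩ hsub hZ'
    refine Set.Subset.antisymm ?_ hsub
    have h1 : vanishingIdeal ℂ n Z' ≤ P := by
      rw [← hvan]; exact fun p hp x hx => hp x (hsub hx)
    have h2 : I ≤ vanishingIdeal ℂ n Z' := fun p hp x hx => hZ' hx p hp
    exact fun v hv p hp => hP.2 ⟨hZ'p, h2⟩ h1 hp v hv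

theorem IsIrredComponentOf.vanishingIdeal_mem_minimalPrimes
    {I : Ideal (MvPolynomial (Fin n) ℂ)} {Z : Set (Fin n → ℂ)}
    (hZ : IsIrredComponentOf ℂ n (zeroSet ℂ n (I : Set (MvPolynomial (Fin n) ℂ))) Z) :
    vanishingIdeal ℂ n Z ∈ I.minimalPrimes := by
  obtain ⟨⟨hZalg, -, hZp⟩, hZsub, hmax⟩ := hZ
  have hle : I ≤ vanishingIdeal ℂ n Z := fun p hp x hx => hZsub hx p hp
  obtain ⟨Q, hQ, hQle⟩ := Ideal.exists_minimalPrimes_le hle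
  have h := isIrredComponentOf_zeroSet hQ
  have hsub : Z ⊆ zeroSet ℂ n (Q : Set (MvPolynomial (Fin n) ℂ)) :=
    fun v hv p hp => hQle hp v hv
  have heq := hmax _ h.1 hsub h.2.1
  rw [← heq, vanishingIdeal_zeroSet, hQ.1.1.radical]
  exact hQ

end Components

/-- **Proposition 2.3(2).** Let `G` be a complex reductive group, `V = ℂⁿ` a `G`-module and
`Y ⊆ V` a `G`-saturated algebraic subset.  Suppose `I_G(Y)` is generated by invariants
`f_1, …, f_d` where `d` is the codimension of `Y` in `V`.  Then `Y` is `G`-reduced if and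
only if for every irreducible component `Z` of `Y` there is a point of `Z` where the rank of
the differential of `f = (f_1, …, f_d) : V → ℂ^d` equals the codimension of `Z`. -/
theorem G_reduced_iff_rank_eq_codim
    (n : ℕ) (G : Set (Matrix (Fin n) (Fin n) ℂ)) (hG : IsReductiveGroup ℂ n G)
    (Y : Set (Fin n → ℂ)) (hYalg : IsAlgebraicSet ℂ n Y) (hYstab : Stabilizes ℂ n G Y)
    (hsat : IsSaturated ℂ n G Y)
    (d : ℕ) (f : Fin d → MvPolynomial (Fin n) ℂ) (hf : ∀ i, Invariant ℂ n G (f i))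
    (hgen : invariantIdeal ℂ n G Y = Ideal.span (Set.range f))
    (hcodim : adim ℂ n Y + (d : WithBot ℕ∞) = (n : WithBot ℕ∞)) :
    IsGReduced ℂ n G Y ↔
      ∀ Z : Set (Fin n → ℂ), IsIrredComponentOf ℂ n Y Z →
        ∃ v ∈ Z, adim ℂ n Z + ((jacRank ℂ n f v : ℕ∞) : WithBot ℕ∞) = (n : WithBot ℕ∞) := by
  set I := Ideal.span (Set.range f) with hI
  have hzero : zeroSet ℂ n (I : Set (MvPolynomial (Fin n) ℂ)) = Y := by
    rw [← hgen]; exact zeroSet_invariantIdeal_eq hG hYalg hYstab hsat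
  have hrad : vanishingIdeal ℂ n Y = I.radical := by rw [← hzero, vanishingIdeal_zeroSet]
  have hdim (Q : Ideal (MvPolynomial (Fin n) ℂ)) (hQ : Q.IsPrime) (hIQ : I ≤ Q) :
      ringKrullDim (MvPolynomial (Fin n) ℂ ⧸ Q) + (d : WithBot ℕ∞) ≤ n := by
    rw [← hcodim, adim]
    have hle : vanishingIdeal ℂ n Y ≤ Q := by rw [hrad]; exact hQ.radical_le_iff.mpr hIQ
    gcongr
    exact ringKrullDim_le_of_surjective (Ideal.Quotient.factor hle)
      (Ideal.Quotient.factor_surjective hle)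
  have hnoether (P : Ideal (MvPolynomial (Fin n) ℂ)) (hP : P ∈ I.minimalPrimes) :=
    exists_noether_of_mem_associatedPrimes_span f hdim P
      ((mem_associatedPrimes_span_iff_mem_minimalPrimes f hdim P).mpr hP)
  rw [IsGReduced, hgen]
  constructor
  · intro hred Z hZ
    rw [← hzero] at hZ
    have hP := hZ.vanishingIdeal_mem_minimalPrimes
    have hprime : (vanishingIdeal ℂ n Z).IsPrime := hP.1.1
    obtain ⟨s, hn, hs, g, hg, hint⟩ := hnoether _ hP
    have hIrad : I.IsRadical := by
      rw [← Ideal.radical_eq_iff, ← hrad, ← hred]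
    obtain ⟨t, ht, hrank⟩ := exists_forall_rank_eq
      (fun i => hP.1.2 (Ideal.subset_span (Set.mem_range_self i)))
      (fun p hp => Ideal.IsRadical.exists_mul_mem_of_mem_minimalPrimes hIrad hP hp) hn hg hint
    obtain ⟨v, hv, hvt⟩ : ∃ v ∈ Z, eval v t ≠ 0 := by
      by_contra! hcon
      exact ht hcon
    refine ⟨v, hv, ?_⟩
    rw [jacRank, hrank v (fun p hp => hp v hv) hvt, adim, hs, hn]
    push_cast
    exact add_comm _ _
  · intro hrank
    have hIrad : I.IsRadical := by
      refine isRadical_span_of_rank_eq hdim fun P hP => ?_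
      have hcomp := isIrredComponentOf_zeroSet hP
      rw [hzero] at hcomp
      obtain ⟨v, hv, hvr⟩ := hrank _ hcomp
      obtain ⟨s, hn, hs, -⟩ := hnoether P hP
      refine ⟨v, fun p hp => hv p hp, ?_⟩
      rw [adim, vanishingIdeal_zeroSet, hP.1.1.radical, hs] at hvr
      have h : s + jacRank ℂ n f v = n := by exact_mod_cast hvr
      exact (Nat.add_left_cancel (h.trans (hn.trans (add_comm d s))) : jacRank ℂ n f v = d)
    rw [hrad, hIrad.radical]

end ZPaper
end
end
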